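/- arXiv:2008.02019 — 3 statements merged into one kernel-verified Lean document; each statement's English description precedes it below -/
import Mathlib

section
/- Let k ≥ 2 be an integer and let ℓ = (l_1, …, l_m) with m ≥ 3 be the segment sequence of some tree. Then there exists a tree T with segment sequence ℓ that maximizes the Steiner k-Wiener index SW_k among all trees with segment sequence ℓ and that is a quasi-caterpillar with the following property: if s_1, s_2, …, s_{c'} are the lengths of its pendant segments, listed in non-decreasing order of the distance of their branch-vertex endpoints from one fixed end of the backbone (two pendant segments at the same branch vertex being listed consecutively in a suitable order), then there is an index j' ∈ {1, …, c'} with s_1 ≥ s_2 ≥ ⋯ ≥ s_{j'} ≤ s_{j'+1} ≤ ⋯ ≤ s_{c'}. -/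
open SimpleGraph Finset

noncomputable def steinerDist {V : Type*} (G : SimpleGraph V) (S : Finset V) : ℕ :=
  sInf {n | ∃ H : G.Subgraph, H.Connected ∧ ↑S ⊆ H.verts ∧ H.edgeSet.ncard = n}

noncomputable def steinerWiener {V : Type*} [Fintype V] (G : SimpleGraph V) (k : ℕ) : ℕ :=
  ∑ S ∈ Finset.powersetCard k (Finset.univ : Finset V), steinerDist G S

noncomputable def degN {V : Type*} (G : SimpleGraph V) (v : V) : ℕ := (G.neighborSet v).ncard

def IsLeafV {V : Type*} (G : SimpleGraph V) (v : V) : Prop := degN G v = 1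

def IsBranchV {V : Type*} (G : SimpleGraph V) (v : V) : Prop := 3 ≤ degN G v

def IsSegment {V : Type*} (G : SimpleGraph V) (u v : V) : Prop :=
  u ≠ v ∧ (IsLeafV G u ∨ IsBranchV G u) ∧ (IsLeafV G v ∨ IsBranchV G v) ∧
    ∃ w : G.Walk u v, w.IsPath ∧ ∀ x ∈ w.support, x ≠ u → x ≠ v → degN G x = 2

noncomputable def segmentMultiset {V : Type*} [Fintype V] (G : SimpleGraph V) : Multiset ℕ :=
  ((Set.toFinite {e : Sym2 V | ∃ u v, e = s(u, v) ∧ IsSegment G u v}).toFinset).val.map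
    (Sym2.lift ⟨fun u v => G.dist u v, fun _ _ => SimpleGraph.dist_comm⟩)

/-- A graph is a path graph if it has a Hamiltonian path. -/
def IsPathGraph {V : Type*} (G : SimpleGraph V) : Prop :=
  ∃ (u v : V) (w : G.Walk u v), w.IsPath ∧ ∀ x, x ∈ w.support

/-- The set of vertices lying on pendant segments, other than branch-vertex endpoints. -/
def pendantSegmentVertices {V : Type*} (G : SimpleGraph V) : Set V :=
  {x | ∃ (u v : V) (w : G.Walk u v), IsSegment G u v ∧ IsLeafV G u ∧ w.IsPath ∧
      (∀ y ∈ w.support, y ≠ u → y ≠ v → degN G y = 2) ∧ x ∈ w.support ∧ ¬ IsBranchV G x}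

/-- A quasi-caterpillar: a tree such that deleting all vertices of its pendant segments other
than their branch-vertex endpoints results in a path. -/
def IsQuasiCaterpillar {V : Type*} [Fintype V] (G : SimpleGraph V) : Prop :=
  G.IsTree ∧ IsPathGraph (G.induce (pendantSegmentVertices G)ᶜ)

/-- A backbone: a longest path containing all branch vertices. -/
def IsBackbone {V : Type*} (G : SimpleGraph V) {u v : V} (w : G.Walk u v) : Prop :=
  w.IsPath ∧ (∀ x, IsBranchV G x → x ∈ w.support) ∧
    ∀ (a b : V) (w' : G.Walk a b), w'.IsPath →
      (∀ x, IsBranchV G x → x ∈ w'.support) → w'.length ≤ w.length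

/-- `A` is one of the two sides into which removing the edge `e` splits the graph: `e` is the only
edge with exactly one endpoint in `A`. -/
def IsCut {V : Type*} (T : SimpleGraph V) (e : Sym2 V) (A : Set V) : Prop :=
  e ∈ T.edgeSet ∧ ∀ p q, T.Adj p q → ((p ∈ A ↔ q ∈ A) ↔ s(p, q) ≠ e)

/-- The part of `T` reached from `a` through its neighbour `b`. -/
def branchAt {V : Type*} (T : SimpleGraph V) (a b : V) : Set V :=
  {z | (T.deleteEdges {s(a, b)}).Reachable b z}

section Cuts

variable {V : Type*} {T : SimpleGraph V}

lemma eq_univ_of_closed (hT : T.Connected) {A : Set V}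
    (h : ∀ p q, T.Adj p q → p ∈ A → q ∈ A) {x : V} (hx : x ∈ A) : A = Set.univ := by
  refine Set.eq_univ_of_forall fun y => ?_
  obtain ⟨w⟩ := hT.preconnected x y
  induction w with
  | nil => exact hx
  | cons hadj _ ih => exact ih (h _ _ hadj hx)

lemma IsCut.compl {e : Sym2 V} {A : Set V} (h : IsCut T e A) : IsCut T e Aᶜ :=
  ⟨h.1, fun p q hpq => by rw [← h.2 p q hpq]; simp only [Set.mem_compl_iff]; tauto⟩

lemma IsCut.eq_or_eq_compl (hT : T.Connected) {e : Sym2 V} {A B : Set V} (hA : IsCut T e A)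
    (hB : IsCut T e B) : B = A ∨ B = Aᶜ := by
  have key : ∀ C : Set V, IsCut T e C → (∃ x, x ∈ A ∧ x ∈ C) → C = A := by
    rintro C hC ⟨x, hxA, hxC⟩
    have := eq_univ_of_closed (T := T) (A := {z | z ∈ A ↔ z ∈ C}) hT
      (fun p q hpq hp => by
        have h1 := hA.2 p q hpq
        have h2 := hC.2 p q hpq
        simp only [Set.mem_ofPred_eq] at hp ⊢
        tauto) (x := x) (by simp [hxA, hxC])
    ext z
    have hz : z ∈ {z | z ∈ A ↔ z ∈ C} := this ▸ Set.mem_univ z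
    exact hz.symm
  by_cases h : ∃ x, x ∈ A ∧ x ∈ B
  · exact Or.inl (key B hB h)
  · right
    obtain ⟨p, q⟩ := e
    have h1 := (hA.2 p q hA.1)
    have : ∃ x, x ∈ A := by
      by_contra hne
      push Not at hne
      exact (h1.1 (by simp [hne])) rfl
    obtain ⟨x, hx⟩ := this
    have hxB : x ∉ B := fun hb => h ⟨x, hx, hb⟩
    rw [← key Bᶜ hB.compl ⟨x, hx, hxB⟩, compl_compl]

lemma IsCut.eq_of_mem (hT : T.Connected) {e : Sym2 V} {A B : Set V} (hA : IsCut T e A)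
    (hB : IsCut T e B) {x : V} (hxA : x ∈ A) (hxB : x ∈ B) : B = A := by
  rcases hA.eq_or_eq_compl hT hB with h | h
  · exact h
  · exact absurd hxA (by rw [h] at hxB; exact hxB)

lemma IsCut.mem_iff {e : Sym2 V} {A : Set V} (hA : IsCut T e A) {p q : V} (h : T.Adj p q)
    (hne : s(p, q) ≠ e) : p ∈ A ↔ q ∈ A := (hA.2 p q h).2 hne

lemma IsCut.eq_of_crossing {e : Sym2 V} {A : Set V} (hA : IsCut T e A) {p q : V} (h : T.Adj p q)
    (hp : p ∈ A) (hq : q ∉ A) : s(p, q) = e := by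
  by_contra hne
  exact hq ((hA.mem_iff h hne).1 hp)

lemma IsCut.exists_crossing {e : Sym2 V} {A : Set V} (hA : IsCut T e A) :
    ∃ p q, T.Adj p q ∧ e = s(p, q) ∧ p ∈ A ∧ q ∉ A := by
  obtain ⟨p, q⟩ := e
  have h1 := hA.2 p q hA.1
  by_cases hp : p ∈ A
  · refine ⟨p, q, hA.1, rfl, hp, fun hq => (h1.1 (by simp [hp, hq])) rfl⟩
  · refine ⟨q, p, (show T.Adj p q from hA.1).symm, Sym2.eq_swap, ?_, hp⟩
    by_contra hq
    exact (h1.1 (by simp [hp, hq])) rfl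

lemma IsCut.subset_or_subset_compl (hT : T.Connected) {e : Sym2 V} {A B : Set V} {a b : V}
    (hA : IsCut T e A) (hB : IsCut T s(a, b) B) (ha : a ∉ A) (hb : b ∉ A) :
    A ⊆ B ∨ A ⊆ Bᶜ := by
  obtain ⟨p, q, hpq, he, hp, hq⟩ := hA.exists_crossing
  have key : ∀ C : Set V, IsCut T s(a, b) C → p ∈ C → A ⊆ C := by
    intro C hC hpC x hx
    by_contra hxC
    have := eq_univ_of_closed (T := T) (A := A \ C) hT (fun r t hrt hr => by
      have hab : s(r, t) ≠ s(a, b) := by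
        intro h
        rcases Sym2.eq_iff.1 h with ⟨rfl, rfl⟩ | ⟨rfl, rfl⟩
        · exact ha hr.1
        · exact hb hr.1
      refine ⟨?_, fun ht => hr.2 ((hC.mem_iff hrt hab).2 ht)⟩
      by_contra htA
      have := hA.eq_of_crossing hrt hr.1 htA
      rw [he] at this
      rcases Sym2.eq_iff.1 this with ⟨rfl, rfl⟩ | ⟨rfl, rfl⟩
      · exact hr.2 hpC
      · exact hq hr.1) (x := x) ⟨hx, hxC⟩
    exact hq (this ▸ Set.mem_univ q : q ∈ A \ C).1
  by_cases hpB : p ∈ B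
  · exact Or.inl (key B hB hpB)
  · exact Or.inr (key Bᶜ hB.compl hpB)

lemma IsCut.mem_edges {e : Sym2 V} {A : Set V} (hA : IsCut T e A) {x y : V} (w : T.Walk x y)
    (hx : x ∈ A) (hy : y ∉ A) : e ∈ w.edges := by
  induction w with
  | nil => exact absurd hx hy
  | @cons u v _ hadj p ih =>
    by_cases hv : v ∈ A
    · exact List.mem_cons_of_mem _ (ih hv hy)
    · rw [← hA.eq_of_crossing hadj hx hv]
      simp

lemma IsCut.mem_edges_of_iff {e : Sym2 V} {A : Set V} (hA : IsCut T e A) {x y : V}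
    (w : T.Walk x y) (h : ¬(x ∈ A ↔ y ∈ A)) : e ∈ w.edges := by
  by_cases hx : x ∈ A
  · exact hA.mem_edges w hx (fun hy => h (by simp [hx, hy]))
  · exact hA.compl.mem_edges w hx (fun hy => h (by simp only [Set.mem_compl_iff] at hy; tauto))

/-- A path cannot leave a side of a cut and come back. -/
lemma IsCut.false_of_append_isPath {e : Sym2 V} {A : Set V} (hA : IsCut T e A) {a y c x z : V}
    {p : T.Walk a y} {q : T.Walk y c} (hpq : (p.append q).IsPath) (hx : x ∈ p.support)
    (hz : z ∈ q.support) (hxy : ¬(x ∈ A ↔ y ∈ A)) (hyz : ¬(y ∈ A ↔ z ∈ A)) : False := by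
  classical
  have h1 := p.edges_dropUntil_subset_edges hx (hA.mem_edges_of_iff (p.dropUntil x hx) hxy)
  have h2 := q.edges_takeUntil_subset_edges hz (hA.mem_edges_of_iff (q.takeUntil z hz) hyz)
  have := hpq.isTrail.edges_nodup
  rw [Walk.edges_append] at this
  exact (List.disjoint_of_nodup_append this) h1 h2

lemma notMem_branchAt (hT : T.IsTree) {a b : V} (h : T.Adj a b) : a ∉ branchAt T a b := by
  have := isAcyclic_iff_forall_adj_isBridge.1 hT.2 h
  rw [isBridge_iff] at this
  exact fun h' => this h'.symm

lemma mem_branchAt (a b : V) : b ∈ branchAt T a b := Reachable.refl _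

lemma isCut_branchAt (hT : T.IsTree) {a b : V} (h : T.Adj a b) :
    IsCut T s(a, b) (branchAt T a b) := by
  refine ⟨h, fun p q hpq => ⟨?_, fun hne => ?_⟩⟩
  · intro hiff heq
    have ha := notMem_branchAt hT h
    have hb := mem_branchAt (T := T) a b
    rcases Sym2.eq_iff.1 heq with ⟨rfl, rfl⟩ | ⟨rfl, rfl⟩ <;> tauto
  · have hadj : (T.deleteEdges {s(a, b)}).Adj p q := by
      simp [deleteEdges_adj, hpq, hne]
    exact ⟨fun hp => Reachable.trans hp hadj.reachable,
      fun hq => Reachable.trans hq hadj.symm.reachable⟩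

lemma branchAt_swap (hT : T.IsTree) {a b : V} (h : T.Adj a b) :
    branchAt T b a = (branchAt T a b)ᶜ := by
  have h1 := isCut_branchAt hT h
  have h2 := isCut_branchAt hT h.symm
  rw [Sym2.eq_swap] at h2
  exact h1.compl.eq_of_mem hT.1 h2 (notMem_branchAt hT h) (mem_branchAt _ _)

lemma notMem_branchAt_of_adj (hT : T.IsTree) {a b c : V} (hb : T.Adj a b) (hc : T.Adj a c)
    (hne : b ≠ c) : c ∉ branchAt T a b := by
  have h := (isCut_branchAt hT hb).mem_iff hc (by
    intro h
    rcases Sym2.eq_iff.1 h with ⟨_, h⟩ | ⟨h, _⟩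
    · exact hne h.symm
    · exact hb.ne h)
  exact fun hc' => notMem_branchAt hT hb (h.2 hc')

lemma disjoint_branchAt (hT : T.IsTree) {a b c : V} (hb : T.Adj a b) (hc : T.Adj a c)
    (hne : b ≠ c) : Disjoint (branchAt T a b) (branchAt T a c) := by
  rcases (isCut_branchAt hT hb).subset_or_subset_compl hT.1 (isCut_branchAt hT hc)
    (notMem_branchAt hT hb) (notMem_branchAt_of_adj hT hb hc hne) with h | h
  · exact absurd (h (mem_branchAt _ _)) (notMem_branchAt_of_adj hT hc hb hne.symm)
  · exact Set.subset_compl_iff_disjoint_right.1 h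

lemma eq_of_mem_branchAt (hT : T.IsTree) {a b c z : V} (hb : T.Adj a b) (hc : T.Adj a c)
    (h1 : z ∈ branchAt T a b) (h2 : z ∈ branchAt T a c) : b = c := by
  by_contra hne
  exact Set.disjoint_left.1 (disjoint_branchAt hT hb hc hne) h1 h2

lemma exists_mem_branchAt (hT : T.IsTree) {a z : V} (h : z ≠ a) :
    ∃ b, T.Adj a b ∧ z ∈ branchAt T a b := by
  have := eq_univ_of_closed (T := T) (A := {z | z = a ∨ ∃ b, T.Adj a b ∧ z ∈ branchAt T a b}) hT.1
    (fun p q hpq hp => by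
      by_cases hq : q = a
      · exact Or.inl hq
      right
      rcases hp with rfl | ⟨b, hb, hp⟩
      · exact ⟨q, hpq, mem_branchAt _ _⟩
      · refine ⟨b, hb, ((isCut_branchAt hT hb).mem_iff hpq ?_).1 hp⟩
        intro h
        rcases Sym2.eq_iff.1 h with ⟨rfl, _⟩ | ⟨_, h⟩
        · exact notMem_branchAt hT hb hp
        · exact hq h) (x := a) (Or.inl rfl)
  have hz : z ∈ {z | z = a ∨ ∃ b, T.Adj a b ∧ z ∈ branchAt T a b} := this ▸ Set.mem_univ z
  exact hz.resolve_left h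

lemma branchAt_subset_of_notMem (hT : T.IsTree) {a b c d : V} (hab : T.Adj a b) (hcd : T.Adj c d)
    (hc : c ∈ branchAt T a b) (ha : a ∉ branchAt T c d) :
    branchAt T c d ⊆ branchAt T a b := by
  by_cases hb : b ∈ branchAt T c d
  · exfalso
    have h1 := (isCut_branchAt hT hcd).eq_of_crossing hab.symm hb ha
    rcases Sym2.eq_iff.1 h1 with ⟨rfl, rfl⟩ | ⟨rfl, rfl⟩
    · exact notMem_branchAt hT hcd hb
    · exact notMem_branchAt hT hab hc
  rcases (isCut_branchAt hT hcd).subset_or_subset_compl hT.1 (isCut_branchAt hT hab) ha hb with h | h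
  · exact h
  · exfalso
    have hd : d ∉ branchAt T a b := h (mem_branchAt _ _)
    have h1 := (isCut_branchAt hT hab).eq_of_crossing hcd hc hd
    rcases Sym2.eq_iff.1 h1 with ⟨rfl, rfl⟩ | ⟨rfl, rfl⟩
    · exact notMem_branchAt hT hab hc
    · exact ha (mem_branchAt _ _)

lemma IsCut.subset_branchAt (hT : T.IsTree) {e : Sym2 V} {A : Set V} (hA : IsCut T e A)
    {c n v : V} (hcn : T.Adj c n) (hv : v ∈ branchAt T c n) (hvA : v ∈ A) (hc : c ∉ A) :
    A ⊆ branchAt T c n := by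
  by_cases hn : n ∈ A
  · have := hA.eq_of_crossing hcn.symm hn hc
    rw [Sym2.eq_swap] at this
    subst this
    exact ((isCut_branchAt hT hcn).eq_of_mem hT.1 hA hv hvA).subset
  · rcases hA.subset_or_subset_compl hT.1 (isCut_branchAt hT hcn) hc hn with h | h
    · exact h
    · exact absurd hv (h hvA)

lemma exists_isCut (hT : T.IsTree) {e : Sym2 V} (he : e ∈ T.edgeSet) : ∃ A, IsCut T e A := by
  obtain ⟨a, b⟩ := e
  exact ⟨_, isCut_branchAt hT he⟩

end Cuts

section Convexity

lemma choose_add_choose_le (k d : ℕ) {a b : ℕ} (h : a ≤ b) :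
    (a + d).choose k + b.choose k ≤ a.choose k + (b + d).choose k := by
  cases k with
  | zero => simp
  | succ k =>
    induction d with
    | zero => simp
    | succ d ih =>
      have := Nat.choose_le_choose k (Nat.add_le_add_right h d)
      rw [← add_assoc, ← add_assoc, Nat.choose_succ_succ', Nat.choose_succ_succ' (b + d)]
      omega

lemma choose_two_add_choose_two_lt {a b d : ℕ} (h : a < b) (hd : 0 < d) :
    (a + d).choose 2 + b.choose 2 < a.choose 2 + (b + d).choose 2 := by
  obtain ⟨d, rfl⟩ := Nat.exists_eq_succ_of_ne_zero hd.ne'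
  have := choose_add_choose_le 2 d h.le
  have h1 : (a + d.succ).choose 2 = (a + d) + (a + d).choose 2 := by
    rw [Nat.add_succ, Nat.choose_succ_succ', Nat.choose_one_right]
  have h2 : (b + d.succ).choose 2 = (b + d) + (b + d).choose 2 := by
    rw [Nat.add_succ, Nat.choose_succ_succ', Nat.choose_one_right]
  omega

end Convexity

section CutCost

variable {V : Type*} {T : SimpleGraph V}

/-- The number of `k`-subsets of the vertices that are not separated by removing `e`. -/
noncomputable def cutCost (T : SimpleGraph V) (k : ℕ) (e : Sym2 V) : ℕ :=
  sInf {m | ∃ A, IsCut T e A ∧ m = A.ncard.choose k + Aᶜ.ncard.choose k}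

lemma IsCut.cutCost_eq (hT : T.Connected) {e : Sym2 V} {A : Set V} (hA : IsCut T e A) (k : ℕ) :
    cutCost T k e = A.ncard.choose k + Aᶜ.ncard.choose k := by
  have : {m | ∃ A, IsCut T e A ∧ m = A.ncard.choose k + Aᶜ.ncard.choose k} =
      {A.ncard.choose k + Aᶜ.ncard.choose k} := by
    ext m
    constructor
    · rintro ⟨B, hB, rfl⟩
      rcases hA.eq_or_eq_compl hT hB with rfl | rfl
      · rfl
      · simp [add_comm]
    · rintro rfl
      exact ⟨A, hA, rfl⟩
  rw [cutCost, this, csInf_singleton]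

/-- The edges of a finite graph. -/
noncomputable def edgesFin [Fintype V] (T : SimpleGraph V) : Finset (Sym2 V) :=
  T.edgeSet.toFinite.toFinset

@[simp] lemma mem_edgesFin [Fintype V] {e : Sym2 V} : e ∈ edgesFin T ↔ e ∈ T.edgeSet := by
  simp [edgesFin]

/-- The total over all edges `e` of the number of `k`-subsets not separated by `e`. -/
noncomputable def totalCutCost [Fintype V] (T : SimpleGraph V) (k : ℕ) : ℕ :=
  ∑ e ∈ edgesFin T, cutCost T k e

lemma isAcyclic_of_forall_isCut (h : ∀ e ∈ T.edgeSet, ∃ A, IsCut T e A) : T.IsAcyclic := by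
  rw [isAcyclic_iff_forall_adj_isBridge]
  intro v w hvw
  obtain ⟨A, hA⟩ := h s(v, w) hvw
  rw [isBridge_iff_forall_walk_mem_edges]
  intro p
  refine hA.mem_edges_of_iff p fun h => ?_
  exact ((hA.2 v w hvw).1 h) rfl

lemma card_edgesFin_add_one [Fintype V] (hT : T.IsTree) :
    (edgesFin T).card + 1 = Fintype.card V := by
  classical
  rw [← hT.card_edgeFinset]
  congr 2
  ext e
  simp

lemma isTree_of_isAcyclic_of_card [Fintype V] [Nonempty V] (hT : T.IsAcyclic)
    (hc : (edgesFin T).card + 1 = Fintype.card V) : T.IsTree := by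
  obtain ⟨T', hle, _, hT'⟩ :=
    (connected_top (V := V)).exists_isTree_le_of_le_of_isAcyclic le_top hT
  have h1 := card_edgesFin_add_one hT'
  have h2 : edgesFin T ⊆ edgesFin T' := fun e he => by
    rw [mem_edgesFin] at he ⊢
    exact edgeSet_mono hle he
  have h3 := Finset.eq_of_subset_of_card_le h2 (by omega)
  have : T = T' := by
    rw [← edgeSet_inj]
    ext e
    rw [← mem_edgesFin, ← mem_edgesFin, h3]
  rwa [this]

end CutCost

section Switch

variable {V : Type*} {T : SimpleGraph V}

/-- Replace the edges `x x'` and `y y'` by `x y'` and `y x'`. -/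
def switch (T : SimpleGraph V) (x x' y y' : V) : SimpleGraph V :=
  T.deleteEdges {s(x, x'), s(y, y')} ⊔ fromEdgeSet {s(x, y'), s(y, x')}

/-- The configuration of two disjoint branches, `x'` at `x` and `y'` at `y`, which can be
exchanged. -/
structure Switchable (T : SimpleGraph V) (x x' y y' : V) : Prop where
  isTree : T.IsTree
  ne : x ≠ y
  adj_x : T.Adj x x'
  adj_y : T.Adj y y'
  y_notMem : y ∉ branchAt T x x'
  x_notMem : x ∉ branchAt T y y'

namespace Switchable

variable {x x' y y' : V}

lemma symm (h : Switchable T x x' y y') : Switchable T y y' x x' :=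
  ⟨h.isTree, h.ne.symm, h.adj_y, h.adj_x, h.x_notMem, h.y_notMem⟩

lemma x'_ne_y (h : Switchable T x x' y y') : x' ≠ y := by
  rintro rfl
  exact h.y_notMem (mem_branchAt _ _)

lemma edge_ne (h : Switchable T x x' y y') : s(x, x') ≠ s(y, y') := by
  have := h.ne
  have := h.x'_ne_y
  rw [Ne, Sym2.eq_iff]
  tauto

lemma y'_notMem (h : Switchable T x x' y y') : y' ∉ branchAt T x x' := fun h' =>
  h.y_notMem (((isCut_branchAt h.isTree h.adj_x).mem_iff h.adj_y h.edge_ne.symm).2 h')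

lemma x'_ne_y' (h : Switchable T x x' y y') : x' ≠ y' := by
  rintro rfl
  exact h.y'_notMem (mem_branchAt _ _)

lemma disjoint (h : Switchable T x x' y y') :
    Disjoint (branchAt T x x') (branchAt T y y') := by
  rcases (isCut_branchAt h.isTree h.adj_x).subset_or_subset_compl h.isTree.1
    (isCut_branchAt h.isTree h.adj_y) h.y_notMem h.y'_notMem with h' | h'
  · exact absurd (h' (mem_branchAt _ _)) h.symm.y'_notMem
  · exact Set.subset_compl_iff_disjoint_right.1 h'

lemma not_adj (h : Switchable T x x' y y') : ¬ T.Adj x y' := by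
  intro hadj
  have := (isCut_branchAt h.isTree h.adj_y).eq_of_crossing hadj.symm (mem_branchAt _ _) h.x_notMem
  rcases Sym2.eq_iff.1 this with ⟨h1, h2⟩ | ⟨_, h1⟩
  · exact h.adj_y.ne h1.symm
  · exact h.ne h1

lemma adj_switch (h : Switchable T x x' y y') {p q : V} : (switch T x x' y y').Adj p q ↔
    (T.Adj p q ∧ s(p, q) ≠ s(x, x') ∧ s(p, q) ≠ s(y, y')) ∨ s(p, q) = s(x, y') ∨
      s(p, q) = s(y, x') := by
  have h1 := h.x'_ne_y
  have h2 := h.symm.x'_ne_y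
  simp only [switch, sup_adj, deleteEdges_adj, fromEdgeSet_adj, Set.mem_insert_iff,
    Set.mem_singleton_iff, not_or]
  refine or_congr Iff.rfl ⟨fun h => h.1, fun h' => ⟨h', ?_⟩⟩
  rintro rfl
  rcases h' with h' | h' <;> rcases Sym2.eq_iff.1 h' with ⟨h3, h4⟩ | ⟨h3, h4⟩ <;>
    simp_all

lemma mem_edgeSet_switch (h : Switchable T x x' y y') {e : Sym2 V} :
    e ∈ (switch T x x' y y').edgeSet ↔
    (e ∈ T.edgeSet ∧ e ≠ s(x, x') ∧ e ≠ s(y, y')) ∨ e = s(x, y') ∨ e = s(y, x') := by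
  obtain ⟨p, q⟩ := e
  exact h.adj_switch

/-- Checking that a set is a side of a cut of the switched tree. -/
lemma isCut_switch (h : Switchable T x x' y y') {e : Sym2 V} {A : Set V}
    (he : e ∈ (switch T x x' y y').edgeSet)
    (h1 : ∀ p q, T.Adj p q → s(p, q) ≠ s(x, x') → s(p, q) ≠ s(y, y') →
      ((p ∈ A ↔ q ∈ A) ↔ s(p, q) ≠ e))
    (h2 : (x ∈ A ↔ y' ∈ A) ↔ s(x, y') ≠ e)
    (h3 : (y ∈ A ↔ x' ∈ A) ↔ s(y, x') ≠ e) : IsCut (switch T x x' y y') e A := by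
  refine ⟨he, fun p q hpq => ?_⟩
  rcases h.adj_switch.1 hpq with ⟨ha, hx, hy⟩ | hpq | hpq
  · exact h1 p q ha hx hy
  · rw [hpq]
    rcases Sym2.eq_iff.1 hpq with ⟨rfl, rfl⟩ | ⟨rfl, rfl⟩
    · exact h2
    · rw [← h2]; exact ⟨Iff.symm, Iff.symm⟩
  · rw [hpq]
    rcases Sym2.eq_iff.1 hpq with ⟨rfl, rfl⟩ | ⟨rfl, rfl⟩
    · exact h3
    · rw [← h3]; exact ⟨Iff.symm, Iff.symm⟩

lemma new_ne (h : Switchable T x x' y y') {e : Sym2 V} (he : e ∈ T.edgeSet) :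
    s(x, y') ≠ e ∧ s(y, x') ≠ e := by
  constructor
  · rintro rfl
    exact h.not_adj he
  · rintro rfl
    exact h.symm.not_adj he

lemma isCut_of_same_side (h : Switchable T x x' y y') {e : Sym2 V} {A : Set V}
    (hA : IsCut T e A) (hx : e ≠ s(x, x')) (hy : e ≠ s(y, y')) (hxy : x ∈ A ↔ y ∈ A) :
    IsCut (switch T x x' y y') e A := by
  have hx' := hA.mem_iff h.adj_x hx.symm
  have hy' := hA.mem_iff h.adj_y hy.symm
  refine h.isCut_switch (h.mem_edgeSet_switch.2 (Or.inl ⟨hA.1, hx, hy⟩))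
    (fun p q hpq _ _ => hA.2 p q hpq) ?_ ?_
  · simp only [(h.new_ne hA.1).1, ne_eq, not_false_iff, iff_true]; tauto
  · simp only [(h.new_ne hA.1).2, ne_eq, not_false_iff, iff_true]; tauto

lemma subset_side (h : Switchable T x x' y y') {e : Sym2 V} {A : Set V}
    (hA : IsCut T e A) (hx : e ≠ s(x, x')) (hxA : x ∈ A) (hyA : y ∉ A) :
    branchAt T x x' ⊆ A := by
  obtain ⟨p, q, hpq, he, hp, hq⟩ := hA.exists_crossing
  have hx' := (hA.mem_iff h.adj_x hx.symm).1 hxA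
  have key : ∀ a b, s(x, x') = s(a, b) → a ∈ A ∧ b ∈ A := by
    intro a b hab
    rcases Sym2.eq_iff.1 hab with ⟨rfl, rfl⟩ | ⟨rfl, rfl⟩
    · exact ⟨hxA, hx'⟩
    · exact ⟨hx', hxA⟩
  rcases hA.compl.subset_or_subset_compl h.isTree.1 (isCut_branchAt h.isTree h.adj_x)
    (by simpa using hxA) (by simpa using hx') with h' | h'
  · exact absurd (h' hyA) h.y_notMem
  · exact Set.compl_subset_compl.1 h'

lemma isCut_of_separated (h : Switchable T x x' y y') {e : Sym2 V} {A : Set V}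
    (hA : IsCut T e A) (hx : e ≠ s(x, x')) (hy : e ≠ s(y, y')) (hxA : x ∈ A) (hyA : y ∉ A) :
    IsCut (switch T x x' y y') e ((A \ branchAt T x x') ∪ branchAt T y y') := by
  have hX := h.subset_side hA hx hxA hyA
  have hY := h.symm.subset_side hA.compl hy hyA (by simpa using hxA)
  have cX := isCut_branchAt h.isTree h.adj_x
  have cY := isCut_branchAt h.isTree h.adj_y
  have hd := Set.disjoint_left.1 h.disjoint
  refine h.isCut_switch (h.mem_edgeSet_switch.2 (Or.inl ⟨hA.1, hx, hy⟩))
    (fun p q hpq hp hq => ?_) ?_ ?_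
  · have h1 := cX.mem_iff hpq hp
    have h2 := cY.mem_iff hpq hq
    have h3 := hA.2 p q hpq
    simp only [Set.mem_union, Set.mem_sdiff]
    rw [← h3, h1, h2]
    by_cases hqX : q ∈ branchAt T x x'
    · have a1 := hX hqX
      have a2 := hX (h1.2 hqX)
      simp [hqX, a1, a2]
    by_cases hqY : q ∈ branchAt T y y'
    · have a1 : q ∉ A := hY hqY
      have a2 : p ∉ A := hY (h2.2 hqY)
      simp [hqY, a1, a2]
    simp [hqX, hqY]
  · have : x ∉ branchAt T x x' := notMem_branchAt h.isTree h.adj_x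
    simp [(h.new_ne hA.1).1, hxA, this, mem_branchAt]
  · have : x' ∉ branchAt T y y' := hd (mem_branchAt _ _)
    simp [(h.new_ne hA.1).2, hyA, this, mem_branchAt, notMem_branchAt h.isTree h.adj_y]

lemma isCut_moved (h : Switchable T x x' y y') :
    IsCut (switch T x x' y y') s(y, x') (branchAt T x x') := by
  have cX := isCut_branchAt h.isTree h.adj_x
  have h1 : s(x, y') ≠ s(y, x') := by
    have h1 := h.ne
    have h2 := h.adj_x.ne
    rw [Ne, Sym2.eq_iff]
    tauto
  refine h.isCut_switch (h.mem_edgeSet_switch.2 (Or.inr (Or.inr rfl)))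
    (fun p q hpq hp hq => ?_) ?_ ?_
  · have h1 := cX.mem_iff hpq hp
    have h2 : s(p, q) ≠ s(y, x') := fun h' => (h.new_ne hpq).2 h'.symm
    tauto
  · simp [h1, h.y'_notMem, notMem_branchAt h.isTree h.adj_x]
  · simp [h.y_notMem, mem_branchAt]

end Switchable

lemma switch_symm (x x' y y' : V) : switch T y y' x x' = switch T x x' y y' := by
  rw [switch, switch, Set.pair_comm s(y, y'), Set.pair_comm s(y, x')]

end Switch

section ComponentSizes

/-- The multiset of the sizes of the connected components of a finite graph. -/
noncomputable def componentSizes {E : Type*} [Finite E] (G : SimpleGraph E) : Multiset ℕ :=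
  (Set.toFinite (Set.univ : Set G.ConnectedComponent)).toFinset.val.map fun c => c.supp.ncard

lemma componentSizes_congr {E F : Type*} [Finite E] [Finite F] {G : SimpleGraph E}
    {H : SimpleGraph F} (φ : G ≃g H) : componentSizes G = componentSizes H := by
  have : (Set.toFinite (Set.univ : Set H.ConnectedComponent)).toFinset =
      (Set.toFinite (Set.univ : Set G.ConnectedComponent)).toFinset.map
        φ.connectedComponentEquiv.toEmbedding := by
    ext c
    simp
  rw [componentSizes, componentSizes, this, Finset.map_val, Multiset.map_map]
  refine Multiset.map_congr rfl fun c _ => ?_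
  exact Nat.card_congr (ConnectedComponent.isoEquivSupp φ c)

lemma sum_componentSizes {E : Type*} [Finite E] (G : SimpleGraph E) :
    (componentSizes G).sum = Nat.card E := by
  classical
  have := Fintype.ofFinite E
  rw [Nat.card_eq_fintype_card, ← Finset.card_univ,
    Finset.card_eq_sum_card_fiberwise (f := G.connectedComponentMk)
      (t := (Set.toFinite (Set.univ : Set G.ConnectedComponent)).toFinset) (by simp)]
  refine congrArg Multiset.sum (Multiset.map_congr rfl fun c _ => ?_)
  rw [← Set.ncard_coe_finset]
  congr 1
  ext e
  simp [ConnectedComponent.mem_supp_iff]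

end ComponentSizes

section SegGraph

variable {V : Type*} {T : SimpleGraph V}

/-- The graph on the edges of `T` in which edges sharing a vertex of degree two are adjacent. -/
def segGraph (T : SimpleGraph V) : SimpleGraph T.edgeSet where
  Adj e f := e ≠ f ∧ ∃ z, z ∈ e.1 ∧ z ∈ f.1 ∧ degN T z = 2
  symm := ⟨fun _ _ ⟨h, z, h1, h2, h3⟩ => ⟨h.symm, z, h2, h1, h3⟩⟩
  loopless := ⟨fun _ h => h.1 rfl⟩

lemma degN_eq_of_iso {W : Type*} {T' : SimpleGraph W} (φ : T ≃g T') (v : V) :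
    degN T' (φ v) = degN T v :=
  (Nat.card_congr (φ.mapNeighborSet v)).symm

/-- An isomorphism of graphs induces one of the graphs on their edges. -/
def segGraphIso {W : Type*} {T' : SimpleGraph W} (φ : T ≃g T') : segGraph T ≃g segGraph T' where
  toEquiv := φ.mapEdgeSet
  map_rel_iff' := by
    intro e f
    have key : ∀ (e : T.edgeSet) z, φ z ∈ (φ.mapEdgeSet e).1 ↔ z ∈ e.1 := by
      intro e z
      change φ z ∈ Sym2.map φ e.1 ↔ _
      rw [Sym2.mem_map]
      constructor
      · rintro ⟨w, hw, h⟩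
        rwa [← φ.injective h]
      · exact fun h => ⟨z, h, rfl⟩
    change (_ ≠ _ ∧ _) ↔ (_ ≠ _ ∧ _)
    rw [φ.mapEdgeSet.injective.ne_iff]
    refine and_congr Iff.rfl ⟨?_, ?_⟩
    · rintro ⟨z, h1, h2, h3⟩
      obtain ⟨z, rfl⟩ := φ.surjective z
      exact ⟨z, (key e z).1 h1, (key f z).1 h2, degN_eq_of_iso φ z ▸ h3⟩
    · rintro ⟨z, h1, h2, h3⟩
      exact ⟨φ z, (key e z).2 h1, (key f z).2 h2, (degN_eq_of_iso φ z).trans h3⟩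

end SegGraph

namespace Switchable

variable {V : Type*} {T : SimpleGraph V} {x x' y y' : V}

lemma degN_x [Finite V] (h : Switchable T x x' y y') : degN (switch T x x' y y') x = degN T x := by
  have : (switch T x x' y y').neighborSet x = insert y' (T.neighborSet x \ {x'}) := by
    ext z
    have h0 := h.ne
    have h1 := h.x'_ne_y
    have h2 := h.adj_x.ne
    have h3 := h.symm.x'_ne_y
    simp only [mem_neighborSet, h.adj_switch, Set.mem_insert_iff, Set.mem_sdiff,
      Set.mem_singleton_iff, Ne, Sym2.eq_iff]
    constructor
    · rintro (h | h | h) <;> tauto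
    · rintro (h | h) <;> tauto
  rw [degN, this]
  exact Set.ncard_exchange (s := T.neighborSet x) h.not_adj h.adj_x

lemma degN_x' [Finite V] (h : Switchable T x x' y y') :
    degN (switch T x x' y y') x' = degN T x' := by
  have : (switch T x x' y y').neighborSet x' = insert y (T.neighborSet x' \ {x}) := by
    ext z
    have h0 := h.ne
    have h1 := h.x'_ne_y
    have h2 := h.adj_x.ne
    have h3 := h.symm.x'_ne_y
    have h4 := h.x'_ne_y'
    simp only [mem_neighborSet, h.adj_switch, Set.mem_insert_iff, Set.mem_sdiff,
      Set.mem_singleton_iff, Ne, Sym2.eq_iff]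
    constructor
    · rintro (h | h | h) <;> tauto
    · rintro (h | h) <;> tauto
  rw [degN, this]
  exact Set.ncard_exchange (s := T.neighborSet x')
    (fun h' => h.symm.not_adj (T.adj_symm h')) h.adj_x.symm

lemma degN_switch [Finite V] (h : Switchable T x x' y y') (v : V) :
    degN (switch T x x' y y') v = degN T v := by
  by_cases h1 : v = x
  · rw [h1, h.degN_x]
  by_cases h2 : v = x'
  · rw [h2, h.degN_x']
  by_cases h3 : v = y
  · rw [h3, ← switch_symm, h.symm.degN_x]
  by_cases h4 : v = y'
  · rw [h4, ← switch_symm, h.symm.degN_x']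
  · rw [degN, degN]
    congr 1
    ext z
    simp only [mem_neighborSet, h.adj_switch, Ne, Sym2.eq_iff]
    tauto

open Classical in
/-- The bijection between the edges before and after switching. -/
noncomputable def perm (_ : Switchable T x x' y y') : Equiv.Perm (Sym2 V) :=
  Equiv.swap s(x, x') s(y, x') * Equiv.swap s(y, y') s(x, y')

lemma perm_x (h : Switchable T x x' y y') : h.perm s(x, x') = s(y, x') := by
  classical
  rw [perm, Equiv.Perm.mul_apply,
    Equiv.swap_apply_of_ne_of_ne h.edge_ne (h.new_ne h.adj_x).1.symm, Equiv.swap_apply_left]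

lemma new_edge_ne (h : Switchable T x x' y y') : s(x, y') ≠ s(y, x') := by
  have h1 := h.ne
  have h2 := h.adj_x.ne
  rw [Ne, Sym2.eq_iff]
  tauto

lemma perm_y (h : Switchable T x x' y y') : h.perm s(y, y') = s(x, y') := by
  classical
  rw [perm, Equiv.Perm.mul_apply, Equiv.swap_apply_left,
    Equiv.swap_apply_of_ne_of_ne (h.new_ne h.adj_x).1 h.new_edge_ne]

lemma perm_of_ne (h : Switchable T x x' y y') {e : Sym2 V} (he : e ∈ T.edgeSet)
    (hx : e ≠ s(x, x')) (hy : e ≠ s(y, y')) : h.perm e = e := by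
  classical
  rw [perm, Equiv.Perm.mul_apply, Equiv.swap_apply_of_ne_of_ne hy (h.new_ne he).1.symm,
    Equiv.swap_apply_of_ne_of_ne hx (h.new_ne he).2.symm]

lemma perm_mem_iff (h : Switchable T x x' y y') {e : Sym2 V} :
    h.perm e ∈ (switch T x x' y y').edgeSet ↔ e ∈ T.edgeSet := by
  have key : ∀ e ∈ T.edgeSet, h.perm e ∈ (switch T x x' y y').edgeSet := by
    intro e he
    rw [h.mem_edgeSet_switch]
    by_cases hx : e = s(x, x')
    · subst hx; exact Or.inr (Or.inr h.perm_x)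
    by_cases hy : e = s(y, y')
    · subst hy; exact Or.inr (Or.inl h.perm_y)
    rw [h.perm_of_ne he hx hy]
    exact Or.inl ⟨he, hx, hy⟩
  refine ⟨fun he => ?_, key e⟩
  rcases h.mem_edgeSet_switch.1 he with ⟨h1, h2, h3⟩ | h1 | h1
  · rwa [h.perm.injective (h.perm_of_ne h1 h2 h3)] at h1
  · rw [← h.perm_y] at h1
    rw [h.perm.injective h1]
    exact h.adj_y
  · rw [← h.perm_x] at h1
    rw [h.perm.injective h1]
    exact h.adj_x

lemma mem_perm_iff (h : Switchable T x x' y y') {e : Sym2 V} {z : V} (hx : z ≠ x) (hy : z ≠ y) :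
    z ∈ h.perm e ↔ z ∈ e := by
  classical
  have key : ∀ a b : Sym2 V, (z ∈ a ↔ z ∈ b) → ∀ e, z ∈ Equiv.swap a b e ↔ z ∈ e := by
    intro a b hab e
    rw [Equiv.swap_apply_def]
    split_ifs with h1 h2
    · rw [h1, hab]
    · rw [h2, hab]
    · rfl
  rw [perm, Equiv.Perm.mul_apply, key _ _ (by simp [hx, hy]), key _ _ (by simp [hx, hy])]

/-- Switching at vertices whose degrees are not two does not change the segment structure. -/
noncomputable def segGraphIso [Finite V] (h : Switchable T x x' y y') (hx : degN T x ≠ 2)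
    (hy : degN T y ≠ 2) : segGraph T ≃g segGraph (switch T x x' y y') where
  toEquiv := h.perm.subtypeEquiv fun _ => h.perm_mem_iff.symm
  map_rel_iff' := by
    intro e f
    change (_ ≠ _ ∧ _) ↔ (_ ≠ _ ∧ _)
    rw [(Equiv.injective _).ne_iff]
    refine and_congr Iff.rfl (exists_congr fun z => ?_)
    rw [h.degN_switch, Equiv.subtypeEquiv_apply, Equiv.subtypeEquiv_apply]
    by_cases hz : degN T z = 2
    · have h1 : z ≠ x := by rintro rfl; exact hx hz
      have h2 : z ≠ y := by rintro rfl; exact hy hz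
      simp only [h.mem_perm_iff h1 h2]
    · simp [hz]

lemma isTree_switch [Fintype V] (h : Switchable T x x' y y') :
    (switch T x x' y y').IsTree := by
  have : Nonempty V := ⟨x⟩
  refine isTree_of_isAcyclic_of_card (isAcyclic_of_forall_isCut fun e he => ?_) ?_
  · rcases h.mem_edgeSet_switch.1 he with ⟨h1, h2, h3⟩ | rfl | rfl
    · obtain ⟨A, hA⟩ := exists_isCut h.isTree h1
      by_cases hx : x ∈ A <;> by_cases hy : y ∈ A
      · exact ⟨_, h.isCut_of_same_side hA h2 h3 (by tauto)⟩
      · exact ⟨_, h.isCut_of_separated hA h2 h3 hx hy⟩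
      · exact ⟨_, h.isCut_of_separated hA.compl h2 h3 hx (by simpa using hy)⟩
      · exact ⟨_, h.isCut_of_same_side hA h2 h3 (by tauto)⟩
    · rw [← switch_symm]
      exact ⟨_, h.symm.isCut_moved⟩
    · exact ⟨_, h.isCut_moved⟩
  · rw [← card_edgesFin_add_one h.isTree]
    congr 1
    refine (Finset.card_bij (fun e _ => h.perm e) (fun e he => ?_)
      (fun _ _ _ _ hab => h.perm.injective hab) (fun e he => ?_)).symm
    · rwa [mem_edgesFin, h.perm_mem_iff, ← mem_edgesFin]
    · refine ⟨h.perm.symm e, ?_, by simp⟩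
      rwa [mem_edgesFin, ← h.perm_mem_iff, Equiv.apply_symm_apply, ← mem_edgesFin]

lemma totalCutCost_switch [Fintype V] (h : Switchable T x x' y y') (k : ℕ) :
    totalCutCost (switch T x x' y y') k =
      ∑ e ∈ edgesFin T, cutCost (switch T x x' y y') k (h.perm e) := by
  refine (Finset.sum_bij (fun e _ => h.perm e) (fun e he => ?_)
    (fun _ _ _ _ hab => h.perm.injective hab) (fun e he => ?_) (fun _ _ => rfl)).symm
  · rwa [mem_edgesFin, h.perm_mem_iff, ← mem_edgesFin]
  · refine ⟨h.perm.symm e, ?_, by simp⟩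
    rwa [mem_edgesFin, ← h.perm_mem_iff, Equiv.apply_symm_apply, ← mem_edgesFin]

/-- Switching changes the cost of an edge separating `x` from `y` in the expected way. -/
lemma cutCost_separated [Fintype V] (h : Switchable T x x' y y')
    (hlt : (branchAt T x x').ncard < (branchAt T y y').ncard)
    (hc : ∀ e A, IsCut T e A → x ∈ A → y ∉ A →
      2 * A.ncard + (branchAt T y y').ncard < Fintype.card V + (branchAt T x x').ncard)
    {e : Sym2 V} {A : Set V} (hA : IsCut T e A) (hx : e ≠ s(x, x')) (hy : e ≠ s(y, y'))
    (hxA : x ∈ A) (hyA : y ∉ A) :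
    (∀ k, cutCost (switch T x x' y y') k (h.perm e) ≤ cutCost T k e) ∧
      cutCost (switch T x x' y y') 2 (h.perm e) < cutCost T 2 e := by
  have hlt' := hc e A hA hxA hyA
  have hX := h.subset_side hA hx hxA hyA
  have hY := h.symm.subset_side hA.compl hy hyA (by simpa using hxA)
  set A' := (A \ branchAt T x x') ∪ branchAt T y y' with hA'
  have hA'c := h.isCut_of_separated hA hx hy hxA hyA
  have h1 : A'.ncard = A.ncard - (branchAt T x x').ncard + (branchAt T y y').ncard := by
    rw [hA', Set.ncard_union_eq, Set.ncard_sdiff hX]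
    exact Set.disjoint_of_subset_left Set.sdiff_subset (Set.disjoint_right.2 fun _ h => hY h)
  have h2 := Set.ncard_le_ncard hX
  have h3 := Set.ncard_add_ncard_compl A
  have h4 := Set.ncard_add_ncard_compl A'
  rw [Nat.card_eq_fintype_card] at h3 h4
  obtain ⟨d, hd⟩ := Nat.exists_eq_add_of_lt hlt
  have e1 : A'.ncard = A.ncard + (d + 1) := by omega
  have e2 : Aᶜ.ncard = A'ᶜ.ncard + (d + 1) := by omega
  have e3 : A.ncard < A'ᶜ.ncard := by omega
  simp only [h.perm_of_ne hA.1 hx hy, hA.cutCost_eq h.isTree.1,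
    hA'c.cutCost_eq h.isTree_switch.1]
  rw [← hA', e1, e2]
  exact ⟨fun k => choose_add_choose_le k _ e3.le, choose_two_add_choose_two_lt e3 (by omega)⟩

/-- The exchange principle: moving the larger of two branches away from the bigger part of the
tree decreases the costs. -/
theorem totalCutCost_switch_le [Fintype V] (h : Switchable T x x' y y')
    (hlt : (branchAt T x x').ncard < (branchAt T y y').ncard)
    (hc : ∀ e A, IsCut T e A → x ∈ A → y ∉ A →
      2 * A.ncard + (branchAt T y y').ncard < Fintype.card V + (branchAt T x x').ncard) :
    (∀ k, totalCutCost (switch T x x' y y') k ≤ totalCutCost T k) ∧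
      totalCutCost (switch T x x' y y') 2 < totalCutCost T 2 := by
  have key : ∀ k, ∀ e ∈ edgesFin T, cutCost (switch T x x' y y') k (h.perm e) ≤ cutCost T k e := by
    intro k e he
    rw [mem_edgesFin] at he
    have hT' := h.isTree_switch
    by_cases hx : e = s(x, x')
    · subst hx
      rw [h.perm_x, h.isCut_moved.cutCost_eq hT'.1,
        (isCut_branchAt h.isTree h.adj_x).cutCost_eq h.isTree.1]
    by_cases hy : e = s(y, y')
    · subst hy
      have := h.symm.isCut_moved
      rw [switch_symm] at this
      rw [h.perm_y, this.cutCost_eq hT'.1,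
        (isCut_branchAt h.isTree h.adj_y).cutCost_eq h.isTree.1]
    obtain ⟨A, hA⟩ := exists_isCut h.isTree he
    by_cases hxy : x ∈ A ↔ y ∈ A
    · rw [h.perm_of_ne he hx hy, hA.cutCost_eq h.isTree.1,
        (h.isCut_of_same_side hA hx hy hxy).cutCost_eq hT'.1]
    by_cases hxA : x ∈ A
    · exact (h.cutCost_separated hlt hc hA hx hy hxA (by tauto)).1 k
    · exact (h.cutCost_separated hlt hc hA.compl hx hy hxA (by
        simp only [Set.mem_compl_iff]; tauto)).1 k
  refine ⟨fun k => ?_, ?_⟩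
  · rw [h.totalCutCost_switch]
    exact Finset.sum_le_sum (key k)
  · rw [h.totalCutCost_switch]
    obtain ⟨n, hn, hyn⟩ := exists_mem_branchAt h.isTree h.ne.symm
    refine Finset.sum_lt_sum (key 2) ⟨s(x, n), by simpa using hn, ?_⟩
    refine (h.cutCost_separated hlt hc (isCut_branchAt h.isTree hn).compl ?_ ?_
      (notMem_branchAt h.isTree hn) (by simpa using hyn)).2
    · intro h'
      rw [Sym2.congr_right] at h'
      subst h'
      exact h.y_notMem hyn
    · intro h'
      rcases Sym2.eq_iff.1 h' with ⟨h1, _⟩ | ⟨h1, _⟩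
      · exact h.ne h1
      · exact h.symm.x'_ne_y h1.symm

end Switchable

section Steiner

variable {V : Type*} {T : SimpleGraph V}

/-- The edge `e` separates the vertices of `S`. -/
def Separates (T : SimpleGraph V) (e : Sym2 V) (S : Finset V) : Prop :=
  ∀ A, IsCut T e A → ¬ (S : Set V) ⊆ A

lemma IsCut.support_subset {e : Sym2 V} {A : Set V} (hA : IsCut T e A) {x y : V}
    {p : T.Walk x y} (hp : p.IsPath) (hx : x ∈ A) (hy : y ∈ A) : ∀ z ∈ p.support, z ∈ A := by
  classical
  intro z hz
  by_contra hzA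
  refine hA.false_of_append_isPath (p := p.takeUntil z hz) (q := p.dropUntil z hz) (x := x)
    (z := y) ?_ (Walk.start_mem_support _) (Walk.end_mem_support _) (by tauto) (by tauto)
  rwa [Walk.take_spec]

lemma edgeSet_subset_of_separates (hT : T.IsTree) {S : Finset V} {H : T.Subgraph}
    (hH : H.Connected) (hS : (S : Set V) ⊆ H.verts) {e : Sym2 V} (he : e ∈ T.edgeSet)
    (hsep : Separates T e S) : e ∈ H.edgeSet := by
  obtain ⟨A, hA⟩ := exists_isCut hT he
  obtain ⟨s, hs, hsA⟩ := Set.not_subset.1 (hsep A hA)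
  obtain ⟨t, ht, htA⟩ := Set.not_subset.1 (hsep _ hA.compl)
  obtain ⟨p, hp⟩ := ((Subgraph.connected_iff_forall_exists_walk_subgraph H).1 hH).2
    (hS ht) (hS hs)
  have := hA.mem_edges p (by simpa using htA) hsA
  rw [← Walk.mem_edges_toSubgraph] at this
  exact Subgraph.edgeSet_mono hp this

lemma steinerDist_eq [Fintype V] (hT : T.IsTree) {S : Finset V} (hS : S.Nonempty) :
    steinerDist T S = {e | e ∈ T.edgeSet ∧ Separates T e S}.ncard := by
  classical
  have hne : {n | ∃ H : T.Subgraph, H.Connected ∧ ↑S ⊆ H.verts ∧ H.edgeSet.ncard = n}.Nonempty := by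
    refine ⟨_, ⊤, ?_, by simp, rfl⟩
    rw [Subgraph.connected_iff', Subgraph.topIso.connected_iff]
    exact hT.1
  obtain ⟨H, hH, hSH, hcard⟩ := Nat.sInf_mem hne
  rw [steinerDist, ← hcard]
  congr 1
  ext e
  refine ⟨fun he => ⟨H.edgeSet_subset he, fun A hA hSA => ?_⟩,
    fun he => edgeSet_subset_of_separates hT hH hSH he.1 he.2⟩
  have hlt : (H.induce (H.verts ∩ A)).edgeSet.ncard < H.edgeSet.ncard := by
    refine Set.ncard_lt_ncard ⟨?_, fun hsub => ?_⟩ (Set.toFinite _)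
    · rintro ⟨p, q⟩ hpq
      exact hpq.2.2
    · obtain ⟨p, q, hpq, rfl, hp, hq⟩ := hA.exists_crossing
      exact hq (hsub he).2.1.2
  refine hlt.not_ge ?_
  rw [hcard]
  refine Nat.sInf_le ⟨_, ?_, Set.subset_inter hSH hSA, rfl⟩
  rw [Subgraph.connected_iff_forall_exists_walk_subgraph]
  refine ⟨?_, ?_⟩
  · obtain ⟨s, hs⟩ := hS
    exact ⟨s, hSH hs, hSA hs⟩
  · rintro u v ⟨hu, huA⟩ ⟨hv, hvA⟩
    obtain ⟨p, hp⟩ := ((Subgraph.connected_iff_forall_exists_walk_subgraph H).1 hH).2 hu hv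
    have hb : p.bypass.toSubgraph ≤ H := le_trans p.toSubgraph_bypass_le_toSubgraph hp
    have hsup := hA.support_subset p.bypass_isPath huA hvA
    refine ⟨p.bypass, fun z hz => ⟨hb.1 hz, hsup z (by simpa using hz)⟩, fun a b hab => ?_⟩
    refine ⟨⟨hb.1 hab.fst_mem, hsup a ?_⟩, ⟨hb.1 hab.snd_mem, hsup b ?_⟩, hb.2 hab⟩
    · simpa using hab.fst_mem
    · simpa using hab.snd_mem

lemma card_separates_add_cutCost [Fintype V] (hT : T.IsTree) {k : ℕ} (hk : 1 ≤ k) {e : Sym2 V}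
    (he : e ∈ T.edgeSet) [DecidablePred (Separates T e)] :
    #{S ∈ powersetCard k (univ : Finset V) | Separates T e S} + cutCost T k e =
      (Fintype.card V).choose k := by
  classical
  obtain ⟨A, hA⟩ := exists_isCut hT he
  have h1 := Finset.card_filter_add_card_filter_not (s := powersetCard k (univ : Finset V))
    (Separates T e)
  rw [card_powersetCard, card_univ] at h1
  rw [← h1, hA.cutCost_eq hT.1]
  congr 1
  have h2 : ({S ∈ powersetCard k (univ : Finset V) | ¬ Separates T e S} : Finset (Finset V)) =
      powersetCard k A.toFinite.toFinset ∪ powersetCard k Aᶜ.toFinite.toFinset := by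
    ext S
    rw [mem_filter, mem_powersetCard_univ, mem_union, mem_powersetCard, mem_powersetCard,
      Set.Finite.subset_toFinset, Set.Finite.subset_toFinset]
    constructor
    · rintro ⟨hS, h⟩
      rw [Separates] at h
      push Not at h
      obtain ⟨B, hB, hSB⟩ := h
      rcases hA.eq_or_eq_compl hT.1 hB with rfl | rfl
      · exact Or.inl ⟨hSB, hS⟩
      · exact Or.inr ⟨hSB, hS⟩
    · rintro (⟨h, hS⟩ | ⟨h, hS⟩)
      · exact ⟨hS, fun h' => h' A hA h⟩
      · exact ⟨hS, fun h' => h' _ hA.compl h⟩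
  rw [h2, card_union_of_disjoint, card_powersetCard, card_powersetCard,
    ← Set.ncard_eq_toFinset_card, ← Set.ncard_eq_toFinset_card]
  rw [Finset.disjoint_left]
  intro S h3 h4
  simp only [mem_powersetCard, Set.Finite.subset_toFinset] at h3 h4
  obtain ⟨s, hs⟩ : S.Nonempty := by
    rw [← Finset.card_pos]
    omega
  exact h4.1 hs (h3.1 hs)

lemma steinerWiener_add_totalCutCost [Fintype V] (hT : T.IsTree) {k : ℕ} (hk : 1 ≤ k) :
    steinerWiener T k + totalCutCost T k =
      (Fintype.card V - 1) * (Fintype.card V).choose k := by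
  classical
  have h1 : steinerWiener T k = ∑ e ∈ edgesFin T,
      #{S ∈ powersetCard k (univ : Finset V) | Separates T e S} := by
    refine Eq.trans ?_ (sum_card_bipartiteAbove_eq_sum_card_bipartiteBelow
      (s := powersetCard k (univ : Finset V)) (t := edgesFin T) (fun S e => Separates T e S))
    refine Finset.sum_congr rfl fun S hS => ?_
    have : S.Nonempty := by
      rw [← Finset.card_pos]
      rw [mem_powersetCard_univ] at hS
      omega
    rw [steinerDist_eq hT this, ← Set.ncard_coe_finset]
    congr 1
    ext e
    simp [bipartiteAbove]
  rw [h1, totalCutCost, ← Finset.sum_add_distrib, Finset.sum_congr rfl fun e he =>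
    card_separates_add_cutCost hT hk (mem_edgesFin.1 he), Finset.sum_const, smul_eq_mul]
  congr 1
  have := card_edgesFin_add_one hT
  omega

lemma steinerDist_le_of_iso {W : Type*} {T' : SimpleGraph W} (hT : T.Connected) (φ : T ≃g T')
    (S : Finset V) : steinerDist T' (S.map φ.toEquiv.toEmbedding) ≤ steinerDist T S := by
  have hne : {n | ∃ H : T.Subgraph, H.Connected ∧ ↑S ⊆ H.verts ∧ H.edgeSet.ncard = n}.Nonempty := by
    refine ⟨_, ⊤, ?_, by simp, rfl⟩
    rw [Subgraph.connected_iff', Subgraph.topIso.connected_iff]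
    exact hT
  obtain ⟨H, hH, hSH, hcard⟩ := Nat.sInf_mem hne
  refine Nat.sInf_le ⟨H.map φ.toHom, ?_, ?_, ?_⟩
  · rw [Subgraph.connected_iff_forall_exists_walk_subgraph] at hH ⊢
    refine ⟨hH.1.image _, ?_⟩
    rintro _ _ ⟨u, hu, rfl⟩ ⟨v, hv, rfl⟩
    obtain ⟨p, hp⟩ := hH.2 hu hv
    refine ⟨p.map φ.toHom, ?_⟩
    rw [Walk.toSubgraph_map]
    exact Subgraph.map_monotone hp
  · intro z hz
    obtain ⟨y, hy, rfl⟩ := Finset.mem_map.1 hz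
    exact ⟨y, hSH hy, rfl⟩
  · rw [Subgraph.edgeSet_map, Set.ncard_image_of_injective _ (Sym2.map.injective (f := φ.toHom) φ.injective)]
    exact hcard

lemma steinerDist_eq_of_iso {W : Type*} {T' : SimpleGraph W} (hT : T.Connected) (φ : T ≃g T')
    (S : Finset V) : steinerDist T' (S.map φ.toEquiv.toEmbedding) = steinerDist T S := by
  refine (steinerDist_le_of_iso hT φ S).antisymm ?_
  have := steinerDist_le_of_iso (φ.connected_iff.1 hT) φ.symm (S.map φ.toEquiv.toEmbedding)
  rw [Finset.map_map] at this
  have h : φ.toEquiv.toEmbedding.trans φ.symm.toEquiv.toEmbedding = Function.Embedding.refl V := by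
    ext z
    exact φ.symm_apply_apply z
  rwa [h, Finset.map_refl] at this

lemma steinerWiener_eq_of_iso {W : Type*} [Fintype V] [Fintype W] {T' : SimpleGraph W}
    (hT : T.Connected) (φ : T ≃g T') (k : ℕ) : steinerWiener T' k = steinerWiener T k := by
  rw [steinerWiener, steinerWiener, ← Finset.map_univ_equiv φ.toEquiv, powersetCard_map,
    Finset.sum_map]
  exact Finset.sum_congr rfl fun S _ => steinerDist_eq_of_iso hT φ S

end Steiner

section Segments

variable {V : Type*} {T : SimpleGraph V}

/-- The walk `w` runs along a segment of `T`. -/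
structure IsSegWalk {u v : V} (w : T.Walk u v) : Prop where
  ne : u ≠ v
  left : IsLeafV T u ∨ IsBranchV T u
  right : IsLeafV T v ∨ IsBranchV T v
  isPath : w.IsPath
  internal : ∀ x ∈ w.support, x ≠ u → x ≠ v → degN T x = 2

lemma isSegment_iff {u v : V} : IsSegment T u v ↔ ∃ w : T.Walk u v, IsSegWalk w :=
  ⟨fun ⟨h1, h2, h3, w, h4, h5⟩ => ⟨w, h1, h2, h3, h4, h5⟩,
    fun ⟨w, h1, h2, h3, h4, h5⟩ => ⟨h1, h2, h3, w, h4, h5⟩⟩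

lemma IsSegWalk.isSegment {u v : V} {w : T.Walk u v} (h : IsSegWalk w) : IsSegment T u v :=
  isSegment_iff.2 ⟨w, h⟩

lemma IsSegWalk.reverse {u v : V} {w : T.Walk u v} (h : IsSegWalk w) : IsSegWalk w.reverse :=
  ⟨h.ne.symm, h.right, h.left, h.isPath.reverse,
    fun x hx hv hu => h.internal x (by simpa using hx) hu hv⟩

lemma degN_ne_two_of_leaf_or_branch {u : V} (h : IsLeafV T u ∨ IsBranchV T u) : degN T u ≠ 2 := by
  rw [IsLeafV, IsBranchV] at h
  omega

lemma not_isLeafV_of_isBranchV {u : V} (h : IsBranchV T u) : ¬ IsLeafV T u := by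
  rw [IsBranchV] at h
  rw [IsLeafV]
  omega

lemma IsPath.eq_of_isTree (hT : T.IsTree) {u v : V} {p q : T.Walk u v} (hp : p.IsPath)
    (hq : q.IsPath) : p = q :=
  congrArg Subtype.val ((hT.2.subsingleton_path u v).elim (⟨p, hp⟩ : T.Path u v) ⟨q, hq⟩)

lemma IsPath.length_eq_dist_of_isTree (hT : T.IsTree) {u v : V} {p : T.Walk u v} (hp : p.IsPath) :
    p.length = T.dist u v := by
  obtain ⟨q, hq⟩ := hT.1.exists_walk_length_eq_dist u v
  rw [IsPath.eq_of_isTree hT hp (q.isPath_of_length_eq_dist hq), hq]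

/-- A path contains all edges at an interior vertex of degree two. -/
lemma mem_edges_of_degN_eq_two [Finite V] {u v : V} {w : T.Walk u v} (hw : w.IsPath) {z y : V}
    (hz : z ∈ w.support) (hu : z ≠ u) (hv : z ≠ v) (hd : degN T z = 2) (hy : T.Adj z y) :
    s(z, y) ∈ w.edges := by
  obtain ⟨i, rfl, hi⟩ := Walk.mem_support_iff_exists_getVert.1 hz
  have h1 := hw.ncard_neighborSet_toSubgraph_internal_eq_two (i := i)
    (by rintro rfl; exact hu (by simp))
    (lt_of_le_of_ne hi (by rintro rfl; exact hv (by simp)))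
  have h2 := Set.eq_of_subset_of_ncard_le (w.toSubgraph.neighborSet_subset (w.getVert i))
    (by rw [h1]; exact hd.le) (Set.toFinite _)
  have h3 : y ∈ w.toSubgraph.neighborSet (w.getVert i) := by
    rw [h2]
    exact hy
  rw [← Walk.mem_edges_toSubgraph]
  exact h3

lemma IsSegWalk.mem_edges_of_mem [Finite V] {u v : V} {w : T.Walk u v} (h : IsSegWalk w)
    {e f : Sym2 V} {z : V} (he : e ∈ w.edges) (hf : f ∈ T.edgeSet) (hze : z ∈ e) (hzf : z ∈ f)
    (hz : degN T z = 2) : f ∈ w.edges := by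
  obtain ⟨y, rfl⟩ := hzf
  refine mem_edges_of_degN_eq_two h.isPath ?_ ?_ ?_ hz hf
  · obtain ⟨x, rfl⟩ := hze
    exact w.fst_mem_support_of_mem_edges he
  · rintro rfl
    exact degN_ne_two_of_leaf_or_branch h.left hz
  · rintro rfl
    exact degN_ne_two_of_leaf_or_branch h.right hz

lemma reachable_segGraph {u v : V} {w : T.Walk u v} (hw : w.IsPath)
    (hd : ∀ x ∈ w.support, x ≠ u → x ≠ v → degN T x = 2) {e f : T.edgeSet} (he : e.1 ∈ w.edges)
    (hf : f.1 ∈ w.edges) : (segGraph T).Reachable e f := by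
  induction w generalizing e f with
  | nil => simp at he
  | @cons u x v h p ih =>
    have hp := hw.of_cons
    have hu : u ∉ p.support := (Walk.cons_isPath_iff _ _).1 hw |>.2
    have ih' := fun {e f : T.edgeSet} => ih (e := e) (f := f) hp (fun z hz _ hzv =>
      hd z (by simp [hz]) (by rintro rfl; exact hu hz) hzv)
    have key : ∀ {e f : T.edgeSet}, e.1 = s(u, x) → f.1 ∈ p.edges →
        (segGraph T).Reachable e f := by
      clear he hf e f
      intro e f he hf
      cases p with
      | nil => simp at hf
      | @cons _ y _ h' q =>
        have hx : x ≠ v := by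
          rintro rfl
          exact ((Walk.cons_isPath_iff _ _).1 hp).2 (Walk.end_mem_support _)
        have hadj : (segGraph T).Adj e ⟨s(x, y), h'⟩ := by
          refine ⟨?_, x, by simp [he], by simp, hd x (by simp) h.ne' hx⟩
          intro heq
          have := congrArg Subtype.val heq
          rw [he] at this
          change s(u, x) = s(x, y) at this
          have hm : u ∈ s(x, y) := by
            rw [← this]
            simp
          rcases Sym2.mem_iff.1 hm with rfl | rfl
          · simp at hu
          · simp at hu
        exact hadj.reachable.trans (ih' (by simp) hf)
    rw [Walk.edges_cons, List.mem_cons] at he hf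
    rcases he with he | he <;> rcases hf with hf | hf
    · rw [Subtype.ext (he.trans hf.symm)]
    · exact key he hf
    · exact (key hf he).symm
    · exact ih' he hf

lemma IsSegWalk.supp_eq [Finite V] {u v : V} {w : T.Walk u v} (h : IsSegWalk w)
    {e : T.edgeSet} (he : e.1 ∈ w.edges) :
    ((segGraph T).connectedComponentMk e).supp = {f | f.1 ∈ w.edges} := by
  ext f
  rw [ConnectedComponent.mem_supp_iff, ConnectedComponent.eq]
  refine ⟨fun hr => ?_, fun hf => reachable_segGraph h.isPath h.internal hf he⟩
  obtain ⟨p⟩ := hr.symm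
  change f.1 ∈ w.edges
  clear hr
  induction p with
  | nil => exact he
  | cons hadj _ ih =>
    obtain ⟨_, z, h1, h2, h3⟩ := hadj
    exact ih (h.mem_edges_of_mem he (Subtype.property _) h1 h2 h3)

lemma ncard_edges_eq_length {u v : V} {w : T.Walk u v} (h : w.IsPath) :
    {f : T.edgeSet | f.1 ∈ w.edges}.ncard = w.length := by
  classical
  rw [← Set.ncard_image_of_injective _ Subtype.val_injective]
  have : Subtype.val '' {f : T.edgeSet | f.1 ∈ w.edges} = (w.edges.toFinset : Set (Sym2 V)) := by
    ext e
    simp only [Set.mem_image, Set.mem_ofPred_eq, Subtype.exists, exists_and_left, exists_prop,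
      exists_eq_right_right, List.coe_toFinset]
    exact ⟨fun h => h.1, fun h => ⟨h, w.edges_subset_edgeSet h⟩⟩
  rw [this, Set.ncard_coe_finset, List.toFinset_card_of_nodup h.isTrail.edges_nodup,
    Walk.length_edges]

lemma IsSegWalk.not_nil {u v : V} {w : T.Walk u v} (h : IsSegWalk w) : ¬ w.Nil :=
  fun hn => h.ne hn.eq

lemma IsSegWalk.eq_of_edges_subset {u v u' v' : V} {w : T.Walk u v} {w' : T.Walk u' v'}
    (h : IsSegWalk w) (h' : IsSegWalk w') (hsub : ∀ e ∈ w.edges, e ∈ w'.edges) :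
    s(u, v) = s(u', v') := by
  have hs : ∀ z ∈ w.support, z ∈ w'.support := by
    intro z hz
    rw [Walk.mem_support_iff_exists_mem_edges_of_not_nil h.not_nil] at hz
    obtain ⟨e, he, hze⟩ := hz
    rw [Walk.mem_support_iff_exists_mem_edges_of_not_nil h'.not_nil]
    exact ⟨e, hsub e he, hze⟩
  have key : ∀ z ∈ w.support, degN T z ≠ 2 → z = u' ∨ z = v' := by
    intro z hz hd
    by_contra hcon
    push Not at hcon
    exact hd (h'.internal z (hs z hz) hcon.1 hcon.2)
  have hne := h.ne
  rcases key u (Walk.start_mem_support _) (degN_ne_two_of_leaf_or_branch h.left) with rfl | rfl <;>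
  rcases key v (Walk.end_mem_support _) (degN_ne_two_of_leaf_or_branch h.right) with rfl | rfl
  · exact absurd rfl hne
  · rfl
  · exact Sym2.eq_swap
  · exact absurd rfl hne

lemma not_nil_of_mem_edges {u v : V} {w : T.Walk u v} {e : Sym2 V} (he : e ∈ w.edges) :
    ¬ w.Nil := by
  intro hn
  cases hn
  simp at he

lemma mem_edges_iff_of_isTree (hT : T.IsTree) {u v u' v' : V} {p : T.Walk u v} {q : T.Walk u' v'}
    (hp : p.IsPath) (hq : q.IsPath) (h : s(u, v) = s(u', v')) (e : Sym2 V) :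
    e ∈ p.edges ↔ e ∈ q.edges := by
  rcases Sym2.eq_iff.1 h with ⟨rfl, rfl⟩ | ⟨rfl, rfl⟩
  · rw [IsPath.eq_of_isTree hT hp hq]
  · rw [IsPath.eq_of_isTree hT hp hq.reverse]
    simp

lemma exists_extension [Fintype V] (hT : T.IsTree) {u v : V} (w : T.Walk u v) (hw : w.IsPath)
    (hnil : ¬ w.Nil) (hd : ∀ x ∈ w.support, x ≠ u → x ≠ v → degN T x = 2) :
    ∃ (v' : V) (w' : T.Walk u v'), w'.IsPath ∧ (∀ e ∈ w.edges, e ∈ w'.edges) ∧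
      (∀ x ∈ w'.support, x ≠ u → x ≠ v' → degN T x = 2) ∧
      (IsLeafV T v' ∨ IsBranchV T v') := by
  induction hn : Fintype.card V - w.length using Nat.strong_induction_on generalizing v with
  | _ n ih =>
  by_cases hv : degN T v = 2
  · obtain ⟨a, b, hab, hN⟩ := Set.ncard_eq_two.1 hv
    obtain ⟨y, hy, hyp⟩ : ∃ y, T.Adj v y ∧ y ≠ w.penultimate := by
      have ha : T.Adj v a := by
        change a ∈ T.neighborSet v
        simp [hN]
      have hb : T.Adj v b := by
        change b ∈ T.neighborSet v
        simp [hN]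
      by_cases h : a = w.penultimate
      · exact ⟨b, hb, fun h' => hab (h.trans h'.symm)⟩
      · exact ⟨a, ha, h⟩
    have hys : y ∉ w.support := fun h => hyp (hT.2.eq_penultimate_of_adj_end hw hy h)
    have hw' := hw.concat hys hy
    have hlt := hw'.length_lt
    rw [Walk.length_concat] at hlt
    obtain ⟨v', w', h1, h2, h3, h4⟩ := ih (Fintype.card V - (w.concat hy).length)
      (by rw [Walk.length_concat]; omega) (w.concat hy) hw'
      (by intro hnil'; have := Walk.length_eq_zero_iff.2 hnil'; simp at this)
      (by
        intro x hx hxu hxy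
        rw [Walk.support_concat] at hx
        simp only [List.mem_append, List.mem_singleton, hxy,
          or_false] at hx
        by_cases hxv : x = v
        · rwa [hxv]
        · exact hd x hx hxu hxv) rfl
    exact ⟨v', w', h1, fun e he => h2 e (by rw [Walk.edges_concat]; simp [he]), h3, h4⟩
  · refine ⟨v, w, hw, fun e he => he, hd, ?_⟩
    have : degN T v ≠ 0 := by
      exact Set.ncard_ne_zero_of_mem (a := w.penultimate) (w.adj_penultimate hnil).symm
    rw [IsLeafV, IsBranchV]
    omega

/-- Every edge of a finite tree lies on a segment. -/
lemma exists_isSegWalk [Fintype V] (hT : T.IsTree) {e : Sym2 V} (he : e ∈ T.edgeSet) :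
    ∃ (u v : V) (w : T.Walk u v), IsSegWalk w ∧ e ∈ w.edges := by
  obtain ⟨p, q⟩ := e
  have hpq : T.Adj p q := he
  obtain ⟨v, w, h1, h2, h3, h4⟩ := exists_extension hT hpq.toWalk
    (by simp [hpq.ne]) (by simp)
    (by simp only [Adj.toWalk, Walk.support_cons, Walk.support_nil, List.mem_cons,
          List.not_mem_nil, or_false]; tauto)
  have he1 : s(p, q) ∈ w.edges := h2 _ (by simp)
  obtain ⟨u, w', h1', h2', h3', h4'⟩ := exists_extension hT w.reverse h1.reverse (by simpa using not_nil_of_mem_edges he1)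
    (fun x hx hv hp => h3 x (by simpa using hx) hp hv)
  have he2 : s(p, q) ∈ w'.edges := h2' _ (by simpa)
  refine ⟨v, u, w', ⟨?_, h4, h4', h1', h3'⟩, he2⟩
  rintro rfl
  exact not_nil_of_mem_edges he2 (Walk.isPath_iff_nil.1 h1')

lemma segmentMultiset_eq [Fintype V] (hT : T.IsTree) :
    segmentMultiset T = componentSizes (segGraph T) := by
  have hC : ∀ C : (segGraph T).ConnectedComponent, ∃ (u v : V) (w : T.Walk u v),
      IsSegWalk w ∧ C.supp = {f | f.1 ∈ w.edges} := by
    intro C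
    induction C using ConnectedComponent.ind with
    | _ e =>
    obtain ⟨u, v, w, hw, he⟩ := exists_isSegWalk hT e.2
    exact ⟨u, v, w, hw, hw.supp_eq he⟩
  choose u v w hw hs using hC
  symm
  refine Multiset.map_eq_map_of_bij_of_nodup _ _ (Finset.nodup _) (Finset.nodup _)
    (fun C _ => s(u C, v C)) ?_ ?_ ?_ ?_
  · intro C _
    rw [Finset.mem_val, Set.Finite.mem_toFinset]
    exact ⟨_, _, rfl, (hw C).isSegment⟩
  · intro C _ D _ h
    refine ConnectedComponent.supp_injective ?_
    rw [hs, hs]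
    ext f
    exact mem_edges_iff_of_isTree hT (hw C).isPath (hw D).isPath h _
  · intro e he
    rw [Finset.mem_val, Set.Finite.mem_toFinset] at he
    obtain ⟨a, b, rfl, hab⟩ := he
    obtain ⟨p, hp⟩ := isSegment_iff.1 hab
    have hm := p.mk_start_snd_mem_edges hp.not_nil
    refine ⟨(segGraph T).connectedComponentMk ⟨_, p.edges_subset_edgeSet hm⟩, by simp, ?_⟩
    refine (hw _).eq_of_edges_subset hp fun e he => ?_
    have h1 := hp.supp_eq (e := ⟨_, p.edges_subset_edgeSet hm⟩) hm
    rw [hs] at h1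
    have : (⟨e, Walk.edges_subset_edgeSet _ he⟩ : T.edgeSet) ∈ {f : T.edgeSet | f.1 ∈ p.edges} := by
      rw [← h1]
      exact he
    exact this
  · intro C _
    rw [hs, ncard_edges_eq_length (hw C).isPath, IsPath.length_eq_dist_of_isTree hT (hw C).isPath]
    rfl

end Segments

section Pendant

variable {V : Type*} {T : SimpleGraph V}

lemma sum_segmentMultiset_add_one [Fintype V] (hT : T.IsTree) :
    (segmentMultiset T).sum + 1 = Fintype.card V := by
  rw [segmentMultiset_eq hT, sum_componentSizes, ← card_edgesFin_add_one hT,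
    ← Set.ncard_coe_finset, Nat.card_coe_set_eq]
  congr 2
  ext e
  simp

lemma segmentMultiset_eq_of_iso {W : Type*} [Fintype V] [Fintype W] {T' : SimpleGraph W}
    (hT : T.IsTree) (φ : T ≃g T') : segmentMultiset T' = segmentMultiset T := by
  rw [segmentMultiset_eq hT, segmentMultiset_eq (φ.isTree_iff.1 hT)]
  exact (componentSizes_congr (segGraphIso φ)).symm

lemma Switchable.segmentMultiset_switch [Fintype V] {x x' y y' : V}
    (h : Switchable T x x' y y') (hx : IsBranchV T x) (hy : IsBranchV T y) :
    segmentMultiset (switch T x x' y y') = segmentMultiset T := by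
  rw [segmentMultiset_eq h.isTree, segmentMultiset_eq h.isTree_switch]
  exact (componentSizes_congr (h.segGraphIso (degN_ne_two_of_leaf_or_branch (Or.inr hx))
    (degN_ne_two_of_leaf_or_branch (Or.inr hy)))).symm

lemma eq_of_isLeafV {u x y : V} (h : IsLeafV T u) (hx : T.Adj u x) (hy : T.Adj u y) : x = y := by
  obtain ⟨a, ha⟩ := Set.ncard_eq_one.1 h
  have h1 : x ∈ T.neighborSet u := hx
  have h2 : y ∈ T.neighborSet u := hy
  rw [ha] at h1 h2
  exact h1.trans h2.symm

lemma IsSegWalk.mem_edges_of_adj [Finite V] {u v : V} {w : T.Walk u v} (h : IsSegWalk w)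
    {x y : V} (hx : x ∈ w.support) (hxb : ¬ IsBranchV T x) (hxy : T.Adj x y) :
    s(x, y) ∈ w.edges := by
  by_cases hxu : x = u
  · subst hxu
    rw [eq_of_isLeafV (h.left.resolve_right hxb) hxy (w.adj_snd h.not_nil)]
    exact w.mk_start_snd_mem_edges h.not_nil
  by_cases hxv : x = v
  · subst hxv
    rw [eq_of_isLeafV (h.right.resolve_right hxb) hxy (w.adj_penultimate h.not_nil).symm,
      Sym2.eq_swap]
    exact w.mk_penultimate_end_mem_edges h.not_nil
  exact mem_edges_of_degN_eq_two h.isPath hx hxu hxv (h.internal x hx hxu hxv) hxy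

lemma IsSegWalk.not_isBranchV {u v : V} {w : T.Walk u v} (h : IsSegWalk w) (hu : IsLeafV T u)
    {x : V} (hx : x ∈ w.support) (hxv : x ≠ v) : ¬ IsBranchV T x := by
  by_cases hxu : x = u
  · subst hxu
    exact fun hb => not_isLeafV_of_isBranchV hb hu
  · rw [IsBranchV, h.internal x hx hxu hxv]
    omega

lemma exists_isBranchV [Fintype V] (hT : T.IsTree) (h : 2 ≤ Multiset.card (segmentMultiset T)) :
    ∃ x, IsBranchV T x := by
  by_contra hcon
  push Not at hcon
  rw [segmentMultiset, Multiset.card_map, Finset.card_val, ← Set.ncard_eq_toFinset_card,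
    ← Nat.lt_iff_add_one_le, Set.one_lt_ncard (Set.toFinite _)] at h
  obtain ⟨_, ⟨u, v, rfl, huv⟩, _, ⟨u', v', rfl, huv'⟩, hne⟩ := h
  obtain ⟨w, hw⟩ := isSegment_iff.1 huv
  obtain ⟨w', hw'⟩ := isSegment_iff.1 huv'
  refine hne (hw'.eq_of_edges_subset hw fun e he => ?_).symm
  have huniv := eq_univ_of_closed (T := T) (A := {z | z ∈ w.support}) hT.1
    (fun p q hpq hp => w.snd_mem_support_of_mem_edges (hw.mem_edges_of_adj hp (hcon p) hpq))
    (Walk.start_mem_support w)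
  obtain ⟨p, q⟩ := e
  have hp : p ∈ {z | z ∈ w.support} := by
    rw [huniv]
    trivial
  exact hw.mem_edges_of_adj hp (hcon p) (w'.edges_subset_edgeSet he)

/-- The branch cut off by a pendant segment. -/
lemma IsSegWalk.branchAt_eq [Finite V] (hT : T.IsTree) {u v : V} {w : T.Walk u v}
    (h : IsSegWalk w) (hu : IsLeafV T u) :
    branchAt T v w.penultimate = {z | z ∈ w.support ∧ z ≠ v} := by
  have hadj := w.adj_penultimate h.not_nil
  have hx : w.penultimate ∈ {z | z ∈ w.support ∧ z ≠ v} :=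
    ⟨w.getVert_mem_support _, hadj.ne⟩
  have key : ∀ p q, T.Adj p q → p ∈ {z | z ∈ w.support ∧ z ≠ v} →
      q ∉ {z | z ∈ w.support ∧ z ≠ v} → s(p, q) = s(v, w.penultimate) := by
    intro p q hpq hp hq
    have he := h.mem_edges_of_adj hp.1 (h.not_isBranchV hu hp.1 hp.2) hpq
    have hqs := w.snd_mem_support_of_mem_edges he
    obtain rfl : q = v := by
      by_contra hne
      exact hq ⟨hqs, hne⟩
    rw [Sym2.eq_swap] at he ⊢
    rw [h.isPath.eq_penultimate_of_mem_edges he]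
  have hB : IsCut T s(v, w.penultimate) {z | z ∈ w.support ∧ z ≠ v} := by
    refine ⟨hadj.symm, fun p q hpq => ⟨fun hiff heq => ?_, fun hne => ?_⟩⟩
    · have hv : v ∉ {z | z ∈ w.support ∧ z ≠ v} := fun h => h.2 rfl
      rcases Sym2.eq_iff.1 heq with ⟨rfl, rfl⟩ | ⟨rfl, rfl⟩ <;> tauto
    · by_contra hcon
      by_cases hp : p ∈ {z | z ∈ w.support ∧ z ≠ v}
      · exact hne (key p q hpq hp (by tauto))
      · exact hne (Sym2.eq_swap.trans (key q p hpq.symm (by tauto) hp))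
  exact hB.eq_of_mem hT.1 (isCut_branchAt hT hadj.symm) hx (mem_branchAt _ _)

lemma IsSegWalk.ncard_branchAt [Finite V] (hT : T.IsTree) {u v : V} {w : T.Walk u v}
    (h : IsSegWalk w) (hu : IsLeafV T u) :
    (branchAt T v w.penultimate).ncard = T.dist u v := by
  classical
  have : {z | z ∈ w.support ∧ z ≠ v} = (w.support.toFinset.erase v : Set V) := by
    ext z
    simp [and_comm]
  rw [h.branchAt_eq hT hu, this, Set.ncard_coe_finset, Finset.card_erase_of_mem (by simp),
    List.toFinset_card_of_nodup h.isPath.support_nodup, Walk.length_support,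
    ← IsPath.length_eq_dist_of_isTree hT h.isPath, Nat.add_sub_cancel]

/-- A branch at a branch vertex without further branch vertices is a pendant segment. -/
lemma exists_isSegWalk_of_branchAt [Fintype V] (hT : T.IsTree) {c n : V} (hc : IsBranchV T c)
    (hcn : T.Adj c n) (hn : ∀ z ∈ branchAt T c n, ¬ IsBranchV T z) :
    ∃ (a : V) (w : T.Walk a c), IsSegWalk w ∧ IsLeafV T a ∧ w.penultimate = n := by
  obtain ⟨u, w, hw, he⟩ : ∃ (u : V) (w : T.Walk u c), IsSegWalk w ∧ s(c, n) ∈ w.edges := by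
    obtain ⟨u, v, w, hw, he⟩ := exists_isSegWalk hT (e := s(c, n)) hcn
    have hcs := w.fst_mem_support_of_mem_edges he
    by_cases hcv : c = v
    · subst hcv
      exact ⟨u, w, hw, he⟩
    by_cases hcu : c = u
    · subst hcu
      exact ⟨v, w.reverse, hw.reverse, by simpa⟩
    · exact absurd (hw.internal c hcs hcu hcv) (degN_ne_two_of_leaf_or_branch (Or.inr hc))
  have hpen := hw.isPath.eq_penultimate_of_mem_edges he
  refine ⟨u, w, hw, hw.left.resolve_right (hn u ?_), hpen.symm⟩
  obtain ⟨b, hb, hub⟩ := exists_mem_branchAt hT hw.ne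
  have := (isCut_branchAt hT hb).mem_edges w hub (notMem_branchAt hT hb)
  rw [hpen, ← hw.isPath.eq_penultimate_of_mem_edges this]
  exact hub

end Pendant

section Optimal

variable {V : Type*} {T : SimpleGraph V}

/-- No exchange of two branches at branch vertices of `T` is certain to be an improvement. -/
def SwitchOptimal [Fintype V] (T : SimpleGraph V) : Prop :=
  ∀ x x' y y', Switchable T x x' y y' → IsBranchV T x → IsBranchV T y →
    (branchAt T x x').ncard < (branchAt T y y').ncard →
    ∃ e A, IsCut T e A ∧ x ∈ A ∧ y ∉ A ∧
      Fintype.card V + (branchAt T x x').ncard ≤ 2 * A.ncard + (branchAt T y y').ncard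

lemma exists_optimal {k : ℕ} (hk : 1 ≤ k) {ℓ : Multiset ℕ}
    (hex : ∃ (V : Type) (_ : Fintype V) (T0 : SimpleGraph V),
      T0.IsTree ∧ segmentMultiset T0 = ℓ) :
    ∃ T : SimpleGraph (Fin (ℓ.sum + 1)), T.IsTree ∧ segmentMultiset T = ℓ ∧
      (∀ (W : Type) [Fintype W] (H : SimpleGraph W), H.IsTree → segmentMultiset H = ℓ →
        steinerWiener H k ≤ steinerWiener T k) ∧ SwitchOptimal T := by
  have htrans : ∀ (W : Type) [Fintype W] (H : SimpleGraph W), H.IsTree → segmentMultiset H = ℓ →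
      ∃ T : SimpleGraph (Fin (ℓ.sum + 1)), T.IsTree ∧ segmentMultiset T = ℓ ∧
        steinerWiener T k = steinerWiener H k := by
    rintro W _ H hH rfl
    let e : W ≃ Fin ((segmentMultiset H).sum + 1) :=
      Fintype.equivFinOfCardEq (sum_segmentMultiset_add_one hH).symm
    let φ : H ≃g H.map e.toEmbedding := Iso.map e H
    exact ⟨_, φ.isTree_iff.1 hH, segmentMultiset_eq_of_iso hH φ, steinerWiener_eq_of_iso hH.1 φ k⟩
  let S : Set (SimpleGraph (Fin (ℓ.sum + 1))) := {T | T.IsTree ∧ segmentMultiset T = ℓ}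
  obtain ⟨V, _, T0, hT0, hℓ⟩ := hex
  obtain ⟨T1, hT1, hT1ℓ, -⟩ := htrans V T0 hT0 hℓ
  obtain ⟨T2, hT2, hmin2⟩ := Set.exists_min_image S (fun T => totalCutCost T k) (Set.toFinite _)
    ⟨T1, hT1, hT1ℓ⟩
  obtain ⟨T, hTS, hmin⟩ := Set.exists_min_image
    {T | T ∈ S ∧ totalCutCost T k ≤ totalCutCost T2 k} (fun T => totalCutCost T 2) (Set.toFinite _)
    ⟨T2, hT2, le_rfl⟩
  obtain ⟨⟨hT, hTℓ⟩, hTk⟩ := hTS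
  refine ⟨T, hT, hTℓ, fun W _ H hH hHℓ => ?_, ?_⟩
  · obtain ⟨T', hT', hT'ℓ, h⟩ := htrans W H hH hHℓ
    rw [← h]
    have h1 := steinerWiener_add_totalCutCost hT hk
    have h2 := steinerWiener_add_totalCutCost hT' hk
    have h3 := hmin2 T' ⟨hT', hT'ℓ⟩
    omega
  · intro x x' y y' h hx hy hlt
    by_contra hcon
    push Not at hcon
    obtain ⟨h1, h2⟩ := h.totalCutCost_switch_le hlt hcon
    have h3 := hmin (switch T x x' y y')
      ⟨⟨h.isTree_switch, (h.segmentMultiset_switch hx hy).trans hTℓ⟩, (h1 k).trans hTk⟩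
    exact absurd h2 h3.not_gt

end Optimal

section Structure

variable {V : Type*} {T : SimpleGraph V}

lemma isBranchV_of_adj [Finite V] {c n₁ n₂ n₃ : V} (h₁ : T.Adj c n₁) (h₂ : T.Adj c n₂)
    (h₃ : T.Adj c n₃) (h₁₂ : n₁ ≠ n₂) (h₁₃ : n₁ ≠ n₃) (h₂₃ : n₂ ≠ n₃) : IsBranchV T c := by
  have h : ({n₁, n₂, n₃} : Set V).ncard = 3 := by
    rw [Set.ncard_eq_three]
    exact ⟨n₁, n₂, n₃, h₁₂, h₁₃, h₂₃, rfl⟩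
  rw [IsBranchV, ← h]
  refine Set.ncard_le_ncard ?_ (Set.toFinite _)
  rintro z (rfl | rfl | rfl) <;> assumption

lemma add_ncard_branchAt_lt [Fintype V] (hT : T.IsTree) {c n₁ n₂ n₃ : V} (h₁ : T.Adj c n₁)
    (h₂ : T.Adj c n₂) (h₃ : T.Adj c n₃) (h₁₂ : n₁ ≠ n₂) (h₁₃ : n₁ ≠ n₃) (h₂₃ : n₂ ≠ n₃) :
    (branchAt T c n₁).ncard + (branchAt T c n₂).ncard + (branchAt T c n₃).ncard <
      Fintype.card V := by
  rw [← Set.ncard_union_eq (disjoint_branchAt hT h₁ h₂ h₁₂),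
    ← Set.ncard_union_eq (Set.disjoint_union_left.2
      ⟨disjoint_branchAt hT h₁ h₃ h₁₃, disjoint_branchAt hT h₂ h₃ h₂₃⟩),
    ← Nat.card_eq_fintype_card, ← Set.ncard_univ]
  refine Set.ncard_lt_ncard ⟨Set.subset_univ _, fun h => ?_⟩
  rcases h (Set.mem_univ c) with (h | h) | h
  · exact notMem_branchAt hT h₁ h
  · exact notMem_branchAt hT h₂ h
  · exact notMem_branchAt hT h₃ h

lemma exists_adj_notMem_branchAt [Finite V] (hT : T.IsTree) {v c : V} (hv : IsBranchV T v)
    (hne : c ≠ v) : ∃ v', T.Adj v v' ∧ c ∉ branchAt T v v' := by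
  obtain ⟨b, hb, hcb⟩ := exists_mem_branchAt hT hne
  have h1 : 1 < (T.neighborSet v).ncard := lt_of_lt_of_le (by norm_num) hv
  obtain ⟨v', hv', hne'⟩ := Set.exists_ne_of_one_lt_ncard h1 b
  exact ⟨v', hv', fun h => hne' (eq_of_mem_branchAt hT hv' hb h hcb)⟩

lemma SwitchOptimal.ncard_lt_or_ncard_lt [Fintype V] (hT : T.IsTree) (hopt : SwitchOptimal T)
    {c n₁ n₂ n₃ v : V} (h₁ : T.Adj c n₁) (h₂ : T.Adj c n₂) (h₃ : T.Adj c n₃) (h₁₂ : n₁ ≠ n₂)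
    (h₁₃ : n₁ ≠ n₃) (h₂₃ : n₂ ≠ n₃) (hv : IsBranchV T v) (hvc : v ∈ branchAt T c n₁) :
    (branchAt T c n₂).ncard < (branchAt T c n₁).ncard ∨
      (branchAt T c n₃).ncard < (branchAt T c n₁).ncard := by
  by_contra hcon
  push Not at hcon
  have hne : c ≠ v := by
    rintro rfl
    exact notMem_branchAt hT h₁ hvc
  obtain ⟨v', hv', hcv'⟩ := exists_adj_notMem_branchAt hT hv hne
  have hlt : (branchAt T v v').ncard < (branchAt T c n₁).ncard :=
    Set.ncard_lt_ncard ⟨branchAt_subset_of_notMem hT h₁ hv' hvc hcv',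
      fun h => notMem_branchAt hT hv' (h hvc)⟩ (Set.toFinite _)
  obtain ⟨e, A, hA, hvA, hcA, hle⟩ := hopt v v' c n₂
    ⟨hT, hne.symm, hv', h₂, hcv', fun h => h₁₂ (eq_of_mem_branchAt hT h₁ h₂ hvc h)⟩ hv
    (isBranchV_of_adj h₁ h₂ h₃ h₁₂ h₁₃ h₂₃) (by omega)
  have h := Set.ncard_le_ncard (hA.subset_branchAt hT h₁ hvc hvA hcA) (Set.toFinite _)
  have := add_ncard_branchAt_lt hT h₁ h₂ h₃ h₁₂ h₁₃ h₂₃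
  omega

/-- No vertex has branch vertices in three directions. -/
lemma SwitchOptimal.false_of_three [Fintype V] (hT : T.IsTree) (hopt : SwitchOptimal T)
    {c n₁ n₂ n₃ v₁ v₂ v₃ : V} (h₁ : T.Adj c n₁) (h₂ : T.Adj c n₂) (h₃ : T.Adj c n₃)
    (h₁₂ : n₁ ≠ n₂) (h₁₃ : n₁ ≠ n₃) (h₂₃ : n₂ ≠ n₃) (hv₁ : IsBranchV T v₁)
    (hv₂ : IsBranchV T v₂) (hv₃ : IsBranchV T v₃) (hvc₁ : v₁ ∈ branchAt T c n₁)
    (hvc₂ : v₂ ∈ branchAt T c n₂) (hvc₃ : v₃ ∈ branchAt T c n₃) : False := by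
  have := hopt.ncard_lt_or_ncard_lt hT h₁ h₂ h₃ h₁₂ h₁₃ h₂₃ hv₁ hvc₁
  have := hopt.ncard_lt_or_ncard_lt hT h₂ h₁ h₃ h₁₂.symm h₂₃ h₁₃ hv₂ hvc₂
  have := hopt.ncard_lt_or_ncard_lt hT h₃ h₁ h₂ h₁₃.symm h₂₃.symm h₁₂ hv₃ hvc₃
  omega

/-- A branch between two others is not larger than both of them. -/
lemma SwitchOptimal.ncard_le_or_ncard_le [Fintype V] (hT : T.IsTree) (hopt : SwitchOptimal T)
    {b₁ b₂ b₃ x₁ x₂ x₃ n₁ n₃ : V} (h₁ : T.Adj b₂ n₁) (h₂ : T.Adj b₂ x₂) (h₃ : T.Adj b₂ n₃)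
    (h₁₂ : n₁ ≠ x₂) (h₁₃ : n₁ ≠ n₃) (h₂₃ : x₂ ≠ n₃) (hb₁ : IsBranchV T b₁)
    (hb₃ : IsBranchV T b₃) (hm₁ : b₁ ∈ branchAt T b₂ n₁) (hm₃ : b₃ ∈ branchAt T b₂ n₃)
    (hx₁ : T.Adj b₁ x₁) (hx₃ : T.Adj b₃ x₃) (hn₁ : b₂ ∉ branchAt T b₁ x₁)
    (hn₃ : b₂ ∉ branchAt T b₃ x₃) :
    (branchAt T b₂ x₂).ncard ≤ (branchAt T b₁ x₁).ncard ∨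
      (branchAt T b₂ x₂).ncard ≤ (branchAt T b₃ x₃).ncard := by
  by_contra hcon
  push Not at hcon
  have hb₂ := isBranchV_of_adj h₁ h₂ h₃ h₁₂ h₁₃ h₂₃
  have key : ∀ b x n, T.Adj b₂ n → n ≠ x₂ → IsBranchV T b → b ∈ branchAt T b₂ n → T.Adj b x →
      b₂ ∉ branchAt T b x → (branchAt T b x).ncard < (branchAt T b₂ x₂).ncard →
      Fintype.card V + (branchAt T b x).ncard ≤
        2 * (branchAt T b₂ n).ncard + (branchAt T b₂ x₂).ncard := by
    intro b x n hn hnx hb hbn hx hbx hlt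
    obtain ⟨e, A, hA, hbA, hbA₂, hle⟩ := hopt b x b₂ x₂
      ⟨hT, fun h => notMem_branchAt hT hn (h ▸ hbn), hx, h₂, hbx,
        fun h => hnx (eq_of_mem_branchAt hT hn h₂ hbn h)⟩ hb hb₂ hlt
    have h := Set.ncard_le_ncard (hA.subset_branchAt hT hn hbn hbA hbA₂) (Set.toFinite _)
    omega
  have k₁ := key b₁ x₁ n₁ h₁ h₁₂ hb₁ hm₁ hx₁ hn₁ hcon.1
  have k₃ := key b₃ x₃ n₃ h₃ h₂₃.symm hb₃ hm₃ hx₃ hn₃ hcon.2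
  have := add_ncard_branchAt_lt hT h₁ h₂ h₃ h₁₂ h₁₃ h₂₃
  omega

lemma exists_walk_edges_subset {u v c y : V} (w : T.Walk u v) (hc : c ∈ w.support)
    (hy : y ∈ w.support) : ∃ p : T.Walk c y, ∀ e ∈ p.edges, e ∈ w.edges := by
  classical
  refine ⟨(w.takeUntil c hc).reverse.append (w.takeUntil y hy), fun e he => ?_⟩
  rw [Walk.edges_append, List.mem_append, Walk.edges_reverse, List.mem_reverse] at he
  rcases he with he | he
  · exact w.edges_takeUntil_subset_edges hc he
  · exact w.edges_takeUntil_subset_edges hy he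

/-- A vertex off a walk lies in a branch that leaves the walk. -/
lemma exists_branchAt_disjoint [Finite V] (hT : T.IsTree) {u v z : V} (w : T.Walk u v)
    (hz : z ∉ w.support) : ∃ c n, c ∈ w.support ∧ T.Adj c n ∧ z ∈ branchAt T c n ∧
      ∀ y ∈ w.support, y ∉ branchAt T c n := by
  have key : ∀ m c n, (branchAt T c n).ncard = m → c ∈ w.support → T.Adj c n →
      z ∈ branchAt T c n → ∃ c n, c ∈ w.support ∧ T.Adj c n ∧ z ∈ branchAt T c n ∧
        ∀ y ∈ w.support, y ∉ branchAt T c n := by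
    intro m
    induction m using Nat.strong_induction_on with
    | _ m ih =>
    intro c n hm hc hcn hzn
    by_cases hn : n ∈ w.support
    · obtain ⟨n', hn', hzn'⟩ := exists_mem_branchAt hT (z := z) (a := n)
        (by rintro rfl; exact hz hn)
      have hne : c ∉ branchAt T n n' := by
        intro hc'
        have := eq_of_mem_branchAt hT hcn.symm hn' (mem_branchAt _ _) hc'
        rw [← this, branchAt_swap hT hcn] at hzn'
        exact hzn' hzn
      refine ih _ ?_ n n' rfl hn hn' hzn'
      rw [← hm]
      exact Set.ncard_lt_ncard
        ⟨branchAt_subset_of_notMem hT hcn hn' (mem_branchAt _ _) hne,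
          fun h => notMem_branchAt hT hn' (h (mem_branchAt _ _))⟩ (Set.toFinite _)
    · refine ⟨c, n, hc, hcn, hzn, fun y hy hyn => hn ?_⟩
      obtain ⟨p, hp⟩ := exists_walk_edges_subset w hy hc
      have := (isCut_branchAt hT hcn).mem_edges p hyn (notMem_branchAt hT hcn)
      exact w.snd_mem_support_of_mem_edges (hp _ this)
  obtain ⟨n, hn, hzn⟩ := exists_mem_branchAt hT (z := z) (a := u)
    (by rintro rfl; exact hz (Walk.start_mem_support _))
  exact key _ u n rfl (Walk.start_mem_support _) hn hzn

/-- The two directions of a path at an interior vertex differ. -/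
lemma ne_of_mem_branchAt_of_isPath (hT : T.IsTree) {u v a b c n₁ n₂ : V} {p : T.Walk u c}
    {q : T.Walk c v} (hpq : (p.append q).IsPath) (ha : a ∈ p.support) (hb : b ∈ q.support)
    (h₁ : T.Adj c n₁) (ha₁ : a ∈ branchAt T c n₁) (hb₂ : b ∈ branchAt T c n₂) : n₁ ≠ n₂ := by
  rintro rfl
  have := notMem_branchAt hT h₁
  exact (isCut_branchAt hT h₁).false_of_append_isPath hpq ha hb (by tauto) (by tauto)

lemma dist_lt_of_mem_branchAt (hT : T.IsTree) {u v z n : V} (hun : T.Adj u n)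
    (hz : z ∈ branchAt T u n) (hv : v ∉ branchAt T u n) : T.dist u v < T.dist z v := by
  classical
  obtain ⟨q, hq⟩ := hT.1.exists_walk_length_eq_dist z v
  have hu := q.fst_mem_support_of_mem_edges ((isCut_branchAt hT hun).mem_edges q hz hv)
  have h1 := q.take_spec hu
  apply_fun Walk.length at h1
  rw [Walk.length_append] at h1
  have h2 := dist_le (q.dropUntil u hu)
  have h3 : (q.takeUntil u hu).length ≠ 0 := by
    intro h
    have := Walk.eq_of_length_eq_zero h
    subst this
    exact notMem_branchAt hT hun hz
  omega

lemma SwitchOptimal.exists_path [Fintype V] (hT : T.IsTree) (hopt : SwitchOptimal T)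
    (hb : ∃ x, IsBranchV T x) : ∃ (u v : V) (w : T.Walk u v), w.IsPath ∧ IsBranchV T u ∧
      IsBranchV T v ∧ ∀ z, IsBranchV T z → z ∈ w.support := by
  classical
  obtain ⟨x, hx⟩ := hb
  obtain ⟨⟨u, v⟩, ⟨hu, hv⟩, hmax⟩ := Set.exists_max_image
    {p : V × V | IsBranchV T p.1 ∧ IsBranchV T p.2} (fun p => T.dist p.1 p.2) (Set.toFinite _)
    ⟨(x, x), hx, hx⟩
  dsimp only at hu hv hmax
  obtain ⟨w, hw⟩ := hT.1.exists_isPath u v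
  refine ⟨u, v, w, hw, hu, hv, fun z hz => ?_⟩
  by_contra hzw
  obtain ⟨c, n, hc, hcn, hzn, hdis⟩ := exists_branchAt_disjoint hT w hzw
  have hun := hdis u (Walk.start_mem_support _)
  have hvn := hdis v (Walk.end_mem_support _)
  by_cases hcu : u = c
  · subst hcu
    exact (hmax (z, v) ⟨hz, hv⟩).not_gt (dist_lt_of_mem_branchAt hT hcn hzn hvn)
  by_cases hcv : v = c
  · subst hcv
    have h1 := hmax (u, z) ⟨hu, hz⟩
    have h2 := dist_lt_of_mem_branchAt hT hcn hzn hun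
    rw [dist_comm, T.dist_comm (u := z)] at h2
    exact h1.not_gt h2
  obtain ⟨n₁, h₁, hu₁⟩ := exists_mem_branchAt hT hcu
  obtain ⟨n₂, h₂, hv₂⟩ := exists_mem_branchAt hT hcv
  have hne := ne_of_mem_branchAt_of_isPath hT (p := w.takeUntil c hc) (q := w.dropUntil c hc)
    (by rwa [Walk.take_spec]) (Walk.start_mem_support _) (Walk.end_mem_support _) h₁ hu₁ hv₂
  exact hopt.false_of_three hT h₁ h₂ hcn hne (by rintro rfl; exact hun hu₁)
    (by rintro rfl; exact hvn hv₂) hu hv hz hu₁ hv₂ hzn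

lemma IsSegWalk.isBranchV_right [Fintype V] (hT : T.IsTree) (hb : ∃ x, IsBranchV T x) {a b : V}
    {s : T.Walk a b} (hs : IsSegWalk s) (ha : IsLeafV T a) : IsBranchV T b := by
  by_contra hbb
  have hnb : ∀ x ∈ s.support, ¬ IsBranchV T x := by
    intro x hx
    by_cases hxb : x = b
    · rwa [hxb]
    · exact hs.not_isBranchV ha hx hxb
  have huniv := eq_univ_of_closed (T := T) (A := {z | z ∈ s.support}) hT.1
    (fun p q hpq hp => s.snd_mem_support_of_mem_edges (hs.mem_edges_of_adj hp (hnb p hp) hpq))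
    (Walk.start_mem_support s)
  obtain ⟨x, hx⟩ := hb
  have hxs : x ∈ {z | z ∈ s.support} := by
    rw [huniv]
    trivial
  exact hnb x hxs hx

lemma SwitchOptimal.isQuasiCaterpillar [Fintype V] (hT : T.IsTree) (hopt : SwitchOptimal T)
    (hb : ∃ x, IsBranchV T x) : IsQuasiCaterpillar T := by
  classical
  refine ⟨hT, ?_⟩
  obtain ⟨u, v, w, hw, hu, hv, hall⟩ := hopt.exists_path hT hb
  have hon : ∀ x ∈ w.support, x ∈ (pendantSegmentVertices T)ᶜ := by
    rintro x hx ⟨a, b, s, hab, ha, hs, hint, hxs, hxb⟩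
    have hseg : IsSegWalk s := ⟨hab.1, hab.2.1, hab.2.2.1, hs, hint⟩
    have hbb := hseg.isBranchV_right hT hb ha
    have hadj := (s.adj_penultimate hseg.not_nil).symm
    have hreg := hseg.branchAt_eq hT ha
    have hxr : x ∈ branchAt T b s.penultimate := by
      rw [hreg]
      exact ⟨hxs, by rintro rfl; exact hxb hbb⟩
    have hnr : ∀ z, IsBranchV T z → z ∉ branchAt T b s.penultimate := by
      intro z hz hzr
      rw [hreg] at hzr
      exact hseg.not_isBranchV ha hzr.1 hzr.2 hz
    have h1 := hnr u hu
    have h2 := hnr v hv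
    exact (isCut_branchAt hT hadj).false_of_append_isPath (p := w.takeUntil x hx)
      (q := w.dropUntil x hx) (by rwa [Walk.take_spec]) (Walk.start_mem_support _)
      (Walk.end_mem_support _) (by tauto) (by tauto)
  have hoff : ∀ x ∈ (pendantSegmentVertices T)ᶜ, x ∈ w.support := by
    intro x hx
    by_contra hxw
    refine hx ?_
    obtain ⟨c, n, hc, hcn, hxn, hdis⟩ := exists_branchAt_disjoint hT w hxw
    have hcb : IsBranchV T c := by
      by_cases hcu : u = c
      · rwa [← hcu]
      by_cases hcv : v = c
      · rwa [← hcv]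
      obtain ⟨n₁, h₁, hu₁⟩ := exists_mem_branchAt hT hcu
      obtain ⟨n₂, h₂, hv₂⟩ := exists_mem_branchAt hT hcv
      have hne := ne_of_mem_branchAt_of_isPath hT (p := w.takeUntil c hc) (q := w.dropUntil c hc)
        (by rwa [Walk.take_spec]) (Walk.start_mem_support _) (Walk.end_mem_support _) h₁ hu₁ hv₂
      exact isBranchV_of_adj h₁ h₂ hcn hne
        (by rintro rfl; exact hdis u (Walk.start_mem_support _) hu₁)
        (by rintro rfl; exact hdis v (Walk.end_mem_support _) hv₂)
    obtain ⟨a, s, hs, ha, hpen⟩ := exists_isSegWalk_of_branchAt hT hcb hcn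
      fun z hz hzb => hdis z (hall z hzb) hz
    rw [← hpen, hs.branchAt_eq hT ha] at hxn
    exact ⟨a, c, s, hs.isSegment, ha, hs.isPath, hs.internal, hxn.1,
      hs.not_isBranchV ha hxn.1 hxn.2⟩
  refine ⟨_, _, w.induce _ hon, ?_, ?_⟩
  · refine Walk.IsPath.of_map (f := (Embedding.induce _).toHom) ?_
    rwa [Walk.map_induce]
  · rintro ⟨x, hx⟩
    rw [Walk.support_induce]
    simpa using hoff x hx

end Structure

section Valley

lemma exists_valley_enumeration {P : Type*} [Fintype P] [Nonempty P] (d len : P → ℕ)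
    (h : ∀ p q r, d p < d q → d q < d r → len q ≤ len p ∨ len q ≤ len r) :
    ∃ f : Fin (Fintype.card P) ≃ P, (∀ i j, i ≤ j → d (f i) ≤ d (f j)) ∧
      ∃ j', (∀ i₁ i₂, i₁ ≤ i₂ → i₂ ≤ j' → len (f i₂) ≤ len (f i₁)) ∧
        ∀ i₁ i₂, j' ≤ i₁ → i₁ ≤ i₂ → len (f i₁) ≤ len (f i₂) := by
  classical
  obtain ⟨p₀, hp₀⟩ := Finite.exists_min len
  let L : P → Prop := fun p => d p < d p₀ ∨ (d p = d p₀ ∧ ∀ q, d q < d p₀ → len p ≤ len q)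
  let key : P → ℕ ×ₗ ℤ := fun p => toLex (d p, if L p then -(len p : ℤ) else len p + 1)
  have hkey : ∀ p q, key p ≤ key q ↔ d p < d q ∨ (d p = d q ∧
      (if L p then -(len p : ℤ) else len p + 1) ≤ if L q then -(len q : ℤ) else len q + 1) :=
    fun p q => Prod.Lex.toLex_le_toLex
  have hL₀ : L p₀ := Or.inr ⟨rfl, fun q _ => hp₀ q⟩
  let e := (Fintype.equivFin P).symm
  let f : Fin (Fintype.card P) ≃ P := (Tuple.sort (key ∘ e)).trans e
  have hf : ∀ i j, i ≤ j → key (f i) ≤ key (f j) := fun i j hij =>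
    Tuple.monotone_sort (key ∘ e) hij
  refine ⟨f, fun i j hij => ?_, f.symm p₀, fun i₁ i₂ h₁ h₂ => ?_, fun i₁ i₂ h₁ h₂ => ?_⟩
  · rcases (hkey _ _).1 (hf i j hij) with h | h <;> omega
  · have k₁ := (hkey _ _).1 (hf _ _ h₁)
    have k₂ := (hkey _ _).1 (hf _ _ h₂)
    have k₃ := (hkey _ _).1 (hf _ _ (h₁.trans h₂))
    rw [f.apply_symm_apply] at k₂ k₃
    generalize f i₁ = p at *
    generalize f i₂ = q at *
    have hLe : ∀ p, d p < d p₀ ∨ (d p = d p₀ ∧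
        (if L p then -(len p : ℤ) else len p + 1) ≤
          if L p₀ then -(len p₀ : ℤ) else len p₀ + 1) → L p := by
      intro p hp
      rcases hp with hp | hp
      · exact Or.inl hp
      · by_contra hLp
        rw [if_neg hLp, if_pos hL₀] at hp
        omega
    have hp := hLe p k₃
    have hq := hLe q k₂
    rw [if_pos hp, if_pos hq] at k₁
    rcases k₁ with k₁ | k₁
    · rcases hq with hq | hq
      · have := h p q p₀ k₁ hq
        have := hp₀ p
        omega
      · exact hq.2 p (by omega)
    · omega
  · have k₁ := (hkey _ _).1 (hf _ _ h₂)
    have k₂ := (hkey _ _).1 (hf _ _ h₁)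
    have k₃ := (hkey _ _).1 (hf _ _ (h₁.trans h₂))
    rw [f.apply_symm_apply] at k₂ k₃
    generalize f i₁ = p at *
    generalize f i₂ = q at *
    rw [if_pos hL₀] at k₂ k₃
    have hpq := hp₀ q
    by_cases hp : L p
    · rw [if_pos hp] at k₂
      have : ¬ d p₀ < d p := by
        rcases hp with hp | hp <;> omega
      omega
    · rw [if_neg hp] at k₁
      by_cases hlt : d p < d q
      · rcases k₂ with k₂ | k₂
        · have := h p₀ p q k₂ hlt
          omega
        · have : ∃ r, d r < d p₀ ∧ len r < len p := by
            by_contra hcon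
            push Not at hcon
            exact hp (Or.inr ⟨k₂.1.symm, hcon⟩)
          obtain ⟨r, hr, hr'⟩ := this
          have := h r p q (by omega) hlt
          omega
      · by_cases hq : L q
        · rw [if_pos hq] at k₁
          omega
        · rw [if_neg hq] at k₁
          omega

end Valley

section Backbone

variable {V : Type*} {T : SimpleGraph V}

lemma mem_support_takeUntil_of_dist_lt [DecidableEq V] (hT : T.IsTree) {u v b c : V}
    {w : T.Walk u v} (hw : w.IsPath) (hb : b ∈ w.support) (hc : c ∈ w.support)
    (hlt : T.dist u b < T.dist u c) : b ∈ (w.takeUntil c hc).support := by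
  by_contra hcon
  have h1 : b ∈ (w.dropUntil c hc).support := by
    rw [← w.take_spec hc, Walk.mem_support_append_iff] at hb
    exact hb.resolve_left hcon
  have h2 : ((w.takeUntil c hc).append ((w.dropUntil c hc).takeUntil b h1)).IsPath := by
    refine Walk.IsPath.of_append_left (q := (w.dropUntil c hc).dropUntil b h1) ?_
    rwa [← Walk.append_assoc, Walk.take_spec, Walk.take_spec]
  have h3 := IsPath.length_eq_dist_of_isTree hT h2
  have h4 := IsPath.length_eq_dist_of_isTree hT (hw.takeUntil hc)
  rw [Walk.length_append] at h3
  omega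

lemma mem_support_dropUntil_of_dist_lt [DecidableEq V] {u v b c : V}
    {w : T.Walk u v} (hT : T.IsTree) (hw : w.IsPath) (hb : b ∈ w.support) (hc : c ∈ w.support)
    (hlt : T.dist u b < T.dist u c) : c ∈ (w.dropUntil b hb).support := by
  by_contra hcon
  have h1 : c ∈ (w.takeUntil b hb).support := by
    rw [← w.take_spec hb, Walk.mem_support_append_iff] at hc
    exact hc.resolve_right hcon
  have h3 := (w.takeUntil b hb).length_takeUntil_le_length h1
  have h4 := IsPath.length_eq_dist_of_isTree hT (hw.takeUntil hb)
  have h5 := dist_le ((w.takeUntil b hb).takeUntil c h1)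
  omega

lemma SwitchOptimal.dist_le_or_dist_le [Fintype V] (hT : T.IsTree) (hopt : SwitchOptimal T)
    {u v : V} {w : T.Walk u v} (hw : w.IsPath) (hall : ∀ z, IsBranchV T z → z ∈ w.support)
    {a₁ a₂ a₃ b₁ b₂ b₃ : V} (hs₁ : IsSegment T a₁ b₁) (hs₂ : IsSegment T a₂ b₂)
    (hs₃ : IsSegment T a₃ b₃) (ha₁ : IsLeafV T a₁) (ha₂ : IsLeafV T a₂) (ha₃ : IsLeafV T a₃)
    (hb₁ : IsBranchV T b₁) (hb₂ : IsBranchV T b₂) (hb₃ : IsBranchV T b₃)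
    (h₁₂ : T.dist u b₁ < T.dist u b₂) (h₂₃ : T.dist u b₂ < T.dist u b₃) :
    T.dist a₂ b₂ ≤ T.dist a₁ b₁ ∨ T.dist a₂ b₂ ≤ T.dist a₃ b₃ := by
  classical
  obtain ⟨s₁, hs₁⟩ := isSegment_iff.1 hs₁
  obtain ⟨s₂, hs₂⟩ := isSegment_iff.1 hs₂
  obtain ⟨s₃, hs₃⟩ := isSegment_iff.1 hs₃
  rw [← hs₁.ncard_branchAt hT ha₁, ← hs₂.ncard_branchAt hT ha₂, ← hs₃.ncard_branchAt hT ha₃]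
  have hnb : ∀ {a b : V} {s : T.Walk a b}, IsSegWalk s → IsLeafV T a → ∀ z, IsBranchV T z →
      z ∉ branchAt T b s.penultimate := by
    intro a b s hs ha z hz hzr
    rw [hs.branchAt_eq hT ha] at hzr
    exact hs.not_isBranchV ha hzr.1 hzr.2 hz
  have hb₁s := mem_support_takeUntil_of_dist_lt hT hw (hall b₁ hb₁) (hall b₂ hb₂) h₁₂
  have hb₃s := mem_support_dropUntil_of_dist_lt hT hw (hall b₂ hb₂) (hall b₃ hb₃) h₂₃
  obtain ⟨n₁, hn₁, hm₁⟩ := exists_mem_branchAt hT (z := b₁) (a := b₂)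
    (by rintro rfl; exact h₁₂.false)
  obtain ⟨n₃, hn₃, hm₃⟩ := exists_mem_branchAt hT (z := b₃) (a := b₂)
    (by rintro rfl; exact h₂₃.false)
  have hne := ne_of_mem_branchAt_of_isPath hT (by rwa [Walk.take_spec]) hb₁s hb₃s hn₁ hm₁ hm₃
  exact hopt.ncard_le_or_ncard_le hT hn₁ (s₂.adj_penultimate hs₂.not_nil).symm hn₃
    (by rintro rfl; exact hnb hs₂ ha₂ b₁ hb₁ hm₁) hne
    (by rintro rfl; exact hnb hs₂ ha₂ b₃ hb₃ hm₃) hb₁ hb₃ hm₁ hm₃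
    (s₁.adj_penultimate hs₁.not_nil).symm (s₃.adj_penultimate hs₃.not_nil).symm
    (hnb hs₁ ha₁ b₂ hb₂) (hnb hs₃ ha₃ b₂ hb₂)

lemma eq_of_isSegment_of_isLeafV [Finite V] {a b b' : V} (ha : IsLeafV T a)
    (h : IsSegment T a b) (h' : IsSegment T a b') : b = b' := by
  obtain ⟨w, hw⟩ := isSegment_iff.1 h
  obtain ⟨w', hw'⟩ := isSegment_iff.1 h'
  have h1 := w.mk_start_snd_mem_edges hw.not_nil
  have h2 : s(a, w.snd) ∈ w'.edges := by
    rw [eq_of_isLeafV ha (w.adj_snd hw.not_nil) (w'.adj_snd hw'.not_nil)]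
    exact w'.mk_start_snd_mem_edges hw'.not_nil
  have h3 := hw.supp_eq (e := ⟨_, w.edges_subset_edgeSet h1⟩) h1
  rw [hw'.supp_eq (e := ⟨_, w.edges_subset_edgeSet h1⟩) h2] at h3
  have h4 := hw.eq_of_edges_subset hw' fun e he => by
    have : (⟨e, w.edges_subset_edgeSet he⟩ : T.edgeSet) ∈ {f : T.edgeSet | f.1 ∈ w'.edges} := by
      rw [h3]
      exact he
    exact this
  rcases Sym2.eq_iff.1 h4 with ⟨-, h5⟩ | ⟨h5, h6⟩
  · exact h5
  · exact h6.trans h5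

lemma exists_pendant [Fintype V] (hT : T.IsTree) (hb : ∃ x, IsBranchV T x) :
    ∃ a b, IsSegment T a b ∧ IsLeafV T a ∧ IsBranchV T b := by
  classical
  obtain ⟨x, hx⟩ := hb
  have hne : (T.neighborSet x).Nonempty := by
    refine Set.nonempty_of_ncard_ne_zero fun h => ?_
    rw [IsBranchV, degN, h] at hx
    omega
  obtain ⟨y, hy⟩ := hne
  have : Nontrivial V := ⟨x, y, hy.ne⟩
  obtain ⟨a, ha⟩ := hT.exists_vert_degree_one_of_nontrivial
  have hal : IsLeafV T a := by
    rw [IsLeafV, degN, Set.ncard_eq_toFinset_card']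
    exact ha
  obtain ⟨c, hc⟩ := Set.nonempty_of_ncard_ne_zero (s := T.neighborSet a)
    (by rw [show (T.neighborSet a).ncard = 1 from hal]; norm_num)
  obtain ⟨u, v, w, hw, he⟩ := exists_isSegWalk hT (e := s(a, c)) hc
  have has := w.fst_mem_support_of_mem_edges he
  by_cases hau : a = u
  · subst hau
    exact ⟨a, v, hw.isSegment, hal, hw.isBranchV_right hT ⟨x, hx⟩ hal⟩
  by_cases hav : a = v
  · subst hav
    exact ⟨a, u, hw.reverse.isSegment, hal, hw.reverse.isBranchV_right hT ⟨x, hx⟩ hal⟩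
  exact absurd (hw.internal a has hau hav) (degN_ne_two_of_leaf_or_branch (Or.inl hal))

end Backbone

/-- For every `k ≥ 2` and every segment sequence `ℓ` (with `m ≥ 3` segments)
realized by some tree, there is a tree `T` with segment sequence `ℓ` maximizing the Steiner
`k`-Wiener index which is a quasi-caterpillar such that, for any backbone with end `u`, the
pendant segments (with leaf ends `a i` and branch-vertex ends `b i`) can be enumerated with
non-decreasing distance of their branch-vertex endpoints from `u`, in such a way that their
lengths first decrease and then increase (a "valley" shape). -/
theorem exists_maximizer_quasiCaterpillar_valley_pendant (k m : ℕ)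
    (hk : 2 ≤ k) (hm : 3 ≤ m) (ℓ : Multiset ℕ) (hcard : Multiset.card ℓ = m)
    (hex : ∃ (V : Type) (_ : Fintype V) (T0 : SimpleGraph V),
      T0.IsTree ∧ segmentMultiset T0 = ℓ) :
    ∃ T : SimpleGraph (Fin (ℓ.sum + 1)), T.IsTree ∧ segmentMultiset T = ℓ ∧
      (∀ (W : Type) [Fintype W] (H : SimpleGraph W), H.IsTree → segmentMultiset H = ℓ →
        steinerWiener H k ≤ steinerWiener T k) ∧
      IsQuasiCaterpillar T ∧
      ∀ (u v : Fin (ℓ.sum + 1)) (w : T.Walk u v), IsBackbone T w →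
        ∃ (c' : ℕ) (a b : Fin c' → Fin (ℓ.sum + 1)),
          (∀ i, IsSegment T (a i) (b i) ∧ IsLeafV T (a i) ∧ IsBranchV T (b i)) ∧
          Function.Injective a ∧
          (∀ a₀ b₀, IsSegment T a₀ b₀ → IsLeafV T a₀ → IsBranchV T b₀ →
            ∃ i, a i = a₀ ∧ b i = b₀) ∧
          (∀ i j : Fin c', i ≤ j → T.dist u (b i) ≤ T.dist u (b j)) ∧
          ∃ j' : Fin c',
            (∀ i₁ i₂ : Fin c', i₁ ≤ i₂ → i₂ ≤ j' →
              T.dist (a i₂) (b i₂) ≤ T.dist (a i₁) (b i₁)) ∧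
            (∀ i₁ i₂ : Fin c', j' ≤ i₁ → i₁ ≤ i₂ →
              T.dist (a i₁) (b i₁) ≤ T.dist (a i₂) (b i₂)) := by
  classical
  obtain ⟨T, hT, hTℓ, hmax, hopt⟩ := exists_optimal (k := k) (by omega) hex
  have hb : ∃ x, IsBranchV T x := exists_isBranchV hT (by rw [hTℓ]; omega)
  refine ⟨T, hT, hTℓ, hmax, hopt.isQuasiCaterpillar hT hb, fun u v w hw => ?_⟩
  let P := {p : Fin (ℓ.sum + 1) × Fin (ℓ.sum + 1) //
    IsSegment T p.1 p.2 ∧ IsLeafV T p.1 ∧ IsBranchV T p.2}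
  obtain ⟨a₀, b₀, h₀⟩ := exists_pendant hT hb
  have : Nonempty P := ⟨⟨(a₀, b₀), h₀⟩⟩
  obtain ⟨f, hmono, j', h₁, h₂⟩ := exists_valley_enumeration (P := P)
    (fun p => T.dist u p.1.2) (fun p => T.dist p.1.1 p.1.2) fun p q r hpq hqr =>
      hopt.dist_le_or_dist_le hT hw.1 hw.2.1 p.2.1 q.2.1 r.2.1 p.2.2.1 q.2.2.1 r.2.2.1
        p.2.2.2 q.2.2.2 r.2.2.2 hpq hqr
  refine ⟨_, fun i => (f i).1.1, fun i => (f i).1.2, fun i => (f i).2, fun i j hij => ?_,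
    fun a b hab ha hb => ⟨f.symm ⟨(a, b), hab, ha, hb⟩, by simp, by simp⟩, hmono, j', h₁, h₂⟩
  refine f.injective (Subtype.ext (Prod.ext hij ?_))
  have h := (f i).2.1
  dsimp only at hij
  rw [hij] at h
  exact eq_of_isSegment_of_isLeafV (f j).2.2.1 h (f j).2.1
end

section
/- Let k ≥ 2, m ≥ 3 and n ≥ m + 1 be integers, and let T* be the balanced starlike tree of order n with m segments, i.e., the starlike tree whose m segment lengths sum to n − 1 and pairwise differ by at most 1. Then for every tree T of order n with exactly m segments, SW_k(T*) ≤ SW_k(T); that is, among trees of given order and given number of segments, the balanced starlike tree minimizes the Steiner k-Wiener index. -/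
open SimpleGraph Finset

/-- `p` sends every vertex of `G` other than the root `r` to its unique neighbour closer to `r`,
and every edge of `G` joins a vertex to its parent. -/
structure IsParentMap {V : Type*} (G : SimpleGraph V) (r : V) (p : V → V) : Prop where
  root : p r = r
  adj : ∀ {w}, w ≠ r → G.Adj w (p w)
  dist : ∀ {w}, w ≠ r → G.dist r (p w) + 1 = G.dist r w
  edge : ∀ {a b}, G.Adj a b → (a ≠ r ∧ p a = b) ∨ (b ≠ r ∧ p b = a)

open Classical in
/-- The vertices whose iterated parents include `w`. -/
noncomputable def subtree {V : Type*} [Fintype V] (p : V → V) (w : V) : Finset V :=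
  {x | ∃ i, p^[i] x = w}

theorem exists_isParentMap {V : Type*} [Fintype V] {G : SimpleGraph V} (hG : G.IsTree) (r : V) :
    ∃ p, IsParentMap G r p := by
  classical
  have hcl : ∀ w, w ≠ r → ∃ y, G.Adj w y ∧ G.dist r y + 1 = G.dist r w := by
    intro w hw
    obtain ⟨q, hq⟩ := hG.connected.exists_walk_length_eq_dist w r
    cases q with
    | nil => exact absurd rfl hw
    | @cons _ y _ h q =>
      refine ⟨y, h, ?_⟩
      have h1 := SimpleGraph.dist_le q
      have h2 := hG.connected.dist_triangle (u := w) (v := y) (w := r)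
      rw [SimpleGraph.dist_eq_one_iff_adj.2 h] at h2
      rw [Walk.length_cons] at hq
      rw [SimpleGraph.dist_comm (u := r), SimpleGraph.dist_comm (u := r)]
      omega
  choose! f hf hfd using hcl
  let p : V → V := fun w => if w = r then r else f w
  have hp : ∀ w, w ≠ r → p w = f w := fun w hw => by simp [p, hw]
  refine ⟨p, by simp [p], fun {w} hw => hp w hw ▸ hf w hw, fun {w} hw => hp w hw ▸ hfd w hw, ?_⟩
  have hinj : Set.InjOn (fun w => s(w, f w)) (univ.erase r : Finset V) := by
    intro a ha b hb hab
    simp only [coe_erase, coe_univ, Set.mem_sdiff, Set.mem_univ, Set.mem_singleton_iff,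
      true_and] at ha hb
    have h1 := hfd a ha
    have h2 := hfd b hb
    rcases Sym2.eq_iff.1 hab with h | ⟨h, h'⟩
    · exact h.1
    · rw [h'] at h1
      rw [← h] at h2
      omega
  have himg : (univ.erase r).image (fun w => s(w, f w)) = G.edgeFinset := by
    apply Finset.eq_of_subset_of_card_le
    · intro e he
      obtain ⟨w, hw, rfl⟩ := Finset.mem_image.1 he
      simpa using hf w (by simpa using hw)
    · rw [Finset.card_image_of_injOn hinj, Finset.card_erase_of_mem (mem_univ r), Finset.card_univ]
      have := hG.card_edgeFinset
      omega
  intro a b hab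
  have : s(a, b) ∈ G.edgeFinset := by simpa using hab
  rw [← himg] at this
  obtain ⟨w, hw, h⟩ := Finset.mem_image.1 this
  have hw : w ≠ r := by simpa using hw
  rcases Sym2.eq_iff.1 h with ⟨h, h'⟩ | ⟨h, h'⟩
  · subst h; exact Or.inl ⟨hw, by rw [hp _ hw, h']⟩
  · subst h; exact Or.inr ⟨hw, by rw [hp _ hw, h']⟩

theorem mem_subtree {V : Type*} [Fintype V] {p : V → V} {w x : V} :
    x ∈ subtree p w ↔ ∃ i, p^[i] x = w := by
  simp [subtree]

theorem self_mem_subtree {V : Type*} [Fintype V] (p : V → V) (w : V) : w ∈ subtree p w :=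
  mem_subtree.2 ⟨0, rfl⟩

theorem mem_subtree_parent {V : Type*} [Fintype V] {p : V → V} {w x : V}
    (h : x ∈ subtree p w) : x ∈ subtree p (p w) := by
  obtain ⟨i, hi⟩ := mem_subtree.1 h
  exact mem_subtree.2 ⟨i + 1, by rw [Function.iterate_succ_apply', hi]⟩

theorem subtree_subset {V : Type*} [Fintype V] {p : V → V} {w z : V}
    (h : w ∈ subtree p z) : subtree p w ⊆ subtree p z := by
  obtain ⟨i, hi⟩ := mem_subtree.1 h
  intro x hx
  obtain ⟨j, hj⟩ := mem_subtree.1 hx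
  exact mem_subtree.2 ⟨i + j, by rw [Function.iterate_add_apply, hj, hi]⟩

theorem subtree_comparable {V : Type*} [Fintype V] {p : V → V} {x w z : V}
    (hw : x ∈ subtree p w) (hz : x ∈ subtree p z) : w ∈ subtree p z ∨ z ∈ subtree p w := by
  obtain ⟨i, hi⟩ := mem_subtree.1 hw
  obtain ⟨j, hj⟩ := mem_subtree.1 hz
  rcases le_total i j with h | h
  · left
    refine mem_subtree.2 ⟨j - i, ?_⟩
    rw [← hi, ← Function.iterate_add_apply, Nat.sub_add_cancel h, hj]
  · right
    refine mem_subtree.2 ⟨i - j, ?_⟩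
    rw [← hj, ← Function.iterate_add_apply, Nat.sub_add_cancel h, hi]

namespace IsParentMap

variable {V : Type*} {G : SimpleGraph V} {r : V} {p : V → V}

theorem iterate_root (hp : IsParentMap G r p) (i : ℕ) : p^[i] r = r :=
  Function.iterate_fixed hp.root i

theorem dist_iterate (hp : IsParentMap G r p) {x : V} {i : ℕ} (h : p^[i] x ≠ r) :
    G.dist r (p^[i] x) + i = G.dist r x := by
  induction i generalizing x with
  | zero => simp
  | succ i ih =>
    rw [Function.iterate_succ_apply] at h ⊢
    have hx : x ≠ r := by
      rintro rfl
      exact h (by rw [hp.root, hp.iterate_root])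
    have := ih h
    have := hp.dist hx
    omega

theorem eq_root_of_dist (hp : IsParentMap G r p) {x : V} (h : G.dist r x = 0) : x = r := by
  by_contra hx
  have := hp.dist hx
  omega

theorem iterate_dist (hp : IsParentMap G r p) (x : V) : p^[G.dist r x] x = r := by
  by_contra h
  have := hp.dist_iterate h
  exact h (hp.eq_root_of_dist (by omega))

theorem iterate_ne_root (hp : IsParentMap G r p) {x : V} {i : ℕ} (h : i < G.dist r x) :
    p^[i] x ≠ r := by
  induction i generalizing x with
  | zero =>
    rintro rfl
    simp at h
  | succ i ih =>
    rw [Function.iterate_succ_apply]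
    apply ih
    have := hp.dist (w := x) (by rintro rfl; simp at h)
    omega

theorem injOn_parentEdge (hp : IsParentMap G r p) :
    Set.InjOn (fun w => s(w, p w)) {w | w ≠ r} := by
  intro a ha b hb hab
  have h1 := hp.dist ha
  have h2 := hp.dist hb
  rcases Sym2.eq_iff.1 hab with h | ⟨h, h'⟩
  · exact h.1
  · rw [h'] at h1
    rw [← h] at h2
    omega

variable [Fintype V]

theorem mem_subtree_root (hp : IsParentMap G r p) (x : V) : x ∈ subtree p r :=
  mem_subtree.2 ⟨_, hp.iterate_dist x⟩

theorem dist_lt_of_mem (hp : IsParentMap G r p) {x w : V} (h : x ∈ subtree p w) (hne : x ≠ w) :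
    G.dist r w < G.dist r x := by
  by_cases hw : w = r
  · subst hw
    have : G.dist w x ≠ 0 := fun h0 => hne (hp.eq_root_of_dist h0)
    simp
    omega
  · obtain ⟨i, rfl⟩ := mem_subtree.1 h
    have := hp.dist_iterate hw
    have : i ≠ 0 := by
      rintro rfl
      exact hne rfl
    omega

theorem subtree_antisymm (hp : IsParentMap G r p) {x w : V} (h : x ∈ subtree p w)
    (h' : w ∈ subtree p x) : x = w := by
  by_contra hne
  have := hp.dist_lt_of_mem h hne
  have := hp.dist_lt_of_mem h' (Ne.symm hne)
  omega

theorem parent_notMem_subtree (hp : IsParentMap G r p) {w : V} (hw : w ≠ r) :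
    p w ∉ subtree p w := by
  intro h
  have h1 := hp.dist hw
  have := hp.dist_lt_of_mem h (hp.adj hw).ne.symm
  omega

/-- The only edge leaving the subtree of `w` joins `w` to its parent. -/
theorem eq_of_adj_of_mem_of_notMem (hp : IsParentMap G r p) {w a b : V} (hab : G.Adj a b)
    (ha : a ∈ subtree p w) (hb : b ∉ subtree p w) : a = w ∧ b = p w := by
  rcases hp.edge hab with ⟨-, rfl⟩ | ⟨-, rfl⟩
  · obtain ⟨i, hi⟩ := mem_subtree.1 ha
    cases i with
    | zero => exact ⟨hi, congrArg p hi⟩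
    | succ i => exact absurd (mem_subtree.2 ⟨i, by rw [← hi, Function.iterate_succ_apply]⟩) hb
  · obtain ⟨i, hi⟩ := mem_subtree.1 ha
    exact absurd (mem_subtree.2 ⟨i + 1, by rw [Function.iterate_succ_apply, hi]⟩) hb

end IsParentMap

open Classical in
/-- The vertices `w` such that the edge from `w` to its parent separates two vertices of `S`. -/
noncomputable def separators {V : Type*} [Fintype V] (r : V) (p : V → V) (S : Finset V) :
    Finset V :=
  {w | w ≠ r ∧ (∃ x ∈ S, x ∈ subtree p w) ∧ ∃ x ∈ S, x ∉ subtree p w}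

namespace IsParentMap

variable {V : Type*} [Fintype V] {G : SimpleGraph V} {r : V} {p : V → V}

theorem card_separators_le (hp : IsParentMap G r p) {S : Finset V} {H : G.Subgraph}
    (hH : H.Connected) (hS : ↑S ⊆ H.verts) : #(separators r p S) ≤ H.edgeSet.ncard := by
  rw [← Set.ncard_coe_finset]
  refine Set.ncard_le_ncard_of_injOn (fun w => s(w, p w)) ?_ ?_ (Set.toFinite _)
  · intro w hw
    simp only [separators, coe_filter, mem_univ, true_and, Set.mem_ofPred_eq] at hw
    obtain ⟨-, ⟨x, hx, hxw⟩, y, hy, hyw⟩ := hw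
    obtain ⟨q⟩ := hH.coe.preconnected ⟨x, hS hx⟩ ⟨y, hS hy⟩
    obtain ⟨d, -, hd, hd'⟩ := q.exists_boundary_dart {z | (z : V) ∈ subtree p w} hxw hyw
    have hadj : H.Adj d.fst d.snd := d.adj
    obtain ⟨h1, h2⟩ := hp.eq_of_adj_of_mem_of_notMem hadj.adj_sub hd hd'
    rw [h1, h2] at hadj
    exact hadj
  · refine hp.injOn_parentEdge.mono fun w hw => ?_
    simp only [separators, coe_filter, mem_univ, true_and, Set.mem_ofPred_eq] at hw
    exact hw.1

theorem exists_connected_subgraph (hp : IsParentMap G r p) {S : Finset V} (hS : S.Nonempty) :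
    ∃ H : G.Subgraph, H.Connected ∧ ↑S ⊆ H.verts ∧ H.edgeSet.ncard ≤ #(separators r p S) := by
  classical
  obtain ⟨z, hz, hmax⟩ := ({z | S ⊆ subtree p z} : Finset V).exists_max_image (G.dist r)
    ⟨r, mem_filter.2 ⟨mem_univ _, fun x _ => hp.mem_subtree_root x⟩⟩
  simp only [mem_filter, mem_univ, true_and] at hz hmax
  obtain ⟨s, hs⟩ := hS
  have hsep : ∀ w ∈ subtree p z, w ≠ z → (∃ x ∈ S, x ∈ subtree p w) → w ∈ separators r p S := by
    intro w hw hwz hx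
    have hlt := hp.dist_lt_of_mem hw hwz
    simp only [separators, mem_filter, mem_univ, true_and]
    refine ⟨?_, hx, ?_⟩
    · rintro rfl
      simp at hlt
    · by_contra! hall
      have := hmax w hall
      omega
  let X : Set V := {w | w ∈ subtree p z ∧ ∃ x ∈ S, x ∈ subtree p w}
  have hzX : z ∈ X := ⟨self_mem_subtree p z, s, hs, hz hs⟩
  have hpar : ∀ w ∈ X, w ≠ z → p w ∈ X := by
    rintro w ⟨hw, x, hx, hxw⟩ hwz
    refine ⟨?_, x, hx, mem_subtree_parent hxw⟩
    obtain ⟨i, hi⟩ := mem_subtree.1 hw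
    cases i with
    | zero => exact absurd hi hwz
    | succ i => exact mem_subtree.2 ⟨i, by rw [← hi, Function.iterate_succ_apply]⟩
  have hroot : ∀ w ∈ X, w ≠ z → w ≠ r := by
    rintro w ⟨hw, -⟩ hwz rfl
    have := hp.dist_lt_of_mem hw hwz
    simp at this
  refine ⟨(⊤ : G.Subgraph).induce X, ?_, fun x hx => ⟨hz hx, x, hx, self_mem_subtree p x⟩, ?_⟩
  · rw [← connected_induce_iff]
    rw [connected_iff_exists_forall_reachable]
    refine ⟨⟨z, hzX⟩, ?_⟩
    have key : ∀ n, ∀ w, (hw : w ∈ X) → G.dist r w = n →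
        (G.induce X).Reachable ⟨z, hzX⟩ ⟨w, hw⟩ := by
      intro n
      induction n with
      | zero =>
        intro w hw h0
        have : w = z := by
          by_contra hwz
          exact hroot w hw hwz (hp.eq_root_of_dist h0)
        subst this
        rfl
      | succ n ih =>
        intro w hw hn
        by_cases hwz : w = z
        · subst hwz
          rfl
        · have hwr := hroot w hw hwz
          have h1 := hp.dist hwr
          refine (ih (p w) (hpar w hw hwz) (by omega)).trans (Adj.reachable ?_)
          exact (hp.adj hwr).symm
    rintro ⟨w, hw⟩
    exact key _ w hw rfl
  · rw [← Set.ncard_coe_finset]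
    refine le_trans (Set.ncard_le_ncard (t := (fun w => s(w, p w)) '' (separators r p S)) ?_
      (Set.toFinite _)) (Set.ncard_image_le (Set.toFinite _))
    have aux : ∀ w, w ∈ X → p w ∈ X → w ≠ r → w ∈ separators r p S := by
      intro w hw hpw hwr
      refine hsep w hw.1 ?_ hw.2
      rintro rfl
      exact hp.parent_notMem_subtree hwr hpw.1
    intro e
    induction e using Sym2.ind with
    | _ a b =>
      intro he
      obtain ⟨ha, hb, hab⟩ : a ∈ X ∧ b ∈ X ∧ G.Adj a b := by
        simpa using he
      rcases hp.edge hab with ⟨hr, rfl⟩ | ⟨hr, rfl⟩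
      · exact ⟨a, aux a ha hb hr, rfl⟩
      · exact ⟨b, aux b hb ha hr, Sym2.eq_swap⟩

theorem steinerDist_eq (hp : IsParentMap G r p) {S : Finset V} (hS : S.Nonempty) :
    steinerDist G S = #(separators r p S) := by
  obtain ⟨H, hH, hSH, hle⟩ := hp.exists_connected_subgraph hS
  unfold steinerDist
  apply le_antisymm
  · refine le_trans (Nat.sInf_le ?_) hle
    exact ⟨H, hH, hSH, rfl⟩
  · refine le_csInf ⟨H.edgeSet.ncard, H, hH, hSH, rfl⟩ ?_
    rintro n ⟨K, hK, hSK, rfl⟩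
    exact hp.card_separators_le hK hSK

end IsParentMap

/-- The number of `k`-subsets of an `n`-set that meet both an `a`-subset and its complement. -/
def splitCount (n k a : ℕ) : ℤ :=
  n.choose k - a.choose k - (n - a).choose k

theorem card_powersetCard_split {V : Type*} [Fintype V] [DecidableEq V] {k : ℕ} (hk : 1 ≤ k)
    (D : Finset V) :
    (#{S ∈ powersetCard k (univ : Finset V) | (∃ x ∈ S, x ∈ D) ∧ ∃ x ∈ S, x ∉ D} : ℤ) =
      splitCount (Fintype.card V) k #D := by
  have hdisj : Disjoint (powersetCard k D) (powersetCard k Dᶜ) := by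
    rw [Finset.disjoint_left]
    intro S hS hS'
    rw [mem_powersetCard] at hS hS'
    obtain ⟨x, hx⟩ : S.Nonempty := card_pos.1 (by omega)
    exact (mem_compl.1 (hS'.1 hx)) (hS.1 hx)
  have hsub : powersetCard k D ∪ powersetCard k Dᶜ ⊆ powersetCard k (univ : Finset V) :=
    union_subset (powersetCard_mono (subset_univ _)) (powersetCard_mono (subset_univ _))
  have heq : {S ∈ powersetCard k (univ : Finset V) | (∃ x ∈ S, x ∈ D) ∧ ∃ x ∈ S, x ∉ D} =
      powersetCard k (univ : Finset V) \ (powersetCard k D ∪ powersetCard k Dᶜ) := by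
    ext S
    simp only [mem_filter, mem_powersetCard, mem_sdiff, mem_union, not_or, not_and,
      Finset.subset_iff, mem_compl, mem_univ]
    constructor
    · rintro ⟨⟨-, h⟩, ⟨x, hx, hxD⟩, y, hy, hyD⟩
      exact ⟨⟨by simp, h⟩, fun h' => absurd (h' hy) hyD, fun h' => absurd hxD (h' hx)⟩
    · rintro ⟨⟨-, h⟩, h1, h2⟩
      refine ⟨⟨by simp, h⟩, ?_, ?_⟩
      · by_contra! hc
        exact h2 (fun x hx => hc x hx) h
      · by_contra! hc
        exact h1 (fun x hx => hc x hx) h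
  rw [heq, card_sdiff_of_subset hsub, Nat.cast_sub (card_le_card hsub), card_union_of_disjoint hdisj]
  simp [splitCount, card_compl]
  ring

theorem IsParentMap.steinerWiener_eq {V : Type*} [Fintype V] [DecidableEq V] {G : SimpleGraph V}
    {r : V} {p : V → V} (hp : IsParentMap G r p) {k : ℕ} (hk : 1 ≤ k) :
    (steinerWiener G k : ℤ) =
      ∑ w ∈ univ.erase r, splitCount (Fintype.card V) k #(subtree p w) := by
  classical
  have h1 : ∀ S ∈ powersetCard k (univ : Finset V), (steinerDist G S : ℤ) =
      ∑ w ∈ univ.erase r, if (∃ x ∈ S, x ∈ subtree p w) ∧ ∃ x ∈ S, x ∉ subtree p w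
        then 1 else 0 := by
    intro S hS
    rw [mem_powersetCard] at hS
    rw [hp.steinerDist_eq (card_pos.1 (by omega)), Finset.sum_boole, separators]
    congr 2
    ext w
    simp
  rw [steinerWiener, Nat.cast_sum, Finset.sum_congr rfl h1, Finset.sum_comm]
  refine Finset.sum_congr rfl fun w _ => ?_
  rw [Finset.sum_boole, card_powersetCard_split hk]

theorem splitCount_le_succ {n k a : ℕ} (hk : 1 ≤ k) (h : 2 * (a + 1) ≤ n) :
    splitCount n k a ≤ splitCount n k (a + 1) := by
  obtain ⟨k, rfl⟩ := Nat.exists_eq_add_of_le' hk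
  obtain ⟨b, rfl⟩ : ∃ b, n = a + 1 + b := ⟨n - (a + 1), by omega⟩
  have e1 : a + 1 + b - a = b + 1 := by omega
  have e2 : a + 1 + b - (a + 1) = b := by omega
  have hab : a.choose k ≤ b.choose k := Nat.choose_le_choose k (by omega)
  simp only [splitCount, e1, e2, Nat.choose_succ_succ' a k, Nat.choose_succ_succ' b k]
  push_cast
  have : (a.choose k : ℤ) ≤ b.choose k := by exact_mod_cast hab
  linarith

theorem splitCount_mono {n k a b : ℕ} (hk : 1 ≤ k) (hab : a ≤ b) (h : 2 * b ≤ n) :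
    splitCount n k a ≤ splitCount n k b := by
  induction b, hab using Nat.le_induction with
  | base => exact le_rfl
  | succ b _ ih => exact (ih (by omega)).trans (splitCount_le_succ hk h)

/-- Comparison of two sums of a function that is monotone up to `n / 2`. -/
theorem sum_le_sum_of_fiber_card_le {α β : Type*} {A : Finset α} {B : Finset β} {n Q : ℕ}
    {s : α → ℕ} {t : β → ℕ} {f : ℕ → ℤ} (hcard : #A = #B)
    (hf : ∀ a b, a ≤ b → 2 * b ≤ n → f a ≤ f b) (hQ : 2 * Q ≤ n)
    (hs : ∀ a ∈ A, s a ≤ Q) (ht : ∀ b ∈ B, 2 * t b ≤ n)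
    (hle : ∀ j < Q, #{b ∈ B | t b = j} ≤ #{a ∈ A | s a = j}) :
    ∑ a ∈ A, f (s a) ≤ ∑ b ∈ B, f (t b) := by
  have hA : ∑ a ∈ A, (f Q - f (s a)) = ∑ j ∈ range (Q + 1), #{a ∈ A | s a = j} * (f Q - f j) := by
    rw [← Finset.sum_fiberwise_of_maps_to (t := range (Q + 1)) (g := s)
      (fun a ha => by simpa [Nat.lt_succ_iff] using hs a ha)]
    refine Finset.sum_congr rfl fun j _ => ?_
    rw [Finset.sum_congr rfl (g := fun _ => f Q - f j)
      (fun a ha => by rw [(mem_filter.1 ha).2])]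
    rw [Finset.sum_const, nsmul_eq_mul]
  have hB : ∑ b ∈ B, (f Q - f (t b)) ≤
      ∑ j ∈ range (Q + 1), #{b ∈ B | t b = j} * (f Q - f j) := by
    have h1 : ∑ b ∈ B, (f Q - f (t b)) ≤ ∑ b ∈ B with t b ∈ range (Q + 1), (f Q - f (t b)) := by
      rw [Finset.sum_filter]
      refine Finset.sum_le_sum fun b hb => ?_
      split_ifs with h
      · exact le_rfl
      · have := hf Q (t b) (by simp at h; omega) (ht b hb)
        linarith
    refine h1.trans (le_of_eq ?_)
    rw [← Finset.sum_fiberwise_of_maps_to (t := range (Q + 1)) (g := t)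
      (fun b hb => (mem_filter.1 hb).2)]
    refine Finset.sum_congr rfl fun j hj => ?_
    rw [Finset.sum_congr rfl (g := fun _ => f Q - f j)
      (fun b hb => by rw [(mem_filter.1 hb).2])]
    have : {b ∈ {b ∈ B | t b ∈ range (Q + 1)} | t b = j} = {b ∈ B | t b = j} := by
      ext b
      simp only [mem_filter]
      constructor
      · rintro ⟨⟨h, -⟩, h'⟩
        exact ⟨h, h'⟩
      · rintro ⟨h, rfl⟩
        exact ⟨⟨h, hj⟩, rfl⟩
    rw [this, Finset.sum_const, nsmul_eq_mul]
  have hAB : ∑ j ∈ range (Q + 1), (#{b ∈ B | t b = j} : ℤ) * (f Q - f j) ≤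
      ∑ j ∈ range (Q + 1), (#{a ∈ A | s a = j} : ℤ) * (f Q - f j) := by
    refine Finset.sum_le_sum fun j hj => ?_
    rcases (Nat.lt_succ_iff.1 (mem_range.1 hj)).eq_or_lt with rfl | h
    · simp
    · refine mul_le_mul_of_nonneg_right (by exact_mod_cast hle j h) ?_
      have := hf j Q h.le hQ
      linarith
  have := hB.trans (hAB.trans hA.ge)
  simp only [Finset.sum_sub_distrib, Finset.sum_const, hcard] at this
  linarith

open Classical in
/-- The leaves of a finite graph. -/
noncomputable def leaves {V : Type*} [Fintype V] (G : SimpleGraph V) : Finset V :=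
  {u | IsLeafV G u}

theorem mem_leaves {V : Type*} [Fintype V] {G : SimpleGraph V} {u : V} :
    u ∈ leaves G ↔ IsLeafV G u := by
  simp [leaves]

theorem IsLeafV.eq_of_adj {V : Type*} {G : SimpleGraph V} {u a b : V} (hu : IsLeafV G u)
    (ha : G.Adj u a) (hb : G.Adj u b) : a = b := by
  obtain ⟨c, hc⟩ := Set.ncard_eq_one.1 hu
  have h1 : a ∈ G.neighborSet u := ha
  have h2 : b ∈ G.neighborSet u := hb
  rw [hc] at h1 h2
  exact h1.trans h2.symm

namespace IsParentMap

variable {V : Type*} [Fintype V] {G : SimpleGraph V} {r : V} {p : V → V}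

theorem exists_leaf_mem_subtree (hp : IsParentMap G r p) {w : V} (hw : w ≠ r) :
    ∃ u ∈ subtree p w, IsLeafV G u ∧ u ≠ r := by
  obtain ⟨u, hu, hmax⟩ := (subtree p w).exists_max_image (G.dist r) ⟨w, self_mem_subtree p w⟩
  have hur : u ≠ r := by
    rintro rfl
    exact hw (hp.subtree_antisymm (hp.mem_subtree_root w) hu)
  refine ⟨u, hu, Set.ncard_eq_one.2 ⟨p u, ?_⟩, hur⟩
  ext b
  simp only [mem_neighborSet, Set.mem_singleton_iff]
  constructor
  · intro hb
    rcases hp.edge hb with ⟨-, h⟩ | ⟨hbr, h⟩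
    · exact h.symm
    · have h1 := hp.dist hbr
      have h2 := hmax b (subtree_subset hu (mem_subtree.2 ⟨1, h⟩))
      rw [h] at h1
      omega
  · rintro rfl
    exact hp.adj hur

theorem card_filter_subtree_le [DecidableEq V] (hp : IsParentMap G r p) (j : ℕ) :
    #{w ∈ univ.erase r | #(subtree p w) = j} ≤ #(leaves G) := by
  have hex : ∀ w, w ≠ r → ∃ u ∈ subtree p w, IsLeafV G u :=
    fun w hw => (hp.exists_leaf_mem_subtree hw).imp fun u hu => ⟨hu.1, hu.2.1⟩
  choose! f hf hfl using hex
  have key : ∀ w w', w ∈ subtree p w' → #(subtree p w) = #(subtree p w') → w = w' := by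
    intro w w' h hc
    refine hp.subtree_antisymm h ?_
    rw [eq_of_subset_of_card_le (subtree_subset h) hc.ge]
    exact self_mem_subtree p w'
  refine card_le_card_of_injOn f ?_ ?_
  · intro w hw
    simp only [coe_filter, mem_erase, Set.mem_ofPred_eq] at hw
    exact mem_coe.2 (mem_leaves.2 (hfl w hw.1.1))
  · intro w hw w' hw' h
    simp only [coe_filter, mem_erase, Set.mem_ofPred_eq] at hw hw'
    have h1 := hf w hw.1.1
    have h2 := hf w' hw'.1.1
    rw [← h] at h2
    rcases subtree_comparable h1 h2 with h | h
    · exact key w w' h (hw.2.trans hw'.2.symm)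
    · exact (key w' w h (hw'.2.trans hw.2.symm)).symm

theorem sum_dist_le_of_adj_root (hG : G.Connected) (hp : IsParentMap G r p) {w : V} (hw : w ≠ r)
    (hwr : p w = r) :
    ∑ x, G.dist w x + 2 * #(subtree p w) ≤ ∑ x, G.dist r x + Fintype.card V := by
  classical
  have hadj : G.dist w r = 1 := SimpleGraph.dist_eq_one_iff_adj.2 (hwr ▸ hp.adj hw)
  have h : ∀ x, G.dist w x + (if x ∈ subtree p w then 2 else 0) ≤ G.dist r x + 1 := by
    intro x
    have htri := hG.dist_triangle (u := w) (v := r) (w := x)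
    split_ifs with hx
    · have hle : ∀ i y, G.dist y (p^[i] y) ≤ i := by
        intro i
        induction i with
        | zero => simp
        | succ i ih =>
          intro y
          rw [Function.iterate_succ_apply]
          by_cases hy : y = r
          · subst hy
            simp [hp.root, hp.iterate_root]
          · have h1 := hG.dist_triangle (u := y) (v := p y) (w := p^[i] (p y))
            rw [SimpleGraph.dist_eq_one_iff_adj.2 (hp.adj hy)] at h1
            have := ih (p y)
            omega
      obtain ⟨i, rfl⟩ := mem_subtree.1 hx
      have h1 := hp.dist_iterate hw
      have h2 := hle i x
      rw [SimpleGraph.dist_comm] at h2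
      rw [SimpleGraph.dist_comm] at hadj
      omega
    · omega
  have := Finset.sum_le_sum fun x (_ : x ∈ univ) => h x
  simp only [sum_add_distrib, sum_ite_mem, univ_inter, sum_const, smul_eq_mul, card_univ] at this
  omega

end IsParentMap

/-- Every finite tree has a centroid. -/
theorem exists_isParentMap_centroid {V : Type*} [Fintype V] {G : SimpleGraph V} (hG : G.IsTree) :
    ∃ r p, IsParentMap G r p ∧ ∀ w, w ≠ r → 2 * #(subtree p w) ≤ Fintype.card V := by
  have := hG.connected.nonempty
  obtain ⟨r, -, hr⟩ := (univ : Finset V).exists_min_image (fun r => ∑ x, G.dist r x) univ_nonempty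
  obtain ⟨p, hp⟩ := exists_isParentMap hG r
  refine ⟨r, p, hp, fun w => ?_⟩
  induction h : G.dist r w generalizing w with
  | zero => exact fun hw => absurd (hp.eq_root_of_dist h) hw
  | succ d ih =>
    intro hw
    have hd := hp.dist hw
    by_cases hpw : p w = r
    · have h1 := hp.sum_dist_le_of_adj_root hG.connected hw hpw
      have h2 := hr w (mem_univ w)
      omega
    · refine le_trans ?_ (ih (p w) (by omega) hpw)
      exact Nat.mul_le_mul_left 2 (card_le_card fun x hx => mem_subtree_parent hx)

namespace IsParentMap

variable {V : Type*} [Fintype V] {G : SimpleGraph V} {r : V} {p : V → V}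

theorem parent_injOn_of_degN_le_two (hp : IsParentMap G r p)
    (hdeg : ∀ w, w ≠ r → degN G w ≤ 2) {a b : V} (ha : a ≠ r) (hb : b ≠ r) (hpa : p a ≠ r)
    (hab : p a = p b) : a = b := by
  by_contra hne
  have h1 := hp.dist ha
  have h2 := hp.dist hb
  have h3 := hp.dist hpa
  rw [← hab] at h2
  have : 2 < (G.neighborSet (p a)).ncard := by
    rw [Set.two_lt_ncard_iff]
    refine ⟨a, b, p (p a), (hp.adj ha).symm, ?_, hp.adj hpa, hne, ?_, ?_⟩
    · rw [hab]
      exact (hp.adj hb).symm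
    · rintro h
      rw [← h] at h3
      omega
    · rintro h
      rw [← h] at h3
      omega
  have := hdeg (p a) hpa
  unfold degN at this
  omega

theorem card_subtree_parent (hp : IsParentMap G r p)
    (hdeg : ∀ w, w ≠ r → degN G w ≤ 2) {w : V} (hw : w ≠ r) (hpw : p w ≠ r) :
    #(subtree p (p w)) = #(subtree p w) + 1 := by
  classical
  rw [← card_insert_of_notMem (hp.parent_notMem_subtree hw)]
  congr 1
  ext x
  rw [mem_insert]
  constructor
  · intro h
    obtain ⟨i, hi⟩ := mem_subtree.1 h
    cases i with
    | zero => exact Or.inl hi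
    | succ i =>
      right
      rw [Function.iterate_succ_apply'] at hi
      refine mem_subtree.2 ⟨i, ?_⟩
      refine hp.parent_injOn_of_degN_le_two hdeg ?_ hw (hi ▸ hpw) hi
      intro h
      rw [h, hp.root] at hi
      exact hpw hi.symm
  · rintro (rfl | h)
    · exact self_mem_subtree p _
    · exact mem_subtree_parent h

theorem card_subtree_leaf (hp : IsParentMap G r p) {u : V} (hu : IsLeafV G u) (hur : u ≠ r) :
    #(subtree p u) = 1 := by
  rw [card_eq_one]
  refine ⟨u, ?_⟩
  ext x
  rw [mem_singleton]
  constructor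
  · intro h
    obtain ⟨i, hi⟩ := mem_subtree.1 h
    cases i with
    | zero => exact hi
    | succ i =>
      rw [Function.iterate_succ_apply'] at hi
      have hy : p^[i] x ≠ r := by
        intro h
        rw [h, hp.root] at hi
        exact hur hi.symm
      have hadj := hp.adj hy
      have h1 := hp.dist hy
      rw [hi] at hadj h1
      have h2 := hp.dist hur
      rw [← hu.eq_of_adj hadj.symm (hp.adj hur)] at h2
      omega
  · rintro rfl
    exact self_mem_subtree p _

theorem card_subtree_iterate (hp : IsParentMap G r p)
    (hdeg : ∀ w, w ≠ r → degN G w ≤ 2) {u : V} (hu : IsLeafV G u) {i : ℕ}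
    (hi : i < G.dist r u) : #(subtree p (p^[i] u)) = i + 1 := by
  induction i with
  | zero =>
    refine hp.card_subtree_leaf hu ?_
    rintro rfl
    simp at hi
  | succ i ih =>
    have h1 := hp.iterate_ne_root hi
    rw [Function.iterate_succ_apply'] at h1 ⊢
    rw [hp.card_subtree_parent hdeg (hp.iterate_ne_root (by omega)) h1, ih (by omega)]

theorem exists_leaf_card_subtree_le (hp : IsParentMap G r p)
    (hdeg : ∀ w, w ≠ r → degN G w ≤ 2) {w : V} (hw : w ≠ r) :
    ∃ u, IsLeafV G u ∧ #(subtree p w) ≤ G.dist r u := by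
  obtain ⟨u, hu, hul, -⟩ := hp.exists_leaf_mem_subtree hw
  refine ⟨u, hul, ?_⟩
  obtain ⟨i, rfl⟩ := mem_subtree.1 hu
  have h1 := hp.dist_iterate hw
  have h2 : G.dist r (p^[i] u) ≠ 0 := fun h => hw (hp.eq_root_of_dist h)
  rw [hp.card_subtree_iterate hdeg hul (by omega)]
  omega

theorem card_leaves_le [DecidableEq V] (hp : IsParentMap G r p)
    (hdeg : ∀ w, w ≠ r → degN G w ≤ 2) {j : ℕ} (hj : ∀ u, IsLeafV G u → j < G.dist r u) :
    #(leaves G) ≤ #{w ∈ univ.erase r | #(subtree p w) = j + 1} := by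
  refine card_le_card_of_injOn (fun u => p^[j] u) ?_ ?_
  · intro u hu
    have hu : IsLeafV G u := mem_leaves.1 (mem_coe.1 hu)
    refine mem_coe.2 (mem_filter.2 ⟨mem_erase.2 ⟨hp.iterate_ne_root (hj u hu), mem_univ _⟩, ?_⟩)
    exact hp.card_subtree_iterate hdeg hu (hj u hu)
  · have key : ∀ i, i ≤ j → Set.InjOn (fun u => p^[i] u) (leaves G : Set V) := by
      intro i hi
      induction i with
      | zero => exact fun a _ b _ h => h
      | succ i ih =>
        intro a ha b hb hab
        have ha' := hj a (mem_leaves.1 (mem_coe.1 ha))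
        have hb' := hj b (mem_leaves.1 (mem_coe.1 hb))
        apply ih (by omega) ha hb
        simp only [Function.iterate_succ_apply'] at hab
        refine hp.parent_injOn_of_degN_le_two hdeg (hp.iterate_ne_root (by omega))
          (hp.iterate_ne_root (by omega)) ?_ hab
        rw [← Function.iterate_succ_apply' p i a]
        exact hp.iterate_ne_root (by omega)
    exact key j le_rfl

theorem two_mul_le_card (hp : IsParentMap G r p)
    (hdeg : ∀ w, w ≠ r → degN G w ≤ 2) (hL : 3 ≤ #(leaves G)) {Q : ℕ} {u : V}
    (hu : IsLeafV G u) (hQu : G.dist r u = Q) (hmax : ∀ u, IsLeafV G u → G.dist r u ≤ Q)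
    (hmin : ∀ u, IsLeafV G u → Q ≤ G.dist r u + 1) :
    2 * Q ≤ Fintype.card V := by
  classical
  cases Q with
  | zero => simp
  | succ q =>
    have hmaps : ∀ w ∈ univ.erase r, #(subtree p w) ∈ range (q + 1 + 1) := by
      intro w hw
      obtain ⟨u, hu, h⟩ := hp.exists_leaf_card_subtree_le hdeg (mem_erase.1 hw).1
      have := hmax u hu
      rw [mem_range]
      omega
    have hcard := card_eq_sum_card_fiberwise hmaps
    rw [sum_range_succ', sum_range_succ, card_erase_of_mem (mem_univ r), card_univ] at hcard
    have h1 : q * 3 ≤ ∑ j ∈ range q, #{w ∈ univ.erase r | #(subtree p w) = j + 1} := by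
      have := card_nsmul_le_sum (range q)
        (fun j => #{w ∈ univ.erase r | #(subtree p w) = j + 1}) 3 ?_
      · simpa using this
      · intro j hj
        refine hL.trans (hp.card_leaves_le hdeg fun u hu => ?_)
        have := hmin u hu
        have := mem_range.1 hj
        omega
    have h2 : 0 < #{w ∈ univ.erase r | #(subtree p w) = q + 1} := by
      refine card_pos.2 ⟨p^[q] u, mem_filter.2 ⟨mem_erase.2 ⟨?_, mem_univ _⟩, ?_⟩⟩
      · exact hp.iterate_ne_root (by omega)
      · exact hp.card_subtree_iterate hdeg hu (by omega)
    omega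

end IsParentMap

/-- A path joining two leaves with all internal vertices of degree two covers a connected graph. -/
theorem mem_support_of_leaf_of_leaf {V : Type*} [Finite V] {G : SimpleGraph V} (hG : G.Connected)
    {u v : V} (huv : u ≠ v) (hu : IsLeafV G u) (hv : IsLeafV G v) {w : G.Walk u v} (hw : w.IsPath)
    (hdeg : ∀ x ∈ w.support, x ≠ u → x ≠ v → degN G x = 2) (x : V) : x ∈ w.support := by
  have hnil : ¬ w.Nil := Walk.not_nil_of_ne huv
  have hclosed : ∀ y ∈ w.support, ∀ z, G.Adj y z → z ∈ w.support := by
    intro y hy z hyz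
    by_cases hyu : y = u
    · subst hyu
      rw [hu.eq_of_adj hyz (w.adj_snd hnil)]
      exact w.getVert_mem_support 1
    by_cases hyv : y = v
    · subst hyv
      rw [hv.eq_of_adj hyz (w.adj_penultimate hnil).symm]
      exact w.getVert_mem_support _
    obtain ⟨i, rfl, hi⟩ := Walk.mem_support_iff_exists_getVert.1 hy
    have hi0 : i ≠ 0 := by
      rintro rfl
      exact hyu w.getVert_zero
    have hil : i < w.length := by
      refine lt_of_le_of_ne hi ?_
      rintro rfl
      exact hyv w.getVert_length
    have h2 := hdeg _ hy hyu hyv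
    have h3 := hw.ncard_neighborSet_toSubgraph_internal_eq_two hi0 hil
    have heq := Set.eq_of_subset_of_ncard_le
      (w.toSubgraph.neighborSet_subset (w.getVert i)) (by rw [h3]; exact h2.le) (Set.toFinite _)
    have hz : z ∈ w.toSubgraph.neighborSet (w.getVert i) := heq ▸ hyz
    exact w.mem_verts_toSubgraph.1 (w.toSubgraph.edge_vert (w.toSubgraph.adj_symm hz))
  by_contra hx
  obtain ⟨q⟩ := hG.preconnected u x
  obtain ⟨d, -, h1, h2⟩ := q.exists_boundary_dart {y | y ∈ w.support} w.start_mem_support hx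
  exact h2 (hclosed _ h1 _ d.adj)

theorem degN_eq_two_of_isSegment_of_leaf_of_leaf {V : Type*} [Finite V] {G : SimpleGraph V}
    (hG : G.Connected) {u v : V} (h : IsSegment G u v) (hu : IsLeafV G u) (hv : IsLeafV G v)
    {x : V} (hxu : x ≠ u) (hxv : x ≠ v) : degN G x = 2 := by
  obtain ⟨huv, -, -, w, hw, hdeg⟩ := h
  exact hdeg x (mem_support_of_leaf_of_leaf hG huv hu hv hw hdeg x) hxu hxv

theorem exists_degN_ne_two {V : Type*} [Fintype V] {G : SimpleGraph V} {u : V}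
    (hu : IsLeafV G u) : ∃ x, x ≠ u ∧ degN G x ≠ 2 := by
  classical
  by_contra! hcon
  have hd : ∀ x, G.degree x = degN G x := fun x => by
    rw [degN, Set.ncard_eq_toFinset_card', ← card_neighborFinset_eq_degree, neighborFinset]
  have h1 := G.sum_degrees_eq_twice_card_edges
  rw [← add_sum_erase _ _ (mem_univ u), hd, (hu : degN G u = 1),
    Finset.sum_congr rfl (g := fun _ => 2)
      (fun x hx => by rw [hd, hcon x (mem_erase.1 hx).1])] at h1
  rw [Finset.sum_const, smul_eq_mul] at h1
  omega

theorem exists_isSegment_of_leaf {V : Type*} [Fintype V] {G : SimpleGraph V} (hG : G.IsTree)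
    {u : V} (hu : IsLeafV G u) : ∃ x, IsSegment G u x := by
  classical
  obtain ⟨y, hyu, hy⟩ := exists_degN_ne_two hu
  obtain ⟨x, hx, hmin⟩ := ({x | x ≠ u ∧ degN G x ≠ 2} : Finset V).exists_min_image (G.dist u)
    ⟨y, by simp [hyu, hy]⟩
  simp only [mem_filter, mem_univ, true_and] at hx hmin
  have hpos : degN G x ≠ 0 := by
    intro h0
    rw [degN, Set.ncard_eq_zero] at h0
    obtain ⟨q⟩ := hG.connected.preconnected x u
    cases q with
    | nil => exact hx.1 rfl
    | @cons _ z _ h _ => exact (Set.eq_empty_iff_forall_notMem.1 h0 z) h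
  obtain ⟨w, hw, hlen⟩ := hG.connected.exists_path_of_dist u x
  refine ⟨x, hx.1.symm, Or.inl hu, ?_, w, hw, fun z hz hzu hzx => ?_⟩
  · have := hx.2
    unfold IsLeafV IsBranchV
    omega
  · by_contra hz2
    have h1 := hmin z ⟨hzu, hz2⟩
    have h2 := Walk.length_takeUntil_lt_length hz hzx
    have h3 := SimpleGraph.dist_le (w.takeUntil z hz)
    omega

/-- The unordered pairs of endpoints of segments. -/
noncomputable def segmentEnds {V : Type*} [Fintype V] (G : SimpleGraph V) : Finset (Sym2 V) :=
  (Set.toFinite {e : Sym2 V | ∃ u v, e = s(u, v) ∧ IsSegment G u v}).toFinset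

theorem mem_segmentEnds {V : Type*} [Fintype V] {G : SimpleGraph V} {e : Sym2 V} :
    e ∈ segmentEnds G ↔ ∃ u v, e = s(u, v) ∧ IsSegment G u v := by
  simp [segmentEnds]

theorem card_segmentMultiset {V : Type*} [Fintype V] (G : SimpleGraph V) :
    Multiset.card (segmentMultiset G) = #(segmentEnds G) := by
  simp [segmentMultiset, segmentEnds]

theorem dist_mem_segmentMultiset {V : Type*} [Fintype V] {G : SimpleGraph V} {u v : V}
    (h : IsSegment G u v) : G.dist u v ∈ segmentMultiset G :=
  Multiset.mem_map.2 ⟨s(u, v), mem_segmentEnds.2 ⟨u, v, rfl, h⟩, rfl⟩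

theorem card_leaves_le_card_segmentMultiset {V : Type*} [Fintype V] {G : SimpleGraph V}
    (hG : G.IsTree) (hm : 2 ≤ Multiset.card (segmentMultiset G)) :
    #(leaves G) ≤ Multiset.card (segmentMultiset G) := by
  rw [card_segmentMultiset] at hm ⊢
  choose! f hf using fun (u : V) (hu : IsLeafV G u) => exists_isSegment_of_leaf hG hu
  refine card_le_card_of_injOn (fun u => s(u, f u)) ?_ ?_
  · intro u hu
    exact mem_coe.2 (mem_segmentEnds.2 ⟨u, f u, rfl, hf u (mem_leaves.1 (mem_coe.1 hu))⟩)
  · intro u hu v hv h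
    have hu : IsLeafV G u := mem_leaves.1 (mem_coe.1 hu)
    have hv : IsLeafV G v := mem_leaves.1 (mem_coe.1 hv)
    rcases Sym2.eq_iff.1 h with h | ⟨-, h⟩
    · exact h.1
    · have hseg : IsSegment G u v := h ▸ hf u hu
      have hend : ∀ x, IsLeafV G x ∨ IsBranchV G x → x = u ∨ x = v := by
        intro x hx
        by_contra! hne
        have := degN_eq_two_of_isSegment_of_leaf_of_leaf hG.connected hseg hu hv hne.1 hne.2
        unfold IsLeafV IsBranchV at hx
        omega
      have hsub : segmentEnds G ⊆ {s(u, v)} := by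
        intro e he
        obtain ⟨a, b, rfl, hab, ha, hb, -⟩ := mem_segmentEnds.1 he
        rw [mem_singleton, Sym2.eq_iff]
        rcases hend a ha with rfl | rfl <;> rcases hend b hb with rfl | rfl <;> simp_all
      have := card_le_card hsub
      rw [card_singleton] at this
      omega

section Starlike

variable {V : Type*} [Fintype V] {G : SimpleGraph V} {v : V}

theorem not_leaf_of_isSegment_leaf (hG : G.Connected) (hv : IsBranchV G v) {a b : V}
    (h : IsSegment G a b) (ha : IsLeafV G a) : ¬ IsLeafV G b := by
  intro hb
  have hne : ∀ x, IsLeafV G x → v ≠ x := by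
    rintro x hx rfl
    unfold IsLeafV at hx
    unfold IsBranchV at hv
    omega
  have := degN_eq_two_of_isSegment_of_leaf_of_leaf hG h ha hb (hne a ha) (hne b hb)
  unfold IsBranchV at hv
  omega

theorem isSegment_leaf_branch (hG : G.IsTree) (hv : IsBranchV G v)
    (huniq : ∀ y, IsBranchV G y → y = v) {u : V} (hu : IsLeafV G u) : IsSegment G u v := by
  obtain ⟨x, hx⟩ := exists_isSegment_of_leaf hG hu
  rcases hx.2.2.1 with h | h
  · exact absurd h (not_leaf_of_isSegment_leaf hG.connected hv hx hu)
  · exact huniq x h ▸ hx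

theorem card_segmentMultiset_le_card_leaves (hG : G.IsTree) (hv : IsBranchV G v)
    (huniq : ∀ y, IsBranchV G y → y = v) :
    Multiset.card (segmentMultiset G) ≤ #(leaves G) := by
  classical
  rw [card_segmentMultiset]
  refine (card_le_card (t := (leaves G).image fun u => s(u, v)) ?_).trans card_image_le
  intro e he
  obtain ⟨a, b, rfl, hab⟩ := mem_segmentEnds.1 he
  rw [mem_image]
  rcases hab.2.1 with ha | ha <;> rcases hab.2.2.1 with hb | hb
  · exact absurd hb (not_leaf_of_isSegment_leaf hG.connected hv hab ha)
  · exact ⟨a, mem_leaves.2 ha, by rw [huniq b hb]⟩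
  · exact ⟨b, mem_leaves.2 hb, by rw [huniq a ha, Sym2.eq_swap]⟩
  · exact absurd ((huniq a ha).trans (huniq b hb).symm) hab.1

end Starlike

/-- Among all trees of order `n` with exactly `m ≥ 3` segments, the balanced
starlike tree (the starlike tree whose `m` segment lengths pairwise differ by at most 1)
minimizes the Steiner `k`-Wiener index for every `k ≥ 2`. -/
theorem balanced_starlike_minimizes_steinerWiener (k m n : ℕ)
    (hk : 2 ≤ k) (hm : 3 ≤ m) (hn : m + 1 ≤ n)
    {V : Type} [Fintype V] (Tstar : SimpleGraph V) (hTstar : Tstar.IsTree)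
    (hcardV : Fintype.card V = n)
    (hstarlike : ∃! v : V, IsBranchV Tstar v)
    (hmstar : Multiset.card (segmentMultiset Tstar) = m)
    (hbal : ∀ a ∈ segmentMultiset Tstar, ∀ b ∈ segmentMultiset Tstar, a ≤ b + 1)
    {W : Type} [Fintype W] (T : SimpleGraph W) (hT : T.IsTree)
    (hcardW : Fintype.card W = n)
    (hmT : Multiset.card (segmentMultiset T) = m) :
    steinerWiener Tstar k ≤ steinerWiener T k := by

  classical
  obtain ⟨v, hv, huniq⟩ := hstarlike
  obtain ⟨p, hp⟩ := exists_isParentMap hTstar v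
  obtain ⟨r, q, hq, hcent⟩ := exists_isParentMap_centroid hT
  have hdeg : ∀ w, w ≠ v → degN Tstar w ≤ 2 := by
    intro w hw
    by_contra! h
    exact hw (huniq w h)
  have hmL : m ≤ #(leaves Tstar) :=
    hmstar ▸ card_segmentMultiset_le_card_leaves hTstar hv huniq
  have hLm : #(leaves T) ≤ m := hmT ▸ card_leaves_le_card_segmentMultiset hT (by omega)
  obtain ⟨u, hu, hmax⟩ := (leaves Tstar).exists_max_image (Tstar.dist v)
    (card_pos.1 (by omega))
  have hmax : ∀ x, IsLeafV Tstar x → Tstar.dist v x ≤ Tstar.dist v u :=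
    fun x hx => hmax x (mem_leaves.2 hx)
  have hu := mem_leaves.1 hu
  have hmin : ∀ x, IsLeafV Tstar x → Tstar.dist v u ≤ Tstar.dist v x + 1 := by
    intro x hx
    rw [SimpleGraph.dist_comm, SimpleGraph.dist_comm (u := v) (v := x)]
    exact hbal _ (dist_mem_segmentMultiset (isSegment_leaf_branch hTstar hv huniq hu)) _
      (dist_mem_segmentMultiset (isSegment_leaf_branch hTstar hv huniq hx))
  have hmain : (steinerWiener Tstar k : ℤ) ≤ steinerWiener T k := by
    rw [hp.steinerWiener_eq (by omega), hq.steinerWiener_eq (by omega), hcardV, hcardW]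
    refine sum_le_sum_of_fiber_card_le (n := n) (Q := Tstar.dist v u)
      (by simp [card_erase_of_mem, hcardV, hcardW])
      (fun a b hab hb => splitCount_mono (by omega) hab hb) ?_ ?_ ?_ ?_
    · exact hcardV ▸ hp.two_mul_le_card hdeg (by omega) hu rfl hmax hmin
    · intro w hw
      obtain ⟨x, hx, hle⟩ := hp.exists_leaf_card_subtree_le hdeg (mem_erase.1 hw).1
      exact hle.trans (hmax x hx)
    · intro w hw
      exact hcardW ▸ hcent w (mem_erase.1 hw).1
    · intro j hj
      cases j with
      | zero =>
        refine le_of_eq_of_le (card_eq_zero.2 (filter_eq_empty_iff.2 fun w _ h => ?_))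
          (Nat.zero_le _)
        exact absurd (card_pos.2 ⟨w, self_mem_subtree q w⟩) (by omega)
      | succ j =>
        refine (hq.card_filter_subtree_le _).trans ((hLm.trans hmL).trans ?_)
        refine hp.card_leaves_le hdeg fun x hx => ?_
        have := hmin x hx
        omega
  exact_mod_cast hmain
end

section
/- Let T be a tree of order n in which some branch vertex v is the common endpoint of two pendant segments of lengths l_1 and l_2 with l_1 ≥ l_2 + 2 and l_2 ≥ 1. Let T′ be the tree obtained from T by replacing these two pendant segments at v by two pendant segments at v of lengths l_1 − 1 and l_2 + 1 (leaving the rest of T unchanged). Then for every integer k ≥ 2, SW_k(T′) ≤ SW_k(T), and the inequality is strict whenever k ≤ n − l_2 − 1. -/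
open SimpleGraph Finset

/-- The tree obtained from `R` by attaching two pendant paths, of lengths `l₁` and `l₂`
(i.e. with `l₁`, resp. `l₂`, edges), at the vertex `v` of `R`. -/
def attachTwoPaths {V : Type*} (R : SimpleGraph V) (v : V) (l₁ l₂ : ℕ) :
    SimpleGraph (V ⊕ (Fin l₁ ⊕ Fin l₂)) :=
  SimpleGraph.fromRel (fun x y =>
    (∃ a b, R.Adj a b ∧ x = Sum.inl a ∧ y = Sum.inl b) ∨
    (∃ i : Fin l₁, i.val = 0 ∧ x = Sum.inl v ∧ y = Sum.inr (Sum.inl i)) ∨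
    (∃ i j : Fin l₁, j.val = i.val + 1 ∧ x = Sum.inr (Sum.inl i) ∧ y = Sum.inr (Sum.inl j)) ∨
    (∃ i : Fin l₂, i.val = 0 ∧ x = Sum.inl v ∧ y = Sum.inr (Sum.inr i)) ∨
    (∃ i j : Fin l₂, j.val = i.val + 1 ∧ x = Sum.inr (Sum.inr i) ∧ y = Sum.inr (Sum.inr j)))

namespace SimpleGraph

variable {W : Type*} {G : SimpleGraph W} {r : W} {p : W → W} {h : W → ℕ} {D : W → W → Prop}

/-- `G` is the tree with root `r`, parent function `p` and descendant relation `D` (`D x y` says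
that `y` is a descendant of `x`); the function `h` decreases towards the root. -/
structure IsRootedTree (G : SimpleGraph W) (r : W) (p : W → W) (h : W → ℕ)
    (D : W → W → Prop) : Prop where
  lt : ∀ x, x ≠ r → h (p x) < h x
  adj_iff : ∀ a b, G.Adj a b ↔ (a ≠ r ∧ b = p a) ∨ (b ≠ r ∧ a = p b)
  desc_iff : ∀ x y, D x y ↔ y = x ∨ (y ≠ r ∧ D x (p y))

/-- A cut `D` separates `S` if `S` meets both `D` and its complement. -/
def Separates (D : W → Prop) (S : Finset W) : Prop := (∃ s ∈ S, D s) ∧ ∃ s ∈ S, ¬ D s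

namespace IsRootedTree

lemma induction_on (hG : IsRootedTree G r p h D) {P : W → Prop} (root : P r)
    (step : ∀ x, x ≠ r → P (p x) → P x) (x : W) : P x := by
  induction hn : h x using Nat.strong_induction_on generalizing x with
  | _ n ih =>
    by_cases hx : x = r
    · exact hx ▸ root
    · exact step x hx (ih _ (hn ▸ hG.lt x hx) _ rfl)

lemma desc_self (hG : IsRootedTree G r p h D) (x : W) : D x x := (hG.desc_iff x x).2 (.inl rfl)

lemma desc_root (hG : IsRootedTree G r p h D) (y : W) : D r y :=
  hG.induction_on (hG.desc_self r) (fun x hx hp => (hG.desc_iff r x).2 (.inr ⟨hx, hp⟩)) y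

lemma height_le (hG : IsRootedTree G r p h D) (x y : W) : D x y → h x ≤ h y := by
  refine hG.induction_on (P := fun y => D x y → h x ≤ h y) ?_ ?_ y
  · intro hd
    rcases (hG.desc_iff _ _).1 hd with rfl | ⟨h1, -⟩
    · rfl
    · exact absurd rfl h1
  · intro y hy ih hd
    rcases (hG.desc_iff _ _).1 hd with rfl | ⟨-, h2⟩
    · rfl
    · exact (ih h2).trans (hG.lt y hy).le

lemma not_desc_parent (hG : IsRootedTree G r p h D) {x : W} (hx : x ≠ r) : ¬ D x (p x) :=
  fun hd => (hG.height_le _ _ hd).not_gt (hG.lt x hx)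

lemma eq_of_adj_of_desc (hG : IsRootedTree G r p h D) {x a b : W} (hab : G.Adj a b)
    (ha : D x a) (hb : ¬ D x b) : a = x ∧ b = p x := by
  rcases (hG.adj_iff a b).1 hab with ⟨har, rfl⟩ | ⟨hbr, rfl⟩
  · rcases (hG.desc_iff _ _).1 ha with rfl | ⟨-, h2⟩
    · exact ⟨rfl, rfl⟩
    · exact absurd h2 hb
  · exact absurd ((hG.desc_iff _ _).2 (.inr ⟨hbr, ha⟩)) hb

lemma injOn_edge (hG : IsRootedTree G r p h D) :
    Set.InjOn (fun x => s(x, p x)) {x | x ≠ r} := by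
  intro x hx y hy hxy
  rcases Sym2.eq_iff.1 hxy with ⟨h1, -⟩ | ⟨h1, h2⟩
  · exact h1
  · have h3 := hG.lt x hx
    have h4 := hG.lt y hy
    rw [h2] at h3
    rw [← h1] at h4
    exact absurd h3 h4.not_gt

end IsRootedTree

lemma Subgraph.connected_iff_reflTransGen {H : G.Subgraph} :
    H.Connected ↔ H.verts.Nonempty ∧
      ∀ u ∈ H.verts, ∀ v ∈ H.verts, Relation.ReflTransGen H.Adj u v := by
  rw [Subgraph.connected_iff, and_comm, Subgraph.preconnected_iff]
  refine and_congr_right fun _ => ⟨fun hH u hu v hv => ?_, fun hH => ?_⟩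
  · have := (reachable_iff_reflTransGen _ _).1 (hH ⟨u, hu⟩ ⟨v, hv⟩)
    exact Relation.ReflTransGen.lift (r := H.coe.Adj) (p := H.Adj) (fun x => (x : W))
      (fun a b hab => hab) _ _ this
  · rintro ⟨u, hu⟩ ⟨v, hv⟩
    have key : ∀ w, Relation.ReflTransGen H.Adj u w → ∀ hw : w ∈ H.verts,
        H.coe.Reachable ⟨u, hu⟩ ⟨w, hw⟩ := by
      intro w hw
      induction hw with
      | refl => exact fun _ => Reachable.refl _
      | tail _ hbc ih =>
        intro hc
        exact (ih hbc.fst_mem).trans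
          (Adj.reachable (show H.coe.Adj ⟨_, hbc.fst_mem⟩ ⟨_, hc⟩ from hbc))
    exact key v (hH u hu v hv) hv

lemma Subgraph.connected_induce_of_retraction {H : G.Subgraph} (hH : H.Connected) {s : Set W}
    (hs : s ⊆ H.verts) (hne : s.Nonempty) (f : W → W) (hf : ∀ x ∈ s, f x = x)
    (hmem : ∀ x, f x ∈ s)
    (hadj : ∀ a b, H.Adj a b → f a = f b ∨ H.Adj (f a) (f b)) : (H.induce s).Connected := by
  rw [Subgraph.connected_iff_reflTransGen] at hH ⊢
  refine ⟨hne, fun u hu v hv => ?_⟩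
  have h1 := hH.2 u (hs hu) v (hs hv)
  rw [← hf u hu, ← hf v hv]
  clear hv
  induction h1 with
  | refl => exact .refl
  | tail _ hbc ih =>
    rcases hadj _ _ hbc with h2 | h2
    · rwa [← h2]
    · exact ih.tail ⟨hmem _, hmem _, h2⟩

lemma _root_.Relation.ReflTransGen.exists_boundary {α : Type*} {R : α → α → Prop} {P : α → Prop}
    {a b : α} (hab : Relation.ReflTransGen R a b) (ha : P a) (hb : ¬ P b) :
    ∃ c d, R c d ∧ P c ∧ ¬ P d := by
  induction hab with
  | refl => exact absurd ha hb
  | @tail c d _ hcd ih =>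
    by_cases hc : P c
    · exact ⟨c, d, hcd, hc, hb⟩
    · exact ih hc

namespace IsRootedTree

lemma connected_top (hG : IsRootedTree G r p h D) : (⊤ : G.Subgraph).Connected := by
  rw [Subgraph.connected_iff_reflTransGen]
  have key : ∀ x, Relation.ReflTransGen (⊤ : G.Subgraph).Adj x r := by
    refine hG.induction_on .refl fun x hx ih => ?_
    exact .head (Subgraph.top_adj.2 ((hG.adj_iff _ _).2 (.inl ⟨hx, rfl⟩))) ih
  refine ⟨⟨r, trivial⟩, fun u _ v _ => (key u).trans ?_⟩
  have : Std.Symm (⊤ : G.Subgraph).Adj := ⟨fun a b hab => hab.symm⟩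
  exact Relation.ReflTransGen.stdSymm.symm _ _ (key v)

lemma adj_of_separates (hG : IsRootedTree G r p h D) {H : G.Subgraph} (hH : H.Connected)
    {S : Finset W} (hS : ↑S ⊆ H.verts) {x : W} (hx : Separates (D x) S) : H.Adj x (p x) := by
  obtain ⟨⟨s, hs, hsD⟩, t, ht, htD⟩ := hx
  obtain ⟨a, b, hab, ha, hb⟩ :=
    ((Subgraph.connected_iff_reflTransGen.1 hH).2 s (hS hs) t (hS ht)).exists_boundary hsD htD
  obtain ⟨rfl, rfl⟩ := hG.eq_of_adj_of_desc hab.adj_sub ha hb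
  exact hab

/-- A non-separating edge of a connected subgraph containing `S` can be discarded. -/
lemma exists_smaller (hG : IsRootedTree G r p h D) {H : G.Subgraph} (hH : H.Connected)
    {S : Finset W} (hS : ↑S ⊆ H.verts) {x : W} (hxr : x ≠ r)
    (hxH : H.Adj x (p x)) (hx : ¬ Separates (D x) S) :
    ∃ H' ≤ H, H'.Connected ∧ ↑S ⊆ H'.verts ∧ ¬ H'.Adj x (p x) := by
  classical
  have hbd : ∀ a b, H.Adj a b → D x a → ¬ D x b → a = x ∧ b = p x :=
    fun a b hab => hG.eq_of_adj_of_desc hab.adj_sub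
  have hpx := hG.not_desc_parent hxr
  have hxx := hG.desc_self x
  by_cases hin : ∃ s ∈ S, D x s
  · have hall : ∀ s ∈ S, D x s := by
      by_contra! hcon
      exact hx ⟨hin, hcon⟩
    refine ⟨H.induce {y | y ∈ H.verts ∧ D x y}, ?_, ?_, fun s hs => ⟨hS hs, hall s hs⟩,
      fun hadj => hpx hadj.2.1.2⟩
    · exact ⟨fun y hy => hy.1, fun a b hab => hab.2.2⟩
    · refine Subgraph.connected_induce_of_retraction hH (fun y hy => hy.1)
        ⟨x, hxH.fst_mem, hxx⟩ (fun y => if y ∈ H.verts ∧ D x y then y else x) ?_ ?_ ?_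
      · exact fun y hy => if_pos hy
      · intro y
        split_ifs with hy
        · exact hy
        · exact ⟨hxH.fst_mem, hxx⟩
      · intro a b hab
        have := hbd a b hab
        have := hbd b a hab.symm
        have := hab.fst_mem
        have := hab.snd_mem
        by_cases ha : D x a <;> by_cases hb : D x b <;> simp_all
  · push Not at hin
    refine ⟨H.induce {y | y ∈ H.verts ∧ ¬ D x y}, ?_, ?_, fun s hs => ⟨hS hs, hin s hs⟩,
      fun hadj => hadj.1.2 hxx⟩
    · exact ⟨fun y hy => hy.1, fun a b hab => hab.2.2⟩
    · refine Subgraph.connected_induce_of_retraction hH (fun y hy => hy.1)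
        ⟨p x, hxH.snd_mem, hpx⟩ (fun y => if y ∈ H.verts ∧ ¬ D x y then y else p x) ?_ ?_ ?_
      · exact fun y hy => if_pos hy
      · intro y
        split_ifs with hy
        · exact hy
        · exact ⟨hxH.snd_mem, hpx⟩
      · intro a b hab
        have := hbd a b hab
        have := hbd b a hab.symm
        have := hab.fst_mem
        have := hab.snd_mem
        by_cases ha : D x a <;> by_cases hb : D x b <;> simp_all

lemma steinerDist_eq [Finite W] (hG : IsRootedTree G r p h D) (S : Finset W) :
    steinerDist G S = {x | Separates (D x) S}.ncard := by
  have hroot : ∀ x, Separates (D x) S → x ≠ r := by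
    rintro x ⟨-, t, -, ht⟩ rfl
    exact ht (hG.desc_root t)
  have hinj : Set.InjOn (fun x => s(x, p x)) {x | Separates (D x) S} :=
    hG.injOn_edge.mono fun x hx => hroot x hx
  rw [← hinj.ncard_image]
  refine IsLeast.csInf_eq ⟨?_, ?_⟩
  · obtain ⟨H, ⟨hH, hSH⟩, hmin⟩ := (Set.toFinite {H : G.Subgraph | H.Connected ∧ ↑S ⊆ H.verts})
      |>.exists_minimal ⟨⊤, hG.connected_top, fun _ _ => trivial⟩
    refine ⟨H, hH, hSH, congrArg Set.ncard ?_⟩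
    ext e
    constructor
    · have key : ∀ x, x ≠ r → H.Adj x (p x) → Separates (D x) S := by
        intro x hxr hx
        by_contra hsep
        obtain ⟨H', hle, hH', hS', hn⟩ := hG.exists_smaller hH hSH hxr hx hsep
        exact hn ((hmin ⟨hH', hS'⟩ hle).2 hx)
      induction e with
      | _ a b =>
        intro hab
        have hab : H.Adj a b := hab
        rcases (hG.adj_iff a b).1 hab.adj_sub with ⟨har, rfl⟩ | ⟨hbr, rfl⟩
        · exact ⟨a, key a har hab, rfl⟩
        · exact ⟨b, key b hbr hab.symm, Sym2.eq_swap⟩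
    · rintro ⟨x, hx, rfl⟩
      exact hG.adj_of_separates hH hSH hx
  · rintro n ⟨H, hH, hSH, rfl⟩
    refine Set.ncard_le_ncard ?_ (Set.toFinite _)
    rintro _ ⟨x, hx, rfl⟩
    exact hG.adj_of_separates hH hSH hx

lemma card_separates_add [Fintype W] (P : W → Prop) [DecidablePred P] {k : ℕ} (hk : 1 ≤ k)
    [DecidablePred (Separates P)] :
    #{S ∈ powersetCard k univ | Separates P S} +
      ((#{x | P x}).choose k + (Fintype.card W - #{x | P x}).choose k) =
      (Fintype.card W).choose k := by
  classical
  have hc : Fintype.card W - #{x | P x} = #{x | ¬ P x} := by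
    have := Finset.card_filter_add_card_filter_not (s := (univ : Finset W)) P
    rw [Finset.card_univ] at this
    lia
  rw [hc, ← card_powersetCard, ← card_powersetCard, ← card_univ, ← card_powersetCard,
    ← card_union_of_disjoint, ← card_union_of_disjoint]
  · congr 1
    ext S
    simp only [mem_union, Finset.mem_filter, mem_powersetCard, subset_iff, mem_univ, true_and,
      implies_true]
    simp only [Separates]
    constructor
    · tauto
    · intro hS
      by_cases h1 : ∃ s ∈ S, P s <;> by_cases h2 : ∃ s ∈ S, ¬ P s
      · exact .inl ⟨hS, h1, h2⟩
      · push Not at h2; tauto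
      · push Not at h1; tauto
      · push Not at h1; tauto
  · rw [Finset.disjoint_left]
    simp only [mem_union, Finset.mem_filter, mem_powersetCard, subset_iff, mem_univ, true_and,
      not_or, not_and]
    rintro S ⟨h1, ⟨s, hs, hP⟩, t, ht, hn⟩
    exact ⟨fun h2 => absurd (h2 ht) hn, fun h2 => absurd hP (h2 hs)⟩
  · rw [Finset.disjoint_left]
    simp only [mem_powersetCard, subset_iff, Finset.mem_filter, mem_univ, true_and, not_and]
    intro S h1 h2
    obtain ⟨s, hs⟩ := card_pos.1 (show 0 < #S by lia)
    exact absurd (h1.1 hs) (h2 hs)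

open Classical in
lemma steinerWiener_add [Fintype W] (hG : IsRootedTree G r p h D) {k : ℕ} (hk : 1 ≤ k) :
    steinerWiener G k + ∑ x, ((#{y | D x y}).choose k +
      (Fintype.card W - #{y | D x y}).choose k) =
      Fintype.card W * (Fintype.card W).choose k := by
  have h1 : steinerWiener G k = ∑ x, #{S ∈ powersetCard k univ | Separates (D x) S} := by
    simp_rw [Finset.card_filter]
    rw [sum_comm]
    refine sum_congr rfl fun S _ => ?_
    rw [hG.steinerDist_eq, ← Finset.card_filter, Set.ncard_eq_toFinset_card']
    simp
  rw [h1, ← sum_add_distrib, sum_congr rfl fun x _ => card_separates_add (D x) hk]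
  simp

end IsRootedTree

/-- Every tree can be rooted at any vertex. -/
lemma IsTree.exists_isRootedTree {R : SimpleGraph W} (hR : R.IsTree) (v : W) :
    ∃ p h D, IsRootedTree R v p h D := by
  classical
  choose f hf hf' using (hR.existsUnique_path · v)
  let p : W → W := fun x => if x = v then v else (f x).snd
  have hp : ∀ x, x ≠ v → p x = (f x).snd := fun x hx => if_neg hx
  have hpv : p v = v := if_pos rfl
  have hnil : ∀ x, x ≠ v → ¬ (f x).Nil := fun x hx => Walk.not_nil_of_ne hx
  refine ⟨p, fun x => (f x).length, fun x y => ∃ n, p^[n] y = x, ?_, ?_, ?_⟩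
  · intro x hx
    rw [hp x hx, ← hf' _ _ (hf x).tail, ← Walk.length_tail_add_one (hnil x hx)]
    exact Nat.lt_succ_self _
  · intro a b
    constructor
    · intro hab
      by_cases hb : b ∈ (f a).support
      · have ha : a ≠ v := by
          rintro rfl
          rw [← hf' _ .nil .nil] at hb
          simp at hb
          exact hab.ne hb.symm
        exact .inl ⟨ha, by rw [hp a ha]; exact hR.isAcyclic.eq_snd_of_adj_start (hf a) hab hb⟩
      · have hbv : b ≠ v := fun hbv => hb (hbv ▸ (f a).end_mem_support)
        refine .inr ⟨hbv, ?_⟩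
        rw [hp b hbv, ← hf' _ (.cons hab.symm (f a)) ((Walk.cons_isPath_iff _ _).2 ⟨hf a, hb⟩)]
        simp
    · rintro (⟨ha, rfl⟩ | ⟨hb, rfl⟩)
      · rw [hp a ha]
        exact Walk.adj_snd (hnil a ha)
      · rw [hp b hb]
        exact (Walk.adj_snd (hnil b hb)).symm
  · intro x y
    constructor
    · rintro ⟨n, hn⟩
      by_cases hy : y = v
      · subst hy
        rw [Function.iterate_fixed hpv] at hn
        exact .inl hn
      · cases n with
        | zero => exact .inl hn
        | succ n => exact .inr ⟨hy, n, hn⟩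
    · rintro (rfl | ⟨-, n, hn⟩)
      · exact ⟨0, rfl⟩
      · exact ⟨n + 1, hn⟩

end SimpleGraph

section Attach

variable {V : Type*} (v : V) {l₁ l₂ : ℕ}

/-- The parent function of `attachTwoPaths R v l₁ l₂`, given that of `R`. -/
def attachParent (p : V → V) : V ⊕ (Fin l₁ ⊕ Fin l₂) → V ⊕ (Fin l₁ ⊕ Fin l₂)
  | .inl a => .inl (p a)
  | .inr (.inl ⟨0, _⟩) => .inl v
  | .inr (.inl ⟨i + 1, hi⟩) => .inr (.inl ⟨i, by lia⟩)
  | .inr (.inr ⟨0, _⟩) => .inl v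
  | .inr (.inr ⟨i + 1, hi⟩) => .inr (.inr ⟨i, by lia⟩)

/-- The height function of `attachTwoPaths R v l₁ l₂`, given that of `R`. -/
def attachHeight (h : V → ℕ) : V ⊕ (Fin l₁ ⊕ Fin l₂) → ℕ
  | .inl a => h a
  | .inr (.inl i) => h v + i + 1
  | .inr (.inr i) => h v + i + 1

/-- The descendant relation of `attachTwoPaths R v l₁ l₂`, given that of `R`. -/
def attachDesc (D : V → V → Prop) :
    V ⊕ (Fin l₁ ⊕ Fin l₂) → V ⊕ (Fin l₁ ⊕ Fin l₂) → Prop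
  | .inl a, .inl b => D a b
  | .inl a, .inr _ => a = v
  | .inr (.inl i), .inr (.inl j) => i ≤ j
  | .inr (.inr i), .inr (.inr j) => i ≤ j
  | _, _ => False

variable {v} {R : SimpleGraph V} {p : V → V} {h : V → ℕ} {D : V → V → Prop}

lemma SimpleGraph.IsRootedTree.attachTwoPaths (hR : IsRootedTree R v p h D) :
    IsRootedTree (attachTwoPaths R v l₁ l₂) (.inl v) (attachParent v p) (attachHeight v h)
      (attachDesc v D) := by
  have hDv : ∀ a, D a v ↔ a = v := fun a => by
    rw [hR.desc_iff]; simp [eq_comm]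
  refine ⟨?_, ?_, ?_⟩
  · rintro (a | ⟨_ | i, hi⟩ | ⟨_ | i, hi⟩) hx
    · exact hR.lt a (by simpa using hx)
    all_goals simp [attachParent, attachHeight]
  · intro a b
    rcases a with (a | ⟨_ | i, hi⟩ | ⟨_ | i, hi⟩) <;>
      rcases b with (b | ⟨_ | j, hj⟩ | ⟨_ | j, hj⟩) <;>
      simp [_root_.attachTwoPaths, attachParent, SimpleGraph.fromRel_adj]
    · rw [R.adj_comm b a, or_self, hR.adj_iff]
      refine ⟨And.right, fun hab => ⟨?_, hab⟩⟩
      exact ((hR.adj_iff a b).2 hab).ne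
    all_goals lia
  · intro x y
    rcases x with (a | ⟨_ | i, hi⟩ | ⟨_ | i, hi⟩) <;>
      rcases y with (b | ⟨_ | j, hj⟩ | ⟨_ | j, hj⟩) <;>
      simp [attachDesc, attachParent, hDv]
    · exact hR.desc_iff a b
    all_goals lia

open Classical in
lemma sum_card_attachDesc [Fintype V] (hR : IsRootedTree R v p h D) (φ : ℕ → ℕ) :
    ∑ x : V ⊕ (Fin l₁ ⊕ Fin l₂), φ #{y | attachDesc v D x y} =
      ∑ a, φ (if a = v then Fintype.card V + (l₁ + l₂) else #{b | D a b}) +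
        (∑ i ∈ range l₁, φ (i + 1) + ∑ i ∈ range l₂, φ (i + 1)) := by
  have hrefl : ∀ l, ∑ i ∈ range l, φ (i + 1) = ∑ i : Fin l, φ (l - i) := fun l => by
    rw [← Finset.sum_range_reflect, Finset.sum_range]
    exact Finset.sum_congr rfl fun i _ => congrArg φ (by lia)
  rw [Fintype.sum_sum_type, Fintype.sum_sum_type, hrefl, hrefl]
  congr 1
  · refine sum_congr rfl fun a _ => congrArg φ ?_
    split_ifs with ha
    · subst ha
      rw [filter_true_of_mem fun y _ => hR.attachTwoPaths.desc_root y]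
      simp
    · refine Eq.trans (congrArg Finset.card ?_) (Finset.card_map Function.Embedding.inl)
      ext (y | y | y) <;> simp <;> simp [attachDesc, ha]
  · congr 1 <;> refine sum_congr rfl fun i _ => congrArg φ ?_
    · refine Eq.trans (congrArg Finset.card ?_) ((Finset.card_map
        (Function.Embedding.inl.trans Function.Embedding.inr)).trans (Fin.card_Ici i))
      ext (y | y | y) <;> simp <;> simp [attachDesc]
    · refine Eq.trans (congrArg Finset.card ?_) ((Finset.card_map
        (Function.Embedding.inr.trans Function.Embedding.inr)).trans (Fin.card_Ici i))
      ext (y | y | y) <;> simp <;> simp [attachDesc]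

lemma two_le_card_of_isBranchV [Fintype V] (hR : R.IsTree)
    (hb : IsBranchV (_root_.attachTwoPaths R v l₁ l₂) (.inl v)) : 2 ≤ Fintype.card V := by
  obtain ⟨p, h, D, hp⟩ := hR.exists_isRootedTree v
  by_contra! hcard
  have hsub : Subsingleton V := Fintype.card_le_one_iff_subsingleton.1 (by lia)
  have hfin : ∀ l, (({i : Fin l | i.val = 0} : Set (Fin l))).ncard ≤ 1 := fun l =>
    (Set.ncard_le_one_iff (Set.toFinite _)).2 fun ha hb => Fin.ext (ha.trans hb.symm)
  refine absurd hb ?_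
  rw [IsBranchV, degN, not_le]
  calc _ ≤ (Set.image (fun i => .inr (.inl i)) {i : Fin l₁ | i.val = 0} ∪
        Set.image (fun i => .inr (.inr i)) {i : Fin l₂ | i.val = 0} :
          Set (V ⊕ (Fin l₁ ⊕ Fin l₂))).ncard := by
        refine Set.ncard_le_ncard ?_ (Set.toFinite _)
        rintro (y | ⟨_ | i, hi⟩ | ⟨_ | i, hi⟩) hy
        · exact absurd (congrArg Sum.inl (Subsingleton.elim v y)) (SimpleGraph.Adj.ne (G := _root_.attachTwoPaths R v l₁ l₂) hy)
        all_goals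
          have := (hp.attachTwoPaths.adj_iff _ _).1 hy
          simp_all [attachParent]
    _ ≤ _ := Set.ncard_union_le _ _
    _ ≤ 1 + 1 := add_le_add ((Set.ncard_image_le (Set.toFinite _)).trans (hfin _))
        ((Set.ncard_image_le (Set.toFinite _)).trans (hfin _))
    _ < 3 := by lia

end Attach

lemma Nat.choose_add_choose_le_of_le {a c : ℕ} (hac : a ≤ c) (j t : ℕ) :
    (a + t).choose (j + 1) + c.choose (j + 1) ≤ a.choose (j + 1) + (c + t).choose (j + 1) := by
  induction t with
  | zero => rfl
  | succ t ih =>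
    have := Nat.choose_le_choose j (show a + t ≤ c + t by lia)
    rw [← add_assoc, ← add_assoc, Nat.choose_succ_succ', Nat.choose_succ_succ' (c + t)]
    lia

lemma Nat.choose_add_choose_lt_of_lt {a c : ℕ} (hac : a < c) {j t : ℕ} (hj : 1 ≤ j)
    (hjt : j ≤ c + t) :
    (a + (t + 1)).choose (j + 1) + c.choose (j + 1) <
      a.choose (j + 1) + (c + (t + 1)).choose (j + 1) := by
  have h1 := Nat.choose_add_choose_le_of_le hac.le j t
  have h2 : (a + t).choose j < (c + t).choose j := by
    obtain ⟨i, rfl⟩ : ∃ i, j = i + 1 := ⟨j - 1, by lia⟩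
    obtain ⟨m, hm⟩ : ∃ m, c + t = m + 1 := ⟨c + t - 1, by lia⟩
    rw [hm, Nat.choose_succ_succ']
    have h3 := Nat.choose_le_choose (i + 1) (show a + t ≤ m by lia)
    have h4 := Nat.choose_pos (show i ≤ m by lia)
    lia
  rw [← add_assoc, ← add_assoc, Nat.choose_succ_succ', Nat.choose_succ_succ' (c + t)]
  lia

/-- Let `T` be the tree obtained from a tree `R` by attaching two pendant
paths of lengths `l₁ ≥ l₂ + 2` and `l₂ ≥ 1` at a vertex `v`, which is a branch vertex of `T`
(so the two attached paths are pendant segments of `T`).  Replacing the two pendant segments by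
pendant segments of lengths `l₁ - 1` and `l₂ + 1` does not increase the Steiner `k`-Wiener
index for any `k ≥ 2`, and strictly decreases it whenever `k ≤ n - l₂ - 1`, where `n` is the
order of `T`. -/
theorem steinerWiener_balance_pendant_paths {V : Type} [Fintype V]
    (R : SimpleGraph V) (hR : R.IsTree) (v : V) (l₁ l₂ : ℕ)
    (hl₂ : 1 ≤ l₂) (hl₁ : l₂ + 2 ≤ l₁)
    (hbranch : IsBranchV (attachTwoPaths R v l₁ l₂) (Sum.inl v))
    (k : ℕ) (hk : 2 ≤ k) :
    steinerWiener (attachTwoPaths R v (l₁ - 1) (l₂ + 1)) k ≤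
      steinerWiener (attachTwoPaths R v l₁ l₂) k ∧
    (k ≤ Fintype.card (V ⊕ (Fin l₁ ⊕ Fin l₂)) - l₂ - 1 →
      steinerWiener (attachTwoPaths R v (l₁ - 1) (l₂ + 1)) k <
        steinerWiener (attachTwoPaths R v l₁ l₂) k) := by
  classical
  obtain ⟨p, h, D, hp⟩ := hR.exists_isRootedTree v
  have hV : 2 ≤ Fintype.card V := two_le_card_of_isBranchV hR hbranch
  obtain ⟨t, rfl⟩ : ∃ t, l₁ = l₂ + 2 + t := ⟨l₁ - (l₂ + 2), by lia⟩
  obtain ⟨j, rfl⟩ : ∃ j, k = j + 1 := ⟨k - 1, by lia⟩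
  rw [show l₂ + 2 + t - 1 = l₂ + 1 + t by lia] at *
  have h1 := (hp.attachTwoPaths (l₁ := l₂ + 2 + t) (l₂ := l₂)).steinerWiener_add
    (k := j + 1) (by lia)
  have h2 := (hp.attachTwoPaths (l₁ := l₂ + 1 + t) (l₂ := l₂ + 1)).steinerWiener_add
    (k := j + 1) (by lia)
  have hcard : Fintype.card (V ⊕ (Fin (l₂ + 2 + t) ⊕ Fin l₂)) =
      Fintype.card V + (l₂ + 2 + t + l₂) := by simp
  have hcard' : Fintype.card (V ⊕ (Fin (l₂ + 1 + t) ⊕ Fin (l₂ + 1))) =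
      Fintype.card V + (l₂ + 2 + t + l₂) := by simp; lia
  rw [hcard] at h1 ⊢
  rw [hcard'] at h2
  set n := Fintype.card V + (l₂ + 2 + t + l₂) with hn
  let φ : ℕ → ℕ := fun d => d.choose (j + 1) + (n - d).choose (j + 1)
  have s1 := sum_card_attachDesc (l₁ := l₂ + 2 + t) (l₂ := l₂) hp φ
  have s2 := sum_card_attachDesc (l₁ := l₂ + 1 + t) (l₂ := l₂ + 1) hp φ
  rw [show l₂ + 1 + t + (l₂ + 1) = l₂ + 2 + t + l₂ by lia, Finset.sum_range_succ _ l₂] at s2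
  rw [show l₂ + 2 + t = l₂ + 1 + t + 1 by lia, Finset.sum_range_succ _ (l₂ + 1 + t),
    show l₂ + 1 + t + 1 = l₂ + 2 + t by lia] at s1
  have e1 : φ (l₂ + 2 + t) = (l₂ + 1 + (t + 1)).choose (j + 1) +
      (Fintype.card V + l₂).choose (j + 1) := by
    simp only [φ]
    congr 2 <;> lia
  have e2 : φ (l₂ + 1) = (l₂ + 1).choose (j + 1) +
      (Fintype.card V + l₂ + (t + 1)).choose (j + 1) := by
    simp only [φ]
    congr 2; lia
  have hle := Nat.choose_add_choose_le_of_le (show l₂ + 1 ≤ Fintype.card V + l₂ by lia) j (t + 1)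
  refine ⟨by lia, fun hkn => ?_⟩
  have hlt := Nat.choose_add_choose_lt_of_lt (show l₂ + 1 < Fintype.card V + l₂ by lia)
    (show 1 ≤ j by lia) (show j ≤ Fintype.card V + l₂ + t by lia)
  lia
end
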